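/- Let k ≥ 1, let π₀ be a noncrossing matching of order k, and let (Ψ_π)_{π∈NC_n} for n ≥ k+1 be a family of wheel polynomials of order n satisfying Ψ_π(σ) = 1 if σ = π and Ψ_π(σ) = 0 if σ ≠ π, for all σ ∈ NC_n. Define F_{π₀}(w_1,…,w_k) = Σ_{a=(a_1,…,a_k)∈NC_k^+} C̃_{π₀,a} · ∏_{j=1}^k w_j^{2j−a_j}. Then for every n ≥ k+1, the sum Σ_{π∈E_n(π₀)} Ψ_π(1,1,…,1) equals the coefficient of the monomial z_1^0 z_2^2 z_3^4 ⋯ z_n^{2n−2} in the polynomial F_{π₀}(z_2,…,z_{k+1}) · ∏_{1≤i<j≤n}(z_j−z_i)(1+z_j+z_i z_j) · ∏_{j=k+2}^n (1+z_j). -/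

import Mathlib

open scoped BigOperators

open MvPolynomial

attribute [local instance 10] Classical.propDecidable

/-- A noncrossing matching of order `n`, on the points `0, …, 2n-1`
(representing the 1-indexed points `1, …, 2n`): a fixed-point-free involution
with no crossing `a < b < c < d`, `f a = c`, `f b = d`. -/
structure NCM (n : ℕ) where
  f : Fin (2 * n) → Fin (2 * n)
  invol : ∀ k, f (f k) = k
  nofix : ∀ k, f k ≠ k
  noncross : ∀ a b c d : Fin (2 * n), a < b → b < c → c < d → f a = c → f b = d → False

theorem NCM.ext' {n : ℕ} {π σ : NCM n} (h : π.f = σ.f) : π = σ := by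
  cases π; cases σ; simpa using h

noncomputable instance {n : ℕ} : Fintype (NCM n) :=
  Fintype.ofInjective NCM.f fun _ _ h => NCM.ext' h

/-- `q = e^{2πi/3}`. -/
noncomputable def q : ℂ := Complex.exp (2 * Real.pi * Complex.I / 3)

/-- A wheel polynomial of order `n`: homogeneous of total degree `n(n-1)` and
vanishing under every substitution `z_j := q² z_i`, `z_k := q⁴ z_i` for `i < j < k`. -/
def IsWheel (n : ℕ) (p : MvPolynomial (Fin (2 * n)) ℂ) : Prop :=
  p.IsHomogeneous (n * (n - 1)) ∧
  ∀ i j k : Fin (2 * n), i < j → j < k →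
    (aeval fun l : Fin (2 * n) =>
      if l = j then C (q ^ 2) * X i
      else if l = k then C (q ^ 4) * X i
      else (X l : MvPolynomial (Fin (2 * n)) ℂ)) p = 0

/-- The `π`-evaluation `p(π) = p(q^{-π_1}, …, q^{-π_{2n}})`, where the `k`-th coordinate
is `q⁻¹` if `π` matches `k` to the right and `q` if it matches `k` to the left. -/
noncomputable def evalNC {n : ℕ} (p : MvPolynomial (Fin (2 * n)) ℂ) (π : NCM n) : ℂ :=
  eval (fun k => if k < π.f k then q⁻¹ else q) p

/-- Evaluation of a polynomial with all variables set to `1`. -/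
noncomputable def evalOne {n : ℕ} (p : MvPolynomial (Fin (2 * n)) ℂ) : ℂ :=
  eval (fun _ => (1 : ℂ)) p

/-- The alternating sign matrix numbers `ASM(n) = ∏_{j=0}^{n-1} (3j+1)!/(n+j)!`. -/
noncomputable def ASM (n : ℕ) : ℂ :=
  ∏ j ∈ Finset.range n, ((3 * j + 1).factorial : ℂ) / ((n + j).factorial : ℂ)

/-- Cyclic successor on `Fin m`. -/
def fsucc {m : ℕ} (k : Fin m) : Fin m := ⟨((k : ℕ) + 1) % m, Nat.mod_lt _ k.pos⟩

/-- The Temperley–Lieb operator `e_k` (underlying function on points): if `π` matches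
`k` with `k+1` it is `π`; otherwise it matches `k ↔ k+1`, `π(k) ↔ π(k+1)` and agrees
with `π` elsewhere (indices cyclic modulo `2n`). -/
def eRaw {n : ℕ} (k : Fin (2 * n)) (π : NCM n) : Fin (2 * n) → Fin (2 * n) :=
  if π.f k = fsucc k then π.f
  else fun m =>
    if m = k then fsucc k
    else if m = fsucc k then k
    else if m = π.f k then π.f (fsucc k)
    else if m = π.f (fsucc k) then π.f k
    else π.f m

/-- The stationarity linear system `2n·v_π = Σ_{k=1}^{2n} Σ_{π' : e_k(π') = π} v_{π'}`. -/
def Stationary {n : ℕ} (v : NCM n → ℂ) : Prop :=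
  ∀ π : NCM n, ((2 * n : ℕ) : ℂ) * v π =
    ∑ k : Fin (2 * n), ∑ π' : NCM n, if eRaw k π' = π.f then v π' else 0

/-- A fixed-point-free involution on `2n` points has exactly `n` "openers". -/
theorem card_openers {n : ℕ} (π : NCM n) :
    (Finset.univ.filter fun k => k < π.f k).card = n := by
  classical
  have hcard : (Finset.univ.filter fun k : Fin (2 * n) => k < π.f k).card
      = (Finset.univ.filter fun k : Fin (2 * n) => π.f k < k).card := by
    apply Finset.card_bij (fun a _ => π.f a)
    · intro a ha
      simp only [Finset.mem_filter, Finset.mem_univ, true_and] at ha ⊢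
      rw [π.invol]; exact ha
    · intro a ha b hb hab
      have h := congrArg π.f hab
      rwa [π.invol, π.invol] at h
    · intro b hb
      simp only [Finset.mem_filter, Finset.mem_univ, true_and] at hb
      refine ⟨π.f b, ?_, π.invol b⟩
      simp only [Finset.mem_filter, Finset.mem_univ, true_and]
      rw [π.invol]; exact hb
  have hdisj : Disjoint (Finset.univ.filter fun k : Fin (2 * n) => k < π.f k)
      (Finset.univ.filter fun k : Fin (2 * n) => π.f k < k) := by
    rw [Finset.disjoint_left]
    intro a haA haB
    simp only [Finset.mem_filter, Finset.mem_univ, true_and] at haA haB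
    exact absurd (haA.trans haB) (lt_irrefl a)
  have hunion : (Finset.univ.filter fun k : Fin (2 * n) => k < π.f k)
      ∪ (Finset.univ.filter fun k : Fin (2 * n) => π.f k < k) = Finset.univ := by
    ext a
    simp only [Finset.mem_union, Finset.mem_filter, Finset.mem_univ, true_and, iff_true]
    rcases lt_trichotomy a (π.f a) with h | h | h
    · exact Or.inl h
    · exact absurd h.symm (π.nofix a)
    · exact Or.inr h
  have hc := Finset.card_union_of_disjoint hdisj
  rw [hunion, Finset.card_univ, Fintype.card_fin] at hc
  omega

/-- `π⁺ : Fin n → ℕ`, the increasing enumeration (with 1-indexed values) of the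
set of points matched to the right by `π`. -/
noncomputable def plus {n : ℕ} (π : NCM n) : Fin n → ℕ := fun i =>
  ((((Finset.univ.filter fun k => k < π.f k).orderIsoOfFin (card_openers π) i :
      { x // x ∈ Finset.univ.filter fun k => k < π.f k }) : Fin (2 * n)) : ℕ) + 1

/-- `χ(m) = 0, 1, -1` according as `m ≡ 0, 1, 2 (mod 3)`. -/
def chi (m : ℤ) : ℤ := if m % 3 = 0 then 0 else if m % 3 = 1 then 1 else -1

/-- `p_{j,k}(a) = #{m : j ≤ a_m < k} − (k−j−1)/2` (arguments `j`, `k` 1-indexed). -/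
def pjkSeq {N : ℕ} (a : Fin N → ℕ) (j k : ℕ) : ℤ :=
  ((Finset.univ.filter fun m : Fin N => j ≤ a m ∧ a m < k).card : ℤ)
    - (((k - j - 1) / 2 : ℕ) : ℤ)

/-- `C_{a,σ} = ∏_{j<k matched by σ} χ(p_{j,k}(a))`. -/
noncomputable def CmatSeq {N n : ℕ} (a : Fin N → ℕ) (σ : NCM n) : ℤ :=
  ∏ j : Fin (2 * n), ∏ k : Fin (2 * n),
    if j < k ∧ σ.f j = k then chi (pjkSeq a ((j : ℕ) + 1) ((k : ℕ) + 1)) else 1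

/-- The matrix `(C_{π,σ})` over `ℂ`. -/
noncomputable def CmatC (k : ℕ) : Matrix (NCM k) (NCM k) ℂ :=
  Matrix.of fun π σ => ((CmatSeq (plus π) σ : ℤ) : ℂ)

/-- The matrix `C̃ = C⁻¹`. -/
noncomputable def Ctilde (k : ℕ) : Matrix (NCM k) (NCM k) ℂ := (CmatC k)⁻¹

/-- `π ∈ E_n(π₀)`: the matching `π` contains `π₀` as a submatching on the
(1-indexed) sites `2, …, 2k+1`. -/
def inE {k n : ℕ} (π₀ : NCM k) (π : NCM n) : Prop :=
  ∀ (j : Fin (2 * k)) (h : (j : ℕ) + 1 < 2 * n),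
    (π.f ⟨(j : ℕ) + 1, h⟩ : ℕ) = (π₀.f j : ℕ) + 1

/-! ### Facts about `q` -/

theorem q_cube : q ^ 3 = 1 := by
  unfold q
  rw [← Complex.exp_nat_mul]
  rw [show ((3 : ℕ) : ℂ) * (2 * Real.pi * Complex.I / 3) = 2 * Real.pi * Complex.I by
    push_cast; ring]
  exact Complex.exp_two_pi_mul_I

theorem q_ne_one : q ≠ 1 := by
  have h : IsPrimitiveRoot q 3 := by
    have := Complex.isPrimitiveRoot_exp 3 (by norm_num)
    unfold q
    exact_mod_cast this
  exact h.ne_one (by norm_num)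

theorem q_rel : q ^ 2 + q + 1 = 0 := by
  have h : (q - 1) * (q ^ 2 + q + 1) = 0 := by
    linear_combination q_cube
  rcases mul_eq_zero.mp h with h | h
  · exact absurd (sub_eq_zero.mp h) q_ne_one
  · exact h

theorem q_ne_zero : q ≠ 0 := by
  intro h
  have := q_cube
  rw [h] at this
  norm_num at this

theorem q_inv : q⁻¹ = q ^ 2 := by
  have h := q_cube
  field_simp [q_ne_zero]
  linear_combination - h

theorem q_four : q ^ 4 = q := by linear_combination q * q_cube

theorem q_sq_ne_one : q ^ 2 ≠ 1 := by
  intro h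
  apply q_ne_one
  linear_combination q_cube - q * h

theorem q_sq_ne_q : q ^ 2 ≠ q := by
  intro h
  apply q_ne_one
  have : q * (q - 1) = 0 := by linear_combination h
  rcases mul_eq_zero.mp this with h | h
  · exact absurd h q_ne_zero
  · exact sub_eq_zero.mp h

theorem q_norm : ‖q‖ = 1 := by
  have := congrArg norm q_cube
  rw [norm_pow, norm_one] at this
  exact (pow_eq_one_iff_of_nonneg (norm_nonneg _) (by norm_num)).mp this

/-! ### Tools for multivariate polynomials -/

/-- Two polynomials that agree where a nonzero polynomial does not vanish are equal. -/
theorem poly_eq_of_generic {ι : Type} {f g h : MvPolynomial ι ℂ} (hh : h ≠ 0)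
    (H : ∀ z, eval z h ≠ 0 → eval z f = eval z g) : f = g := by
  have : (f - g) * h = 0 := by
    apply MvPolynomial.funext
    intro z
    by_cases hz : eval z h = 0
    · simp [hz]
    · simp [H z hz]
  rcases mul_eq_zero.mp this with h1 | h1
  · exact sub_eq_zero.mp h1
  · exact absurd h1 hh

/-- A polynomial in `ι` seen through a substitution of polynomials. -/
theorem eval_aeval {ι κ : Type} (F : ι → MvPolynomial κ ℂ) (p : MvPolynomial ι ℂ) (z : κ → ℂ) :
    eval z (aeval F p) = eval (fun i => eval z (F i)) p := by
  induction p using MvPolynomial.induction_on with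
  | C a => simp
  | add p q hp hq => rw [map_add, map_add, hp, hq, map_add]
  | mul_X p i hp => rw [map_mul, map_mul, hp, map_mul, aeval_X, eval_X]

/-- `g` does not involve the variable `l`. -/
def Indep {ι : Type} (l : ι) (g : MvPolynomial ι ℂ) : Prop :=
  ∀ (z : ι → ℂ) (v : ℂ), eval (Function.update z l v) g = eval z g

theorem linform_dvd {ι : Type} (l : ι) (g : MvPolynomial ι ℂ) (hg : Indep l g)
    (p : MvPolynomial ι ℂ) (H : ∀ z, z l = eval z g → eval z p = 0) : (X l - g) ∣ p := by
  have key : (X l - g) ∣ p - aeval (fun m => if m = l then g else X m) p := by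
    rw [← Ideal.mem_span_singleton, ← Ideal.Quotient.eq]
    have : (Ideal.Quotient.mkₐ ℂ (Ideal.span {X l - g})) =
        (Ideal.Quotient.mkₐ ℂ (Ideal.span {X l - g})).comp
          (aeval (fun m => if m = l then g else X m)) := by
      ext m
      simp only [Ideal.Quotient.mkₐ_eq_mk, AlgHom.coe_comp, Function.comp_apply, aeval_X]
      split_ifs with h
      · rw [Ideal.Quotient.eq, Ideal.mem_span_singleton, h]
      · rfl
    exact DFunLike.congr_fun this p
  have h0 : aeval (fun m => if m = l then g else X m) p = 0 := by
    apply MvPolynomial.funext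
    intro z
    rw [eval_aeval, map_zero]
    have : (fun i => eval z (if i = l then g else X i)) = Function.update z l (eval z g) := by
      ext i
      by_cases h : i = l
      · subst h; simp
      · simp [h]
    rw [this]
    apply H
    rw [hg]; simp
  rwa [h0, sub_zero] at key

theorem linform_eval_eq {ι : Type} {l : ι} {g : MvPolynomial ι ℂ} (z : ι → ℂ) :
    eval z (X l - g) = 0 ↔ z l = eval z g := by
  rw [map_sub, eval_X, sub_eq_zero]

theorem linform_prime {ι : Type} (l : ι) (g : MvPolynomial ι ℂ) (hg : Indep l g) :
    Prime (X l - g) := by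
  refine ⟨?_, ?_, ?_⟩
  · intro h
    have h1 := congrArg (eval (Function.update 0 l (eval 0 g + 1))) h
    rw [map_sub, eval_X, hg] at h1
    simp at h1
  · intro h
    have h1 := h.map (eval (Function.update 0 l (eval 0 g)))
    rw [map_sub, eval_X, hg] at h1
    simp at h1
  · intro a b hab
    let s : MvPolynomial ι ℂ →ₐ[ℂ] MvPolynomial ι ℂ := aeval (fun m => if m = l then g else X m)
    have hs : ∀ p z, eval z (s p) = eval (Function.update z l (eval z g)) p := by
      intro p z
      rw [eval_aeval]
      congr 2
      ext i
      by_cases h : i = l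
      · subst h; simp
      · simp [h]
    have h0 : s a * s b = 0 := by
      rw [← map_mul]
      apply MvPolynomial.funext
      intro z
      rw [hs]
      obtain ⟨c, hc⟩ := hab
      rw [hc, map_mul, map_sub, eval_X, hg]
      simp
    have back : ∀ p, s p = 0 → (X l - g) ∣ p := by
      intro p hp
      apply linform_dvd l g hg
      intro z hz
      have := hs p z
      rw [hp, ← hz, Function.update_eq_self] at this
      simpa using this.symm
    rcases mul_eq_zero.mp h0 with h | h
    · exact Or.inl (back a h)
    · exact Or.inr (back b h)

/-- Product of distinct linear forms dividing a polynomial. -/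
theorem linform_prod_dvd {ι T : Type} (s : Finset T) (l : T → ι) (g : T → MvPolynomial ι ℂ)
    (hg : ∀ t ∈ s, Indep (l t) (g t)) (p : MvPolynomial ι ℂ)
    (H : ∀ t ∈ s, ∀ z, z (l t) = eval z (g t) → eval z p = 0)
    (hd : ∀ t ∈ s, ∀ t' ∈ s, t ≠ t' → ∃ z, z (l t) = eval z (g t) ∧ z (l t') ≠ eval z (g t')) :
    (∏ t ∈ s, (X (l t) - g t)) ∣ p := by
  apply Finset.prod_dvd_of_isRelPrime
  · intro t ht t' ht' hne
    rw [Function.onFun, (linform_prime _ _ (hg t ht)).irreducible.isRelPrime_iff_not_dvd]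
    rintro ⟨c, hc⟩
    obtain ⟨z, h1, h2⟩ := hd t ht t' ht' hne
    apply h2
    rw [← linform_eval_eq, hc, map_mul, (linform_eval_eq z).mpr h1, zero_mul]
  · intro t ht
    exact linform_dvd _ _ (hg t ht) _ (H t ht)
  
theorem linform_totalDegree {ι : Type} (l : ι) (g : MvPolynomial ι ℂ) (hg : Indep l g) :
    1 ≤ (X l - g).totalDegree := by
  by_contra h
  have h0 : (X l - g).totalDegree = 0 := by omega
  rw [totalDegree_eq_zero_iff_eq_C] at h0
  have h1 := congrArg (eval (Function.update 0 l (eval 0 g + 1))) h0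
  have h2 := congrArg (eval (Function.update 0 l (eval 0 g))) h0
  rw [map_sub, eval_X, hg, eval_C] at h1 h2
  simp at h1 h2
  rw [h2] at h1
  norm_num at h1

theorem linform_prod_totalDegree {ι T : Type} (s : Finset T) (l : T → ι) (g : T → MvPolynomial ι ℂ)
    (hg : ∀ t ∈ s, Indep (l t) (g t)) :
    s.card ≤ (∏ t ∈ s, (X (l t) - g t)).totalDegree := by
  induction s using Finset.induction_on with
  | empty => simp
  | insert a s ha ih =>
    rw [Finset.prod_insert ha, Finset.card_insert_of_notMem ha]
    have h1 := ih (fun t ht => hg t (Finset.mem_insert_of_mem ht))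
    have h2 := linform_totalDegree _ _ (hg a (Finset.mem_insert_self _ _))
    rw [totalDegree_mul_of_isDomain (linform_prime _ _ (hg a (Finset.mem_insert_self _ _))).ne_zero
      (Finset.prod_ne_zero_iff.mpr fun t ht =>
        (linform_prime _ _ (hg t (Finset.mem_insert_of_mem ht))).ne_zero)]
    omega

theorem indep_C {ι : Type} (l : ι) (c : ℂ) : Indep l (C c) := by
  intro z v; simp

theorem indep_X {ι : Type} {l m : ι} (h : m ≠ l) (c : ℂ) : Indep l (C c * X m) := by
  intro z v; simp [h]


/-! ### Wheel polynomials: uniqueness -/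

/-- Pointwise form of the wheel condition. -/
def WheelFun {ι : Type} [LinearOrder ι] (p : MvPolynomial ι ℂ) : Prop :=
  ∀ (i j k : ι) (z : ι → ℂ), i < j → j < k → z j = q ^ 2 * z i → z k = q * z i → eval z p = 0

theorem totalDegree_aeval_le {ι κ : Type} (F : ι → MvPolynomial κ ℂ)
    (hF : ∀ i, (F i).totalDegree ≤ 1) (p : MvPolynomial ι ℂ) :
    (aeval F p).totalDegree ≤ p.totalDegree := by
  rw [aeval_def, eval₂_eq]
  apply totalDegree_finsetSum_le
  intro d hd
  refine (totalDegree_mul _ _).trans ?_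
  rw [algebraMap_eq, totalDegree_C, zero_add]
  refine (totalDegree_finsetProd _ _).trans ?_
  refine le_trans ?_ (le_totalDegree hd)
  rw [Finsupp.sum]
  apply Finset.sum_le_sum
  intro i _
  refine (totalDegree_pow _ _).trans ?_
  nlinarith [hF i]

/-- The substitution onto the wheel locus. -/
noncomputable def wsub {ι : Type} [LinearOrder ι] (i j k : ι) (l : ι) : MvPolynomial ι ℂ :=
  if l = j then C (q ^ 2) * X i else if l = k then C q * X i else X l

theorem wsub_eval {ι : Type} [LinearOrder ι] {i j k : ι} (hij : i < j) (hjk : j < k) (z : ι → ℂ) :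
    (eval z (wsub i j k j) = q ^ 2 * eval z (wsub i j k i)) ∧
    (eval z (wsub i j k k) = q * eval z (wsub i j k i)) := by
  have h1 : i ≠ j := hij.ne
  have h2 : i ≠ k := (hij.trans hjk).ne
  have h3 : k ≠ j := hjk.ne'
  simp [wsub, h1, h2, h3]

theorem wsub_fix {ι : Type} [LinearOrder ι] {i j k : ι} (z : ι → ℂ)
    (h1 : z j = q ^ 2 * z i) (h2 : z k = q * z i) : (fun l => eval z (wsub i j k l)) = z := by
  ext l
  unfold wsub
  split_ifs with h h'
  · subst h; simp [h1]
  · subst h'; simp [h2]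
  · simp

theorem wheelFun_iff {ι : Type} [LinearOrder ι] (p : MvPolynomial ι ℂ) :
    WheelFun p ↔ ∀ i j k : ι, i < j → j < k → aeval (wsub i j k) p = 0 := by
  constructor
  · intro h i j k hij hjk
    apply MvPolynomial.funext
    intro z
    rw [eval_aeval, map_zero]
    exact h i j k _ hij hjk (wsub_eval hij hjk z).1 (wsub_eval hij hjk z).2
  · intro h i j k z hij hjk h1 h2
    have := eval_aeval (wsub i j k) p z
    rw [h i j k hij hjk, wsub_fix z h1 h2] at this
    simpa using this.symm

theorem wheel_of_mul {ι : Type} [LinearOrder ι] (D r : MvPolynomial ι ℂ)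
    (h : WheelFun (D * r))
    (hD : ∀ i j k : ι, i < j → j < k → ∃ z : ι → ℂ, z j = q ^ 2 * z i ∧ z k = q * z i ∧
      eval z D ≠ 0) : WheelFun r := by
  rw [wheelFun_iff] at h ⊢
  intro i j k hij hjk
  have h1 := h i j k hij hjk
  rw [map_mul] at h1
  rcases mul_eq_zero.mp h1 with h2 | h2
  · exfalso
    obtain ⟨z, hz1, hz2, hz3⟩ := hD i j k hij hjk
    apply hz3
    have := eval_aeval (wsub i j k) D z
    rw [h2, wsub_fix z hz1 hz2] at this
    simpa using this.symm
  · exact h2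

theorem IsWheel.wheelFun {n : ℕ} {p : MvPolynomial (Fin (2 * n)) ℂ} (h : IsWheel n p) :
    WheelFun p := by
  rw [wheelFun_iff]
  intro i j k hij hjk
  have := h.2 i j k hij hjk
  rw [q_four] at this
  exact this

/-- Extend `z'` on `ι'` to `ι` by the values `c`, `q² c` at `i`, `j`. -/
noncomputable def extP {ι ι' : Type} (e : ι' → ι) (i j : ι) (c : ℂ) (l : ι) : MvPolynomial ι' ℂ :=
  if l = i then C c else if l = j then C (q ^ 2 * c)
  else if h : ∃ l', e l' = l then X h.choose else 0

noncomputable def extZ {ι ι' : Type} (e : ι' → ι) (i j : ι) (c : ℂ) (z : ι' → ℂ) (l : ι) : ℂ :=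
  eval z (extP e i j c l)

theorem extZ_i {ι ι' : Type} (e : ι' → ι) (i j : ι) (c : ℂ) (z : ι' → ℂ) :
    extZ e i j c z i = c := by simp [extZ, extP]

theorem extZ_j {ι ι' : Type} (e : ι' → ι) {i j : ι} (h : i ≠ j) (c : ℂ) (z : ι' → ℂ) :
    extZ e i j c z j = q ^ 2 * c := by simp [extZ, extP, h.symm]

theorem extZ_e {ι ι' : Type} (e : ι' → ι) (he : Function.Injective e) {i j : ι}
    (hi : ∀ l, e l ≠ i) (hj : ∀ l, e l ≠ j) (c : ℂ) (z : ι' → ℂ) (l : ι') :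
    extZ e i j c z (e l) = z l := by
  have h : ∃ l', e l' = e l := ⟨l, rfl⟩
  simp only [extZ, extP, hi, hj, if_false, dif_pos h, eval_X]
  rw [he h.choose_spec]

theorem extP_deg {ι ι' : Type} (e : ι' → ι) (i j : ι) (c : ℂ) (l : ι) :
    (extP e i j c l).totalDegree ≤ 1 := by
  unfold extP
  split_ifs
  · simp
  · rw [totalDegree_C]; omega
  · exact (totalDegree_X _).le
  · simp

theorem extZ_unique {ι ι' : Type} (e : ι' → ι) (he : Function.Injective e) {i j : ι} (hne : i ≠ j)
    (hi : ∀ l, e l ≠ i) (hj : ∀ l, e l ≠ j) (hs : ∀ l, l = i ∨ l = j ∨ ∃ l', e l' = l) (c : ℂ)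
    (w : ι → ℂ) (h1 : w i = c) (h2 : w j = q ^ 2 * c) : extZ e i j c (w ∘ e) = w := by
  ext l
  rcases hs l with rfl | rfl | ⟨l', rfl⟩
  · rw [extZ_i, h1]
  · rw [extZ_j e hne, h2]
  · rw [extZ_e e he hi hj]; rfl

theorem restrict_div {ι ι' T : Type} [LinearOrder ι] [LinearOrder ι'] (e : ι' → ι)
    (he : StrictMono e) {i j : ι}
    (hi : ∀ l, e l ≠ i) (hj : ∀ l, e l ≠ j) (c : ℂ) (p : MvPolynomial ι ℂ) (hp : WheelFun p)
    (s : Finset T) (l : T → ι') (a : T → ℂ)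
    (hinj : ∀ t ∈ s, ∀ t' ∈ s, l t = l t' → a t = a t' → t = t')
    (H : ∀ t ∈ s, ∀ z, z (l t) = a t → eval (extZ e i j c z) p = 0) :
    ∃ r : MvPolynomial ι' ℂ, WheelFun r ∧ (r = 0 ∨ r.totalDegree + s.card ≤ p.totalDegree) ∧
      ∀ z, eval (extZ e i j c z) p = (∏ t ∈ s, (z (l t) - a t)) * eval z r := by
  have hev : ∀ z, eval (extZ e i j c z) p = eval z (aeval (extP e i j c) p) := by
    intro z
    rw [eval_aeval]; rfl
  have hdvd : (∏ t ∈ s, (X (l t) - C (a t))) ∣ aeval (extP e i j c) p := by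
    apply linform_prod_dvd s l (fun t => C (a t))
    · intro t _; exact indep_C _ _
    · intro t ht z hz
      rw [← hev]
      apply H t ht
      simpa using hz
    · intro t ht t' ht' hne
      by_cases h : l t = l t'
      · refine ⟨fun _ => a t, by simp, ?_⟩
        simp only [eval_C]
        intro h'
        exact hne (hinj t ht t' ht' h h')
      · refine ⟨Function.update (fun _ => a t) (l t') (a t' + 1), ?_, ?_⟩
        · rw [Function.update_of_ne h]; simp
        · simp
  obtain ⟨r, hr⟩ := hdvd
  have hprod : ∀ z, eval z (∏ t ∈ s, (X (l t) - C (a t)) : MvPolynomial ι' ℂ)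
      = ∏ t ∈ s, (z (l t) - a t) := by
    intro z; simp [map_prod]
  refine ⟨r, ?_, ?_, ?_⟩
  · apply wheel_of_mul (∏ t ∈ s, (X (l t) - C (a t))) r
    · rw [← hr]
      intro i' j' k' z hij hjk h1 h2
      rw [← hev]
      apply hp (e i') (e j') (e k') _ (he hij) (he hjk)
      · rw [extZ_e e he.injective hi hj, extZ_e e he.injective hi hj, h1]
      · rw [extZ_e e he.injective hi hj, extZ_e e he.injective hi hj, h2]
    · intro i' j' k' hij hjk
      -- choose a scale large enough
      obtain ⟨x, hx⟩ : ∃ x : ℂ, x ∉ (s.image a ∪ s.image (fun t => q * a t) ∪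
          s.image (fun t => q ^ 2 * a t) : Finset ℂ) := Infinite.exists_notMem_finset _
      simp only [Finset.mem_union, Finset.mem_image, not_or, not_exists, not_and] at hx
      refine ⟨fun m => if m = j' then q ^ 2 * x else if m = k' then q * x else x, ?_, ?_, ?_⟩
      · simp [hij.ne, (hij.trans hjk).ne]
      · simp [hij.ne, (hij.trans hjk).ne, hjk.ne']
      · rw [hprod, Finset.prod_ne_zero_iff]
        intro t ht h0
        rw [sub_eq_zero] at h0
        split_ifs at h0
        · apply hx.1.2 t ht
          rw [← h0]; linear_combination x * q_cube
        · apply hx.2 t ht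
          rw [← h0]; linear_combination x * q_cube
        · exact hx.1.1 t ht h0.symm
  · by_cases h0 : r = 0
    · exact Or.inl h0
    · right
      have hp0 : (∏ t ∈ s, (X (l t) - C (a t)) : MvPolynomial ι' ℂ) ≠ 0 :=
        Finset.prod_ne_zero_iff.mpr fun t _ => (linform_prime _ _ (indep_C _ _)).ne_zero
      have h1 := totalDegree_mul_of_isDomain hp0 h0
      rw [← hr] at h1
      have h2 := totalDegree_aeval_le _ (extP_deg e i j c) p
      have h3 := linform_prod_totalDegree s l (fun t => (C (a t) : MvPolynomial ι' ℂ))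
        (fun t _ => indep_C _ _)
      omega
  · intro z
    rw [hev, hr, map_mul, hprod]

theorem vanish_all_of_ne {ι : Type} (p : MvPolynomial ι ℂ) {i j : ι} (hij : i ≠ j)
    (H : ∀ z : ι → ℂ, z i ≠ 0 → z j = q ^ 2 * z i → eval z p = 0) :
    ∀ z : ι → ℂ, z j = q ^ 2 * z i → eval z p = 0 := by
  have h1 : (X j - C (q ^ 2) * X i) ∣ X i * p := by
    apply linform_dvd _ _ (indep_X hij _)
    intro z hz
    simp only [map_mul, eval_C, eval_X] at hz ⊢
    by_cases h0 : z i = 0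
    · rw [h0, zero_mul]
    · rw [H z h0 hz, mul_zero]
  intro z hz
  rcases (linform_prime _ _ (indep_X hij _)).dvd_or_dvd h1 with ⟨r, h⟩ | ⟨r, h⟩
  · exfalso
    have := congrArg (eval (fun l => if l = j then q ^ 2 else 1)) h
    simp [hij] at this
  · rw [h, map_mul]
    simp [hz]

/-- minimal degree of wheel polynomials in `N` variables -/
def minDeg (N : ℕ) : ℕ := (N - 1) ^ 2 / 4

theorem minDeg_step (N : ℕ) : minDeg (N + 3) = minDeg (N + 1) + (N + 1) := by
  unfold minDeg
  have : (N + 3 - 1) ^ 2 = (N + 1 - 1) ^ 2 + (N + 1) * 4 := by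
    simp only [Nat.add_sub_cancel]
    rw [show N + 3 - 1 = N + 2 by omega]
    ring
  rw [this, Nat.add_mul_div_right _ _ (by norm_num)]

def LemA (N : ℕ) : Prop := ∀ (ι : Type) [Fintype ι] [LinearOrder ι] (p : MvPolynomial ι ℂ),
  Fintype.card ι = N → WheelFun p → p.totalDegree < minDeg N → p = 0

theorem pair_vanish {N : ℕ} (hA : LemA (N + 1)) {ι : Type} [Fintype ι] [LinearOrder ι]
    (p : MvPolynomial ι ℂ) (hc : Fintype.card ι = N + 3) (hp : WheelFun p) {i j : ι} (hij : i < j)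
    (h1 : ∀ l, i < l → l < j → ∀ z : ι → ℂ, z l = q ^ 2 * z i → eval z p = 0)
    (h2 : ∀ l, i < l → l < j → ∀ z : ι → ℂ, z j = q ^ 2 * z l → eval z p = 0)
    (hd : p.totalDegree < minDeg (N + 3) ∨
      (p.totalDegree ≤ minDeg (N + 3) ∧ ∃ l, i < l ∧ l < j)) :
    ∀ z : ι → ℂ, z j = q ^ 2 * z i → eval z p = 0 := by
  apply vanish_all_of_ne p hij.ne
  intro w hw0 hw
  let ι' := {l : ι // l ≠ i ∧ l ≠ j}
  have hcard : Fintype.card ι' = N + 1 := by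
    have : Fintype.card ι' = (Finset.univ \ {i, j} : Finset ι).card := by
      rw [Fintype.card_subtype]
      congr 1
      ext l
      simp
    rw [this, Finset.card_sdiff_of_subset (Finset.subset_univ _), Finset.card_univ, hc,
      Finset.card_pair hij.ne]
    omega
  let e : ι' → ι := Subtype.val
  have he : StrictMono e := fun _ _ h => h
  have hi : ∀ l : ι', e l ≠ i := fun l => l.2.1
  have hj : ∀ l : ι', e l ≠ j := fun l => l.2.2
  have hs : ∀ l, l = i ∨ l = j ∨ ∃ l' : ι', e l' = l := by
    intro l
    by_cases ha : l = i
    · exact Or.inl ha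
    · by_cases hb : l = j
      · exact Or.inr (Or.inl hb)
      · exact Or.inr (Or.inr ⟨⟨l, ha, hb⟩, rfl⟩)
  set c := w i with hcdef
  let btw : ι' → Prop := fun l => i < e l ∧ e l < j
  let s : Finset (ι' × Bool) := Finset.univ.filter fun t => t.2 = false ∨ btw t.1
  let a : ι' × Bool → ℂ := fun t => if btw t.1 then (if t.2 then c else q ^ 2 * c) else q * c
  obtain ⟨r, hr1, hr2, hr3⟩ := restrict_div e he hi hj c p hp s Prod.fst a (by
    rintro ⟨l, b⟩ ht ⟨l', b'⟩ ht' hl ha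
    simp only [s, Finset.mem_filter, Finset.mem_univ, true_and] at ht ht'
    simp only at hl
    subst hl
    simp only [Prod.mk.injEq, true_and]
    by_cases hb : btw l
    · simp only [a, hb, if_true] at ha
      have hne : q ^ 2 * c ≠ c := by
        intro h
        apply q_sq_ne_one
        exact mul_right_cancel₀ hw0 (by rw [h, one_mul])
      cases b <;> cases b' <;> simp at ha ⊢
      · exact hne ha
      · exact hne ha.symm
    · simp only [hb, or_false] at ht ht'
      rw [ht, ht']) (by
    rintro ⟨l, b⟩ ht z hz
    simp only [s, Finset.mem_filter, Finset.mem_univ, true_and] at ht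
    have e1 := extZ_i e i j c z
    have e2 := extZ_j e hij.ne c z
    have e3 := extZ_e e he.injective hi hj c z l
    simp only at hz
    rw [hz] at e3
    by_cases hb : btw l
    · simp only [a, hb, if_true] at e3
      cases b
      · apply h1 _ hb.1 hb.2
        rw [e3, e1]; simp
      · apply h2 _ hb.1 hb.2
        rw [e3, e2]; simp
    · simp only [a, hb, if_false] at e3
      rcases lt_or_gt_of_ne (hi l) with h | h
      · apply hp _ _ _ _ h hij
        · rw [e1, e3]; linear_combination (- c) * q_cube
        · rw [e2, e3]; ring
      · have h' : j < e l := lt_of_le_of_ne (not_lt.mp fun h' => hb ⟨h, h'⟩) (hj l).symm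
        apply hp _ _ _ _ hij h'
        · rw [e1, e2]
        · rw [e1, e3])
  have hr0 : r = 0 := by
    rcases hr2 with h | h
    · exact h
    · apply hA ι' r hcard hr1
      have hsub : (Finset.univ.image fun l : ι' => (l, false)) ⊆ s := by
        intro t ht
        simp only [Finset.mem_image, Finset.mem_univ, true_and] at ht
        obtain ⟨l, rfl⟩ := ht
        simp [s]
      have hcs : (Finset.univ.image fun l : ι' => (l, false)).card = N + 1 := by
        rw [Finset.card_image_of_injective _ (fun _ _ h => (Prod.mk.inj h).1), Finset.card_univ,
          hcard]
      have hst := minDeg_step N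
      rcases hd with hd | ⟨hd, l, hl1, hl2⟩
      · have := Finset.card_le_card hsub
        omega
      · have : (Finset.univ.image fun l : ι' => (l, false)).card < s.card := by
          apply Finset.card_lt_card
          refine ⟨hsub, fun hsub' => ?_⟩
          have : ((⟨l, hl1.ne', hl2.ne⟩ : ι'), true) ∈ s := by
            simp only [s, Finset.mem_filter, Finset.mem_univ, true_and]
            exact Or.inr ⟨hl1, hl2⟩
          have := hsub' this
          simp at this
        omega
  have := hr3 (w ∘ e)
  rw [extZ_unique e he.injective hij.ne hi hj hs c w rfl hw, hr0] at this
  simpa using this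

theorem zero_of_pairs {N : ℕ} {ι : Type} [Fintype ι] [LinearOrder ι]
    (p : MvPolynomial ι ℂ) (hc : Fintype.card ι = N + 2)
    (hd : p.totalDegree ≤ minDeg (N + 2))
    (H : ∀ i j : ι, i < j → ∀ z : ι → ℂ, z j = q ^ 2 * z i → eval z p = 0) : p = 0 := by
  by_contra hp0
  let s : Finset (ι × ι) := Finset.univ.filter fun t => t.1 < t.2
  have hne : ∀ t ∈ s, t.1 ≠ t.2 := by
    intro t ht
    simp only [s, Finset.mem_filter] at ht
    exact ht.2.ne
  have hdvd : (∏ t ∈ s, (X t.2 - C (q ^ 2) * X t.1)) ∣ p := by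
    apply linform_prod_dvd s (fun t => t.2) (fun t => C (q ^ 2) * X t.1)
    · intro t ht
      exact indep_X (hne t ht) _
    · intro t ht z hz
      simp only [s, Finset.mem_filter] at ht
      apply H _ _ ht.2
      simpa using hz
    · rintro ⟨a, b⟩ ht ⟨a', b'⟩ ht' htt
      simp only [s, Finset.mem_filter, Finset.mem_univ, true_and] at ht ht'
      simp only [map_mul, eval_C, eval_X]
      by_cases hb : b = b'
      · have ha : a' ≠ a := by
          rintro rfl
          exact htt (by rw [hb])
        refine ⟨fun l => if l = b then q ^ 2 else if l = a' then 0 else 1, ?_, ?_⟩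
        · simp [ht.ne, ha.symm]
        · subst hb
          simp [ht'.ne, q_ne_zero]
      · by_cases hab : a' = b
        · refine ⟨fun l => if l = b then q ^ 2 else if l = b' then q ^ 4 + 1 else 1, ?_, ?_⟩
          · have : a ≠ b' := by rintro rfl; exact absurd (ht.trans (hab ▸ ht')) (lt_irrefl _)
            simp [ht.ne, this]
          · simp only [if_neg (Ne.symm hb), if_true, hab]
            intro h
            have : (1 : ℂ) = 0 := by linear_combination h
            norm_num at this
        · by_cases hba : a = b'
          · refine ⟨fun l => if l = b then q ^ 2 else if l = a' then 0 else 1, ?_, ?_⟩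
            · have : a ≠ a' := by rintro rfl; exact absurd hba ht'.ne
              simp [ht.ne, this]
            · have : b' ≠ a' := ht'.ne'
              simp [hab, Ne.symm hb, this]
          · refine ⟨fun l => if l = b then q ^ 2 else if l = b' then q ^ 2 + 1 else 1, ?_, ?_⟩
            · simp [ht.ne, hba]
            · simp [Ne.symm hb, hab, ht'.ne]
  obtain ⟨r, hr⟩ := hdvd
  have hr0 : r ≠ 0 := by
    rintro rfl
    simp at hr
    exact hp0 hr
  have hP0 : (∏ t ∈ s, (X t.2 - C (q ^ 2) * X t.1) : MvPolynomial ι ℂ) ≠ 0 := by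
    intro h
    rw [h, zero_mul] at hr
    exact hp0 hr
  have hdeg := totalDegree_mul_of_isDomain hP0 hr0
  rw [← hr] at hdeg
  have h3 := linform_prod_totalDegree s (fun t => t.2)
    (fun t => (C (q ^ 2) * X t.1 : MvPolynomial ι ℂ)) (fun t ht => indep_X (hne t ht) _)
  have hcard : 2 * s.card = (N + 2) * (N + 1) := by
    have h1 : s.card = (Finset.univ.filter fun t : ι × ι => t.2 < t.1).card := by
      apply Finset.card_bij (fun t _ => (t.2, t.1))
      · intro t ht; simpa [s] using ht
      · rintro ⟨a, b⟩ _ ⟨c, d⟩ _ h; simp at h; simp [h]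
      · rintro ⟨a, b⟩ h; exact ⟨(b, a), by simpa [s] using h, rfl⟩
    have h2 : s.card + (Finset.univ.filter fun t : ι × ι => t.2 < t.1).card
        + (Finset.univ.filter fun t : ι × ι => t.1 = t.2).card = (N + 2) * (N + 2) := by
      rw [← Finset.card_union_of_disjoint, ← Finset.card_union_of_disjoint]
      · rw [← hc, ← Fintype.card_prod, ← Finset.card_univ]
        congr 1
        ext t
        simp only [s, Finset.mem_union, Finset.mem_filter, Finset.mem_univ, true_and, iff_true]
        rcases lt_trichotomy t.1 t.2 with h | h | h <;> simp [h]
      · rw [Finset.disjoint_left]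
        intro t ht ht'
        simp only [s, Finset.mem_union, Finset.mem_filter, Finset.mem_univ, true_and] at ht ht'
        rcases ht with ht | ht
        · exact ht.ne ht'
        · exact ht.ne' ht'
      · rw [Finset.disjoint_left]
        intro t ht ht'
        simp only [s, Finset.mem_filter, Finset.mem_univ, true_and] at ht ht'
        exact lt_asymm ht ht'
    have h4 : (Finset.univ.filter fun t : ι × ι => t.1 = t.2).card = N + 2 := by
      rw [← hc, ← Finset.card_univ (α := ι)]
      symm
      apply Finset.card_bij (fun a _ => (a, a))
      · intro a _; simp
      · intro a _ b _ h; exact (Prod.mk.inj h).1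
      · rintro ⟨a, b⟩ h; simp at h; exact ⟨a, by simp, by simp [h]⟩
    nlinarith
  have hm : 4 * minDeg (N + 2) ≤ (N + 1) ^ 2 := by
    unfold minDeg
    have := Nat.mul_div_le ((N + 2 - 1) ^ 2) 4
    simpa using this
  nlinarith

theorem zero_of_adj {N : ℕ} (hA : LemA (N + 1)) {ι : Type} [Fintype ι] [LinearOrder ι]
    (p : MvPolynomial ι ℂ) (hc : Fintype.card ι = N + 3) (hp : WheelFun p)
    (hd : p.totalDegree ≤ minDeg (N + 3))
    (hadj : ∀ i j : ι, i < j → (∀ l, i < l → ¬ l < j) →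
      ∀ z : ι → ℂ, z j = q ^ 2 * z i → eval z p = 0) : p = 0 := by
  apply zero_of_pairs (N := N + 1) p hc hd
  have key : ∀ d : ℕ, ∀ i j : ι, i < j → (Finset.univ.filter fun l => i < l ∧ l < j).card = d →
      ∀ z : ι → ℂ, z j = q ^ 2 * z i → eval z p = 0 := by
    intro d
    induction d using Nat.strong_induction_on with
    | _ d ih =>
      intro i j hij hcd
      by_cases hb : ∃ l, i < l ∧ l < j
      · apply pair_vanish hA p hc hp hij _ _ (Or.inr ⟨hd, hb⟩)
        · intro l hl1 hl2
          apply ih _ _ i l hl1 rfl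
          rw [← hcd]
          apply Finset.card_lt_card
          refine ⟨fun m hm => ?_, fun h => ?_⟩
          · simp only [Finset.mem_filter, Finset.mem_univ, true_and] at hm ⊢
            exact ⟨hm.1, hm.2.trans hl2⟩
          · have := h (Finset.mem_filter.mpr ⟨Finset.mem_univ l, hl1, hl2⟩)
            simp at this
        · intro l hl1 hl2
          apply ih _ _ l j hl2 rfl
          rw [← hcd]
          apply Finset.card_lt_card
          refine ⟨fun m hm => ?_, fun h => ?_⟩
          · simp only [Finset.mem_filter, Finset.mem_univ, true_and] at hm ⊢
            exact ⟨hl1.trans hm.1, hm.2⟩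
          · have := h (Finset.mem_filter.mpr ⟨Finset.mem_univ l, hl1, hl2⟩)
            simp at this
      · push Not at hb
        exact hadj i j hij (fun l h => not_lt.mpr (hb l h))
  intro i j hij
  exact key _ i j hij rfl

theorem lemA (N : ℕ) : LemA N := by
  induction N using Nat.strong_induction_on with
  | _ N ih =>
    intro ι _ _ p hc hp hd
    match N, ih, hc, hd with
    | 0, _, _, hd => simp [minDeg] at hd
    | 1, _, _, hd => simp [minDeg] at hd
    | 2, _, _, hd => simp [minDeg] at hd
    | N + 3, ih, hc, hd =>
      have hA := ih (N + 1) (by omega)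
      apply zero_of_adj hA p hc hp hd.le
      intro i j hij hb
      apply pair_vanish hA p hc hp hij _ _ (Or.inl hd)
      · intro l h1 h2; exact absurd h2 (hb l h1)
      · intro l h1 h2; exact absurd h2 (hb l h1)



/-! ### Part 3: combinatorics of noncrossing matchings -/

/-- insertion of a gap of size two at position `κ`. -/
def ek {m : ℕ} (κ : Fin (2 * m + 1)) (i : Fin (2 * m)) : Fin (2 * (m + 1)) :=
  ⟨if (i : ℕ) < κ then i else i + 2, by split <;> omega⟩

def kA {m : ℕ} (κ : Fin (2 * m + 1)) : Fin (2 * (m + 1)) := ⟨κ, by omega⟩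
def kB {m : ℕ} (κ : Fin (2 * m + 1)) : Fin (2 * (m + 1)) := ⟨κ + 1, by omega⟩

theorem ek_val {m : ℕ} (κ : Fin (2 * m + 1)) (i : Fin (2 * m)) :
    ((ek κ i : Fin _) : ℕ) = if (i : ℕ) < κ then (i : ℕ) else i + 2 := rfl
theorem kA_val {m : ℕ} (κ : Fin (2 * m + 1)) : ((kA κ : Fin _) : ℕ) = κ := rfl
theorem kB_val {m : ℕ} (κ : Fin (2 * m + 1)) : ((kB κ : Fin _) : ℕ) = κ + 1 := rfl

theorem ek_strictMono {m : ℕ} (κ : Fin (2 * m + 1)) : StrictMono (ek κ) := by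
  intro i j h
  rw [Fin.lt_def, ek_val, ek_val]
  rw [Fin.lt_def] at h
  split_ifs <;> omega

theorem ek_lt_iff {m : ℕ} (κ : Fin (2 * m + 1)) {i j} : ek κ i < ek κ j ↔ i < j :=
  (ek_strictMono κ).lt_iff_lt

theorem ek_inj {m : ℕ} (κ : Fin (2 * m + 1)) : Function.Injective (ek κ) :=
  (ek_strictMono κ).injective

theorem ek_ne_kA {m : ℕ} (κ : Fin (2 * m + 1)) (i) : ek κ i ≠ kA κ := by
  rw [Ne, Fin.ext_iff, ek_val, kA_val]; split_ifs <;> omega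
theorem ek_ne_kB {m : ℕ} (κ : Fin (2 * m + 1)) (i) : ek κ i ≠ kB κ := by
  rw [Ne, Fin.ext_iff, ek_val, kB_val]; split_ifs <;> omega
theorem kA_lt_kB {m : ℕ} (κ : Fin (2 * m + 1)) : kA κ < kB κ := by
  rw [Fin.lt_def, kA_val, kB_val]; omega
theorem kA_ne_kB {m : ℕ} (κ : Fin (2 * m + 1)) : kA κ ≠ kB κ := (kA_lt_kB κ).ne

theorem ek_cover {m : ℕ} (κ : Fin (2 * m + 1)) (l : Fin (2 * (m + 1))) :
    l = kA κ ∨ l = kB κ ∨ ∃ i, ek κ i = l := by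
  by_cases h1 : (l : ℕ) < κ
  · right; right
    refine ⟨⟨l, by omega⟩, ?_⟩
    rw [Fin.ext_iff, ek_val]; simp [h1]
  by_cases h2 : (l : ℕ) = κ
  · left; exact Fin.ext h2
  by_cases h3 : (l : ℕ) = κ + 1
  · right; left; exact Fin.ext h3
  · right; right
    refine ⟨⟨l - 2, by omega⟩, ?_⟩
    rw [Fin.ext_iff, ek_val]
    simp only
    split_ifs <;> omega

theorem prod_split {M : Type} [CommMonoid M] {m : ℕ} (κ : Fin (2 * m + 1))
    (f : Fin (2 * (m + 1)) → M) :
    ∏ l, f l = f (kA κ) * f (kB κ) * ∏ i, f (ek κ i) := by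
  classical
  have h : (Finset.univ : Finset (Fin (2 * (m + 1)))) =
      insert (kA κ) (insert (kB κ) (Finset.univ.image (ek κ))) := by
    ext l
    simpa using ek_cover κ l
  rw [h, Finset.prod_insert, Finset.prod_insert, Finset.prod_image, mul_assoc]
  · exact fun x _ y _ h => ek_inj κ h
  · simp [ek_ne_kB]
  · simp [ek_ne_kA, kA_ne_kB]

/-- `σ` is obtained from `σ'` by inserting a little arc at `κ`. -/
def Ins {m : ℕ} (κ : Fin (2 * m + 1)) (σ : NCM (m + 1)) (σ' : NCM m) : Prop :=
  σ.f (kA κ) = kB κ ∧ σ.f (kB κ) = kA κ ∧ ∀ i, σ.f (ek κ i) = ek κ (σ'.f i)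

theorem exists_remove {m : ℕ} (κ : Fin (2 * m + 1)) (σ : NCM (m + 1))
    (h : σ.f (kA κ) = kB κ) : ∃ σ', Ins κ σ σ' := by
  have h' : σ.f (kB κ) = kA κ := by rw [← h, σ.invol]
  have h2 : ∀ i, ∃ j, ek κ j = σ.f (ek κ i) := by
    intro i
    rcases ek_cover κ (σ.f (ek κ i)) with h3 | h3 | h3
    · have := congrArg σ.f h3
      rw [σ.invol, h] at this
      exact absurd this (ek_ne_kB κ i)
    · have := congrArg σ.f h3
      rw [σ.invol, h'] at this
      exact absurd this (ek_ne_kA κ i)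
    · exact h3
  choose g hg using h2
  refine ⟨⟨g, ?_, ?_, ?_⟩, h, h', fun i => (hg i).symm⟩
  · intro k
    apply ek_inj κ
    rw [hg, hg, σ.invol]
  · intro k hk
    apply σ.nofix (ek κ k)
    rw [← hg, hk]
  · intro a b c d hab hbc hcd h1 h2
    apply σ.noncross (ek κ a) (ek κ b) (ek κ c) (ek κ d)
    · exact ek_strictMono κ hab
    · exact ek_strictMono κ hbc
    · exact ek_strictMono κ hcd
    · rw [← hg, h1]
    · rw [← hg, h2]

theorem exists_insert {m : ℕ} (κ : Fin (2 * m + 1)) (σ' : NCM m) : ∃ σ, Ins κ σ σ' := by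
  classical
  have hex : ∃ g : Fin (2 * (m + 1)) → Fin (2 * (m + 1)), g (kA κ) = kB κ ∧ g (kB κ) = kA κ ∧
      ∀ i, g (ek κ i) = ek κ (σ'.f i) := by
    refine ⟨fun l => if l = kA κ then kB κ else if l = kB κ then kA κ else
      if h : ∃ i, ek κ i = l then ek κ (σ'.f h.choose) else l, ?_, ?_, ?_⟩
    · simp
    · simp [(kA_ne_kB κ).symm]
    · intro i
      have h : ∃ j, ek κ j = ek κ i := ⟨i, rfl⟩
      simp only [ek_ne_kA, ek_ne_kB, if_false]
      rw [dif_pos h, ek_inj κ h.choose_spec]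
  obtain ⟨g, g1, g2, g3⟩ := hex
  refine ⟨⟨g, ?_, ?_, ?_⟩, g1, g2, g3⟩
  · intro l
    rcases ek_cover κ l with rfl | rfl | ⟨i, rfl⟩
    · rw [g1, g2]
    · rw [g2, g1]
    · rw [g3, g3, σ'.invol]
  · intro l
    rcases ek_cover κ l with rfl | rfl | ⟨i, rfl⟩
    · rw [g1]; exact (kA_ne_kB κ).symm
    · rw [g2]; exact kA_ne_kB κ
    · rw [g3]; intro h; exact σ'.nofix i (ek_inj κ h)
  · intro a b c d hab hbc hcd h1 h2
    rcases ek_cover κ a with rfl | rfl | ⟨a, rfl⟩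
    · rw [g1] at h1; subst h1
      rw [Fin.lt_def, kA_val] at hab; rw [Fin.lt_def, kB_val] at hbc; omega
    · rw [g2] at h1; subst h1
      exact absurd (hab.trans hbc) (not_lt.mpr (kA_lt_kB κ).le)
    rcases ek_cover κ b with rfl | rfl | ⟨b, rfl⟩
    · rw [g1] at h2; subst h2
      rw [Fin.lt_def, kA_val] at hbc; rw [Fin.lt_def, kB_val] at hcd; omega
    · rw [g2] at h2; subst h2
      exact absurd (hbc.trans hcd) (not_lt.mpr (kA_lt_kB κ).le)
    rw [g3] at h1 h2
    subst h1; subst h2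
    rw [ek_lt_iff] at hab hbc hcd
    exact σ'.noncross _ _ _ _ hab hbc hcd rfl rfl

/-- If `κ` is an opener and `κ+1` a closer then they are matched. -/
theorem little_arc {m : ℕ} (κ : Fin (2 * m + 1)) (σ : NCM (m + 1))
    (h1 : kA κ < σ.f (kA κ)) (h2 : ¬ kB κ < σ.f (kB κ)) : σ.f (kA κ) = kB κ := by
  have h3 : σ.f (kB κ) < kB κ := lt_of_le_of_ne (not_lt.mp h2) (σ.nofix _)
  by_contra hne
  have h4 : kB κ < σ.f (kA κ) := by
    apply lt_of_le_of_ne _ (Ne.symm hne)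
    rw [Fin.le_def, kB_val]; rw [Fin.lt_def, kA_val] at h1; omega
  have h5 : σ.f (kB κ) < kA κ := by
    have : σ.f (kB κ) ≠ kA κ := by
      intro h; apply hne; rw [← h, σ.invol]
    apply lt_of_le_of_ne _ this
    rw [Fin.le_def, kA_val]; rw [Fin.lt_def, kB_val] at h3; omega
  exact σ.noncross _ _ _ _ h5 (kA_lt_kB κ) h4 (σ.invol _) rfl

theorem exists_ins {m : ℕ} (σ : NCM (m + 1)) : ∃ κ σ', Ins κ σ σ' := by
  -- first closer
  have h0 : (⟨0, by omega⟩ : Fin (2 * (m + 1))) < σ.f ⟨0, by omega⟩ := by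
    rw [Fin.lt_def]
    have := σ.nofix ⟨0, by omega⟩
    rw [Ne, Fin.ext_iff] at this
    change (0:ℕ) < _
    change ¬ ((σ.f ⟨0, by omega⟩ : ℕ) = 0) at this
    omega
  have hex : ∃ l : ℕ, ∃ h : l < 2 * (m + 1), ¬ (⟨l, h⟩ : Fin (2 * (m + 1))) < σ.f ⟨l, h⟩ := by
    refine ⟨σ.f ⟨0, by omega⟩, Fin.is_lt _, ?_⟩
    change ¬ σ.f ⟨0, by omega⟩ < σ.f (σ.f ⟨0, by omega⟩)
    rw [σ.invol]
    exact not_lt.mpr h0.le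
  classical
  obtain ⟨hl, hc⟩ := Nat.find_spec hex
  have hmin := fun l' => Nat.find_min hex (m := l')
  set l := Nat.find hex
  have hl0 : l ≠ 0 := by
    intro h
    have h9 : (⟨l, hl⟩ : Fin (2 * (m + 1))) = ⟨0, by omega⟩ := Fin.ext h
    rw [h9] at hc
    exact hc h0
  have := hmin (l - 1) (by omega)
  push Not at this
  have h1 := this (by omega)
  let κ : Fin (2 * m + 1) := ⟨l - 1, by omega⟩
  have hB : kB κ = ⟨l, hl⟩ := by rw [Fin.ext_iff, kB_val]; simp only [κ]; omega
  have hA : kA κ = ⟨l - 1, by omega⟩ := rfl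
  have h3 : σ.f (kA κ) = kB κ := by
    apply little_arc
    · rw [hA]; exact h1
    · rw [hB]; exact hc
  exact ⟨κ, exists_remove κ σ h3⟩

theorem ncm_eq_of_openers {m : ℕ} (σ τ : NCM m)
    (h : ∀ j, j < σ.f j ↔ j < τ.f j) : σ = τ := by
  induction m with
  | zero => apply NCM.ext'; funext i; exact absurd i.is_lt (by omega)
  | succ m ih =>
    obtain ⟨κ, σ', h1, h2, h3⟩ := exists_ins σ
    have h4 : τ.f (kA κ) = kB κ := by
      apply little_arc
      · rw [← h, h1]; exact kA_lt_kB κ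
      · rw [← h, h2]; exact not_lt.mpr (kA_lt_kB κ).le
    obtain ⟨τ', t1, t2, t3⟩ := exists_remove κ τ h4
    have : σ' = τ' := by
      apply ih
      intro j
      have := h (ek κ j)
      rwa [h3, t3, ek_lt_iff, ek_lt_iff] at this
    subst this
    apply NCM.ext'
    funext l
    rcases ek_cover κ l with rfl | rfl | ⟨i, rfl⟩
    · rw [h1, t1]
    · rw [h2, t2]
    · rw [h3, t3]

theorem parity {m : ℕ} (σ : NCM m) (j) : ((σ.f j : ℕ) + j) % 2 = 1 := by
  induction m with
  | zero => exact absurd j.is_lt (by omega)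
  | succ m ih =>
    obtain ⟨κ, σ', h1, h2, h3⟩ := exists_ins σ
    rcases ek_cover κ j with rfl | rfl | ⟨i, rfl⟩
    · rw [h1, kA_val, kB_val]; omega
    · rw [h2, kA_val, kB_val]; omega
    · rw [h3, ek_val, ek_val]
      have := ih σ' i
      split_ifs <;> omega

theorem CmatSeq_eq {N n : ℕ} (a : Fin N → ℕ) (σ : NCM n) :
    CmatSeq a σ = ∏ j : Fin (2 * n),
      if j < σ.f j then chi (pjkSeq a ((j : ℕ) + 1) ((σ.f j : ℕ) + 1)) else 1 := by
  unfold CmatSeq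
  apply Finset.prod_congr rfl
  intro j _
  rw [Finset.prod_eq_single (σ.f j)]
  · simp
  · intro k _ hk
    rw [if_neg]
    rintro ⟨_, h⟩
    exact hk h.symm
  · simp

/-- relabelling after removal of sites `κ+1, κ+2` (1-indexed). -/
def fk (κ x : ℕ) : ℕ := if x < κ + 1 then x else if x ≤ κ + 2 then κ else x - 2

theorem chi_pjk_little {N m : ℕ} (a : Fin N → ℕ) (κ : Fin (2 * m + 1)) :
    pjkSeq a ((kA κ : ℕ) + 1) ((kB κ : ℕ) + 1) =
      ((Finset.univ.filter fun i => a i = κ + 1).card : ℤ) := by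
  unfold pjkSeq
  rw [kA_val, kB_val]
  have : ((κ : ℕ) + 1 + 1 - (κ + 1) - 1) / 2 = 0 := by omega
  rw [this]
  simp only [Nat.cast_zero, sub_zero, Nat.cast_inj]
  congr 1
  ext i
  simp only [Finset.mem_filter, Finset.mem_univ, true_and]
  omega

theorem pjk_ek {N m : ℕ} (a : Fin (N + 1) → ℕ) (κ : Fin (2 * m + 1)) (k0 : Fin (N + 1))
    (hk : a k0 = κ + 1) {i j : Fin (2 * m)} (hij : i < j) :
    pjkSeq a ((ek κ i : ℕ) + 1) ((ek κ j : ℕ) + 1) =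
      pjkSeq (fun x => fk κ (a (k0.succAbove x))) ((i : ℕ) + 1) ((j : ℕ) + 1) := by
  unfold pjkSeq
  simp only [Finset.card_filter]
  rw [Fin.sum_univ_succAbove _ k0]
  rw [Fin.lt_def] at hij
  have hcount : ∀ x : ℕ, ((ek κ i : ℕ) + 1 ≤ x ∧ x < (ek κ j : ℕ) + 1) ↔
      ((i : ℕ) + 1 ≤ fk κ x ∧ fk κ x < (j : ℕ) + 1) := by
    intro x
    rw [ek_val, ek_val]; unfold fk
    split_ifs <;> omega
  simp only [hcount]
  have hk' : fk κ (a k0) = κ := by rw [hk]; unfold fk; simp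
  rw [hk', ek_val, ek_val]
  push_cast
  split_ifs <;> omega

theorem C_rec {m N : ℕ} (a : Fin (N + 1) → ℕ) {κ : Fin (2 * m + 1)} {σ : NCM (m + 1)} {σ' : NCM m}
    (h : Ins κ σ σ') (k0 : Fin (N + 1)) (hk : a k0 = κ + 1) :
    CmatSeq a σ = chi ((Finset.univ.filter fun i => a i = κ + 1).card : ℤ) *
      CmatSeq (fun x => fk κ (a (k0.succAbove x))) σ' := by
  obtain ⟨h1, h2, h3⟩ := h
  rw [CmatSeq_eq, CmatSeq_eq, prod_split κ, h1, h2, if_pos (kA_lt_kB κ),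
    if_neg (not_lt.mpr (kA_lt_kB κ).le), chi_pjk_little, mul_one]
  congr 1
  apply Finset.prod_congr rfl
  intro i _
  rw [h3]
  simp only [ek_lt_iff]
  split_ifs with h
  · rw [pjk_ek a κ k0 hk h]
  · rfl

theorem chi_zero : chi 0 = 0 := rfl

theorem C_ins_zero {m N : ℕ} (a : Fin N → ℕ) {κ : Fin (2 * m + 1)} {σ : NCM (m + 1)} {σ' : NCM m}
    (h : Ins κ σ σ') (hk : ∀ k, a k ≠ κ + 1) : CmatSeq a σ = 0 := by
  obtain ⟨h1, h2, h3⟩ := h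
  rw [CmatSeq_eq, prod_split κ, h1, if_pos (kA_lt_kB κ), chi_pjk_little]
  have : (Finset.univ.filter fun i => a i = κ + 1) = ∅ := by
    ext i; simp [hk]
  rw [this]
  simp [chi_zero]

theorem C_arc_pos {m : ℕ} (a : Fin m → ℕ) (σ : NCM m) (h : CmatSeq a σ ≠ 0) (j) (hj : j < σ.f j) :
    1 ≤ pjkSeq a ((j : ℕ) + 1) ((σ.f j : ℕ) + 1) := by
  induction m with
  | zero => exact absurd j.is_lt (by omega)
  | succ m ih =>
    obtain ⟨κ, σ', hI⟩ := exists_ins σ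
    by_cases hk : ∀ k, a k ≠ κ + 1
    · exact absurd (C_ins_zero a hI hk) h
    push Not at hk
    obtain ⟨k0, hk⟩ := hk
    rw [C_rec a hI k0 hk] at h
    obtain ⟨h1, h2, h3⟩ := hI
    rcases ek_cover κ j with rfl | rfl | ⟨i, rfl⟩
    · rw [h1, chi_pjk_little]
      have : 0 < (Finset.univ.filter fun i => a i = κ + 1).card :=
        Finset.card_pos.mpr ⟨k0, by simp [hk]⟩
      omega
    · rw [h2] at hj; exact absurd hj (not_lt.mpr (kA_lt_kB κ).le)
    · rw [h3] at hj ⊢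
      rw [ek_lt_iff] at hj
      rw [pjk_ek a κ k0 hk hj]
      exact ih _ σ' (right_ne_zero_of_mul h) i hj

theorem C_triple {m : ℕ} (a : Fin m → ℕ) (σ : NCM m) (v : ℕ)
    (hv : 3 ≤ (Finset.univ.filter fun i => a i = v).card) : CmatSeq a σ = 0 := by
  induction m generalizing v with
  | zero => simp at hv
  | succ m ih =>
    obtain ⟨κ, σ', hI⟩ := exists_ins σ
    by_cases hk : ∀ k, a k ≠ κ + 1
    · exact C_ins_zero a hI hk
    push Not at hk
    obtain ⟨k0, hk⟩ := hk
    rw [C_rec a hI k0 hk]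
    have hle : (if a k0 = v then 0 else 0) + ∑ x : Fin m, (if a (k0.succAbove x) = v then 1 else 0)
        ≤ (Finset.univ.filter fun x : Fin m => fk κ (a (k0.succAbove x)) = fk κ v).card := by
      rw [Finset.card_filter]
      simp only [ite_self, zero_add]
      apply Finset.sum_le_sum
      intro x _
      split_ifs with h1 h2
      · exact le_rfl
      · rw [h1] at h2; exact absurd rfl h2
      · simp
      · simp
    rw [Finset.card_filter, Fin.sum_univ_succAbove _ k0] at hv
    by_cases hvk : v = κ + 1
    · subst hvk
      by_cases h4 : 4 ≤ (Finset.univ.filter fun i => a i = κ + 1).card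
      · rw [Finset.card_filter, Fin.sum_univ_succAbove _ k0] at h4
        rw [ih _ σ' (fk κ (κ + 1)), mul_zero]
        rw [if_pos hk] at h4
        simp only [ite_self, zero_add] at hle
        omega
      · have : (Finset.univ.filter fun i => a i = κ + 1).card = 3 := by
          rw [Finset.card_filter, Fin.sum_univ_succAbove _ k0] at h4 ⊢
          omega
        rw [this]
        simp [chi]
    · rw [ih _ σ' (fk κ v), mul_zero]
      rw [if_neg (by omega)] at hv
      simp only [ite_self, zero_add] at hle hv
      omega

theorem C_suffix {m : ℕ} (a : Fin m → ℕ) (σ : NCM m) (h : CmatSeq a σ ≠ 0) (v : ℕ) :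
    (Finset.univ.filter fun j => j < σ.f j ∧ v ≤ (j : ℕ) + 1).card ≤
      (Finset.univ.filter fun i => v ≤ a i).card := by
  induction m generalizing v with
  | zero => simp
  | succ m ih =>
    obtain ⟨κ, σ', hI⟩ := exists_ins σ
    by_cases hk : ∀ k, a k ≠ κ + 1
    · exact absurd (C_ins_zero a hI hk) h
    push Not at hk
    obtain ⟨k0, hk⟩ := hk
    rw [C_rec a hI k0 hk] at h
    obtain ⟨h1, h2, h3⟩ := hI
    have h4 := ih _ σ' (right_ne_zero_of_mul h) (if v ≤ κ + 1 then v else max (v - 2) (κ + 1))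
    simp only [Finset.card_filter] at h4 ⊢
    rw [Fin.sum_univ_succAbove _ k0]
    have h5 : ∀ f : Fin (2 * (m + 1)) → ℕ, ∑ l, f l = f (kA κ) + f (kB κ) + ∑ i, f (ek κ i) := by
      intro f
      exact prod_split (M := Multiplicative ℕ) κ f
    rw [h5, h1, h2, kA_val]
    simp only [kA_lt_kB, not_lt.mpr (kA_lt_kB κ).le, hk, true_and, false_and, if_false, add_zero]
    apply Nat.add_le_add_left
    refine le_trans (le_of_eq ?_) (h4.trans ?_)
    · apply Finset.sum_congr rfl
      intro i _
      congr 1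
      rw [h3, ek_lt_iff, ek_val]
      apply propext
      apply and_congr Iff.rfl
      split_ifs <;> omega
    · apply Finset.sum_le_sum
      intro x _
      have : (if v ≤ κ + 1 then v else max (v - 2) (κ + 1)) ≤ fk κ (a (k0.succAbove x)) →
          v ≤ a (k0.succAbove x) := by
        unfold fk
        split_ifs <;> omega
      by_cases h8 : v ≤ a (k0.succAbove x)
      · rw [if_pos h8]; split_ifs <;> omega
      · rw [if_neg (mt this h8)]; exact Nat.zero_le _

/-- `a` enumerates the openers of `σ` (1-indexed) without repetition. -/
def IsOp {m : ℕ} (a : Fin m → ℕ) (σ : NCM m) : Prop :=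
  Function.Injective a ∧ (∀ i, ∃ j, j < σ.f j ∧ a i = j + 1) ∧ ∀ j, j < σ.f j → ∃ i, a i = j + 1

theorem C_diag {m : ℕ} (a : Fin m → ℕ) (σ : NCM m) (h : IsOp a σ) : CmatSeq a σ = 1 := by
  induction m with
  | zero =>
    rw [CmatSeq_eq]
    apply Finset.prod_eq_one
    intro j
    exact absurd j.is_lt (by omega)
  | succ m ih =>
    obtain ⟨κ, σ', hI⟩ := exists_ins σ
    obtain ⟨a1, a2, a3⟩ := h
    have ⟨h1, h2, h3⟩ := hI
    obtain ⟨k0, hk⟩ := a3 (kA κ) (by rw [h1]; exact kA_lt_kB κ)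
    rw [kA_val] at hk
    rw [C_rec a hI k0 hk]
    have : (Finset.univ.filter fun i => a i = κ + 1) = {k0} := by
      ext i
      simp only [Finset.mem_filter, Finset.mem_univ, true_and, Finset.mem_singleton, ← hk]
      exact a1.eq_iff
    have hfe : ∀ i : Fin (2 * m), fk κ ((ek κ i : ℕ) + 1) = i + 1 := by
      intro i
      rw [ek_val]; unfold fk
      split_ifs <;> omega
    have hae : ∀ x : Fin m, ∃ i, i < σ'.f i ∧ a (k0.succAbove x) = (ek κ i : ℕ) + 1 := by
      intro x
      obtain ⟨j, hj, hj'⟩ := a2 (k0.succAbove x)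
      rcases ek_cover κ j with rfl | rfl | ⟨i, rfl⟩
      · rw [kA_val, ← hk] at hj'
        exact absurd (a1 hj') (Fin.succAbove_ne k0 x)
      · rw [h2] at hj; exact absurd hj (not_lt.mpr (kA_lt_kB κ).le)
      · rw [h3, ek_lt_iff] at hj
        exact ⟨i, hj, hj'⟩
    rw [this, ih]
    · simp [chi]
    refine ⟨?_, ?_, ?_⟩
    · intro x y hxy
      obtain ⟨i, _, hi⟩ := hae x
      obtain ⟨j, _, hj⟩ := hae y
      simp only [hi, hj, hfe] at hxy
      have : i = j := Fin.ext (by omega)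
      subst this
      exact Fin.succAbove_right_injective (a1 (hi.trans hj.symm))
    · intro x
      obtain ⟨i, hi', hi⟩ := hae x
      exact ⟨i, hi', by simp only [hi, hfe]⟩
    · intro j hj
      obtain ⟨k, hk'⟩ := a3 (ek κ j) (by rw [h3, ek_lt_iff]; exact hj)
      have hne : k ≠ k0 := by
        intro h
        rw [h, hk] at hk'
        apply ek_ne_kA κ j
        rw [Fin.ext_iff, kA_val]; omega
      obtain ⟨x, rfl⟩ := Fin.exists_succAbove_eq hne
      exact ⟨x, by simp only [hk', hfe]⟩

theorem plus_strictMono {n : ℕ} (π : NCM n) : StrictMono (plus π) := by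
  intro i j h
  unfold plus
  have := ((Finset.univ.filter fun k => k < π.f k).orderIsoOfFin (card_openers π)).strictMono h
  have h2 : (((Finset.univ.filter fun k => k < π.f k).orderIsoOfFin (card_openers π) i :
      { x // x ∈ Finset.univ.filter fun k => k < π.f k }) : Fin (2 * n)) <
    (((Finset.univ.filter fun k => k < π.f k).orderIsoOfFin (card_openers π) j :
      { x // x ∈ Finset.univ.filter fun k => k < π.f k }) : Fin (2 * n)) := this
  rw [Fin.lt_def] at h2
  omega

theorem plus_isOp {n : ℕ} (π : NCM n) : IsOp (plus π) π := by
  refine ⟨(plus_strictMono π).injective, ?_, ?_⟩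
  · intro i
    refine ⟨_, ?_, rfl⟩
    have := ((Finset.univ.filter fun k => k < π.f k).orderIsoOfFin (card_openers π) i).2
    exact (Finset.mem_filter.mp this).2
  · intro j hj
    refine ⟨((Finset.univ.filter fun k => k < π.f k).orderIsoOfFin (card_openers π)).symm
      ⟨j, by simp [hj]⟩, ?_⟩
    unfold plus
    rw [OrderIso.apply_symm_apply]

theorem plus_ge {n : ℕ} (π : NCM n) (i) : 1 ≤ plus π i := by unfold plus; omega
theorem plus_le {n : ℕ} (π : NCM n) (i) : plus π i ≤ 2 * n := by
  unfold plus
  have := Fin.is_lt (((Finset.univ.filter fun k => k < π.f k).orderIsoOfFin (card_openers π) i :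
      { x // x ∈ Finset.univ.filter fun k => k < π.f k }) : Fin (2 * n))
  omega

/-- counting values of `plus π` satisfying `P` = counting openers. -/
theorem plus_count {n : ℕ} (π : NCM n) (P : ℕ → Prop) [DecidablePred P] :
    (Finset.univ.filter fun i => P (plus π i)).card =
      (Finset.univ.filter fun j => j < π.f j ∧ P ((j : ℕ) + 1)).card := by
  obtain ⟨h1, h2, h3⟩ := plus_isOp π
  choose g hg hg' using h2
  apply Finset.card_bij (fun i _ => g i)
  · intro i hi
    simp only [Finset.mem_filter, Finset.mem_univ, true_and] at hi ⊢
    exact ⟨hg i, by rw [← hg']; exact hi⟩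
  · intro i _ j _ h
    apply h1
    rw [hg', hg', h]
  · intro j hj
    simp only [Finset.mem_filter, Finset.mem_univ, true_and] at hj
    obtain ⟨i, hi⟩ := h3 j hj.1
    refine ⟨i, by simp [hi, hj.2], ?_⟩
    apply Fin.ext
    have := hg' i
    omega

theorem suffix_ballot {n : ℕ} (π : NCM n) (v : ℕ) :
    (Finset.univ.filter fun j => j < π.f j ∧ v ≤ (j : ℕ)).card ≤
      (Finset.univ.filter fun j => ¬ j < π.f j ∧ v ≤ (j : ℕ)).card := by
  apply Finset.card_le_card_of_injOn π.f
  · intro j hj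
    simp only [Finset.coe_filter, Finset.mem_univ, true_and, Set.mem_ofPred_eq] at hj ⊢
    rw [π.invol]
    exact ⟨not_lt.mpr hj.1.le, hj.2.trans (Fin.le_def.mp hj.1.le)⟩
  · intro i _ j _ h
    have := congrArg π.f h
    rwa [π.invol, π.invol] at this

/-- suffix statistic -/
noncomputable def sufw {n : ℕ} (σ : NCM n) (v : ℕ) : ℕ :=
  (Finset.univ.filter fun j => j < σ.f j ∧ v ≤ (j : ℕ) + 1).card

theorem sufw_succ {n : ℕ} (σ : NCM n) (j : Fin (2 * n)) :
    sufw σ (j + 1) = sufw σ (j + 1 + 1) + if j < σ.f j then 1 else 0 := by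
  unfold sufw
  simp only [Finset.card_filter]
  rw [← Finset.sum_erase_add _ _ (Finset.mem_univ j),
    ← Finset.sum_erase_add (a := j) (f := fun i : Fin (2 * n) =>
      if i < σ.f i ∧ (j : ℕ) + 1 + 1 ≤ i + 1 then 1 else 0) _ (Finset.mem_univ j)]
  have : ¬ ((j : ℕ) + 1 + 1 ≤ j + 1) := by omega
  simp only [le_refl, and_true, this, and_false, if_false, add_zero]
  congr 1
  apply Finset.sum_congr rfl
  intro i hi
  have hne : (i : ℕ) ≠ j := fun h => (Finset.ne_of_mem_erase hi) (Fin.ext h)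
  have : ((j : ℕ) + 1 ≤ i + 1) ↔ ((j : ℕ) + 1 + 1 ≤ i + 1) := by omega
  simp only [this]

theorem C_ne_suf {k : ℕ} {π σ : NCM k} (h : CmatC k π σ ≠ 0) (v : ℕ) : sufw σ v ≤ sufw π v := by
  unfold sufw
  rw [← plus_count π (fun x => v ≤ x)]
  apply C_suffix
  intro h2
  apply h
  simp [CmatC, h2]

theorem CmatC_unit (k : ℕ) : IsUnit (CmatC k) := by
  rw [← Matrix.mulVec_injective_iff_isUnit]
  change Function.Injective (Matrix.mulVecLin (CmatC k))
  rw [injective_iff_map_eq_zero]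
  intro x hx
  have hx' : ∀ π, ∑ σ, CmatC k π σ * x σ = 0 := fun π => congrFun hx π
  let w : NCM k → ℕ := fun σ => ∑ v ∈ Finset.range (2 * k + 2), sufw σ v
  have key : ∀ N, ∀ π, w π = N → x π = 0 := by
    intro N
    induction N using Nat.strong_induction_on with
    | _ N ih =>
      intro π hπ
      have h1 := hx' π
      rw [Finset.sum_eq_single π] at h1
      · have h2 : CmatC k π π = 1 := by simp [CmatC, C_diag _ _ (plus_isOp π)]
        rwa [h2, one_mul] at h1
      · intro σ _ hne
        by_cases hC : CmatC k π σ = 0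
        · rw [hC, zero_mul]
        have h3 := C_ne_suf hC
        by_cases hlt : w σ < N
        · rw [ih _ hlt σ rfl, mul_zero]
        · exfalso
          apply hne
          have h4 : w σ = w π := le_antisymm (Finset.sum_le_sum fun v _ => h3 v) (by omega)
          have h5 := (Finset.sum_eq_sum_iff_of_le (fun v _ => h3 v)).mp h4
          apply ncm_eq_of_openers
          intro j
          have e1 := h5 (j + 1) (by rw [Finset.mem_range]; omega)
          have e2 := h5 (j + 1 + 1) (by rw [Finset.mem_range]; omega)
          rw [sufw_succ, sufw_succ, e2] at e1
          by_cases q1 : j < σ.f j <;> by_cases q2 : j < π.f j <;> simp [q1, q2] at e1 ⊢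
      · simp
  funext π
  exact key _ π rfl


/-! ### Part 4: uniqueness -/

theorem ncm_nonempty (n : ℕ) : Nonempty (NCM n) := by
  induction n with
  | zero =>
    exact ⟨⟨fun i => i, fun _ => rfl, fun k => absurd k.is_lt (by omega),
      fun k => absurd k.is_lt (by omega)⟩⟩
  | succ n ih =>
    obtain ⟨σ'⟩ := ih
    obtain ⟨σ, _⟩ := exists_insert (⟨0, by omega⟩ : Fin (2 * n + 1)) σ'
    exact ⟨σ⟩

theorem homComp_aeval {ι κ : Type} (F : ι → MvPolynomial κ ℂ) (hF : ∀ i, (F i).IsHomogeneous 1)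
    (p : MvPolynomial ι ℂ) (t : ℕ) :
    homogeneousComponent t (aeval F p) = aeval F (homogeneousComponent t p) := by
  have h := (sum_homogeneousComponent p)
  conv_lhs => rw [← h]
  rw [map_sum, map_sum]
  have h1 : ∀ i, homogeneousComponent t (aeval F (homogeneousComponent i p)) =
      if t = i then aeval F (homogeneousComponent i p) else 0 := by
    intro i
    apply homogeneousComponent_of_mem
    have := (homogeneousComponent_isHomogeneous i p).aeval F hF
    rwa [one_mul] at this
  simp only [h1]
  rw [Finset.sum_ite_eq]
  split_ifs with h2
  · rfl
  · rw [homogeneousComponent_eq_zero t p, map_zero]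
    simpa using h2

theorem wheel_homComp {ι : Type} [LinearOrder ι] (p : MvPolynomial ι ℂ) (hp : WheelFun p) (t : ℕ) :
    WheelFun (homogeneousComponent t p) := by
  rw [wheelFun_iff] at hp ⊢
  intro i j k hij hjk
  rw [← homComp_aeval, hp i j k hij hjk, map_zero]
  intro l
  unfold wsub
  split_ifs
  · exact (isHomogeneous_X _ _).C_mul _
  · exact (isHomogeneous_X _ _).C_mul _
  · exact isHomogeneous_X _ _

theorem hom_eval_smul {ι : Type} (p : MvPolynomial ι ℂ) {d : ℕ} (hp : p.IsHomogeneous d) (c : ℂ)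
    (z : ι → ℂ) : eval (fun i => c * z i) p = c ^ d * eval z p := by
  rw [eval_eq, eval_eq, Finset.mul_sum]
  apply Finset.sum_congr rfl
  intro m hm
  have h1 := hp (mem_support_iff.mp hm)
  rw [Finsupp.weight_apply] at h1
  simp only [mul_pow, Finset.prod_mul_distrib, Finset.prod_pow_eq_pow_sum]
  have : ∑ i ∈ m.support, m i = d := by
    rw [← h1, Finsupp.sum]; simp
  rw [this]; ring

theorem wheel_homog {m : ℕ} (p : MvPolynomial (Fin (2 * m)) ℂ) (hp : WheelFun p)
    (hd : p.totalDegree ≤ m * (m - 1)) (hm : minDeg (2 * m) = m * (m - 1)) :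
    p.IsHomogeneous (m * (m - 1)) := by
  have h1 : p = homogeneousComponent (m * (m - 1)) p := by
    conv_lhs => rw [← sum_homogeneousComponent p]
    have h2 : ∑ i ∈ Finset.range (p.totalDegree + 1), homogeneousComponent i p =
        ∑ i ∈ Finset.range (p.totalDegree + 1),
          if i = m * (m - 1) then homogeneousComponent (m * (m - 1)) p else 0 := by
      apply Finset.sum_congr rfl
      intro i hi
      split_ifs with h
      · rw [h]
      · apply lemA (2 * m) (Fin (2 * m)) _ (by simp) (wheel_homComp p hp i)
        rw [hm]
        have h3 := (homogeneousComponent_isHomogeneous i p).totalDegree_le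
        rw [Finset.mem_range] at hi
        omega
    rw [h2, Finset.sum_ite_eq']
    split_ifs with h3
    · rfl
    · rw [homogeneousComponent_eq_zero]
      simpa using h3
  rw [h1]
  exact homogeneousComponent_isHomogeneous _ _

theorem minDeg_even (m : ℕ) : minDeg (2 * m) = m * (m - 1) := by
  unfold minDeg
  cases m with
  | zero => rfl
  | succ m =>
    have : (2 * (m + 1) - 1) ^ 2 = 4 * ((m + 1) * m) + 1 := by
      have : 2 * (m + 1) - 1 = 2 * m + 1 := by omega
      rw [this]; ring
    rw [this]
    simp only [Nat.add_sub_cancel]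
    omega

theorem spin_ins {m : ℕ} {κ : Fin (2 * m + 1)} {σ : NCM (m + 1)} {σ' : NCM m} (h : Ins κ σ σ') :
    extZ (ek κ) (kA κ) (kB κ) q⁻¹ (fun k => if k < σ'.f k then q⁻¹ else q) =
      fun k => if k < σ.f k then q⁻¹ else q := by
  obtain ⟨h1, h2, h3⟩ := h
  rw [← extZ_unique (ek κ) (ek_inj κ) (kA_ne_kB κ) (ek_ne_kA κ) (ek_ne_kB κ) (ek_cover κ) q⁻¹
    (fun k => if k < σ.f k then q⁻¹ else q)]
  · congr 1
    funext i
    simp only [Function.comp, h3, ek_lt_iff]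
  · simp only [h1, kA_lt_kB, if_true]
  · simp only [h2, not_lt.mpr (kA_lt_kB κ).le, if_false]
    rw [q_inv]
    linear_combination (-q) * q_cube

theorem uniqB (n : ℕ) (p : MvPolynomial (Fin (2 * n)) ℂ) (hp : WheelFun p)
    (hd : p.totalDegree ≤ n * (n - 1)) (hz : ∀ σ, evalNC p σ = 0) : p = 0 := by
  have h00 : p.totalDegree = 0 → p = 0 := by
    intro h
    rw [totalDegree_eq_zero_iff_eq_C] at h
    obtain ⟨σ⟩ := ncm_nonempty n
    have h2 := hz σ
    rw [h] at h2 ⊢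
    unfold evalNC at h2
    rw [eval_C] at h2
    rw [h2, C_0]
  induction n with
  | zero => apply h00; omega
  | succ m ih =>
    match m, ih with
    | 0, ih => apply h00; omega
    | m + 1, ih =>
      have hhom := wheel_homog p hp hd (minDeg_even _)
      have hd' : p.totalDegree ≤ minDeg (2 * m + 1 + 3) := by
        have := minDeg_even (m + 1 + 1)
        have e : 2 * m + 1 + 3 = 2 * (m + 1 + 1) := by ring
        rw [e, this]; exact hd
      apply zero_of_adj (lemA (2 * m + 1 + 1)) p (by simp; ring) hp hd'
      intro i j hij hadj
      obtain ⟨κ, rfl, rfl⟩ : ∃ κ : Fin (2 * (m + 1) + 1), i = kA κ ∧ j = kB κ := by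
        rw [Fin.lt_def] at hij
        refine ⟨⟨i, by omega⟩, Fin.ext rfl, ?_⟩
        rw [Fin.ext_iff, kB_val]
        have := hadj ⟨i + 1, by omega⟩ (by rw [Fin.lt_def]; simp)
        rw [Fin.lt_def] at this
        change ¬ ((i : ℕ) + 1 < j) at this
        change (j : ℕ) = i + 1
        omega
      obtain ⟨r, hr1, hr2, hr3⟩ := restrict_div (ek κ) (ek_strictMono κ) (ek_ne_kA κ) (ek_ne_kB κ)
        q⁻¹ p hp (Finset.univ : Finset (Fin (2 * (m + 1)))) (fun t => t) (fun _ => 1)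
        (fun t _ t' _ h _ => h) (by
          intro t _ z hzt
          rcases lt_or_ge (t : ℕ) κ with h | h
          · apply hp (ek κ t) (kA κ) (kB κ) _ _ (kA_lt_kB κ)
            · rw [extZ_i, extZ_e _ (ek_inj κ) (ek_ne_kA κ) (ek_ne_kB κ), hzt, q_inv, mul_one]
            · rw [extZ_j _ (kA_ne_kB κ), extZ_e _ (ek_inj κ) (ek_ne_kA κ) (ek_ne_kB κ), hzt, q_inv]
              linear_combination q * q_cube
            · rw [Fin.lt_def, ek_val, kA_val, if_pos h]; exact h
          · apply hp (kA κ) (kB κ) (ek κ t) _ (kA_lt_kB κ)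
            · rw [Fin.lt_def, ek_val, kB_val, if_neg (not_lt.mpr h)]; omega
            · rw [extZ_i, extZ_j _ (kA_ne_kB κ)]
            · rw [extZ_i, extZ_e _ (ek_inj κ) (ek_ne_kA κ) (ek_ne_kB κ), hzt, q_inv]
              linear_combination -q_cube)
      have hr0 : r = 0 := by
        rcases hr2 with h | h
        · exact h
        have hrd : r.totalDegree ≤ (m + 1) * (m + 1 - 1) := by
          rw [Finset.card_univ, Fintype.card_fin] at h
          simp only [Nat.add_sub_cancel] at hd ⊢
          nlinarith
        have hrz : ∀ σ', evalNC r σ' = 0 := by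
          intro σ'
          obtain ⟨σ, hI⟩ := exists_insert κ σ'
          have h4 := hz σ
          unfold evalNC at h4 ⊢
          rw [← spin_ins hI, hr3] at h4
          rcases mul_eq_zero.mp h4 with h5 | h5
          · exfalso
            rw [Finset.prod_eq_zero_iff] at h5
            obtain ⟨t, _, ht⟩ := h5
            split_ifs at ht
            · rw [q_inv] at ht
              exact q_sq_ne_one (sub_eq_zero.mp ht)
            · exact q_ne_one (sub_eq_zero.mp ht)
          · exact h5
        apply ih r hr1 hrd hrz
        intro h9
        rw [totalDegree_eq_zero_iff_eq_C] at h9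
        obtain ⟨σ⟩ := ncm_nonempty (m + 1)
        have h2 := hrz σ
        rw [h9] at h2 ⊢
        unfold evalNC at h2
        rw [eval_C] at h2
        rw [h2, C_0]
      apply vanish_all_of_ne p (kA_ne_kB κ)
      intro z hz0 hzz
      set c := z (kA κ)
      have hq := q_ne_zero
      have : z = fun l => (c * q) * ((c * q)⁻¹ * z l) := by
        funext l
        field_simp
      rw [this, hom_eval_smul p hhom]
      rw [← extZ_unique (ek κ) (ek_inj κ) (kA_ne_kB κ) (ek_ne_kA κ) (ek_ne_kB κ) (ek_cover κ) q⁻¹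
        (fun l => (c * q)⁻¹ * z l), hr3, hr0]
      · simp
      · change (c * q)⁻¹ * c = q⁻¹
        field_simp
      · rw [hzz]
        field_simp


/-! ### Part 5: the residue sums -/

theorem inj_prod {n N : ℕ} (I : Fin n → Fin N) (hI : Function.Injective I) (P : Fin n → Prop)
    (g : Fin N → ℂ) :
    (∏ i, if ∃ k, I k = i ∧ P k then 1 else g i) * (∏ k, if P k then g (I k) else 1) =
      ∏ i, g i := by
  classical
  have h1 : (∏ k, if P k then g (I k) else 1) = ∏ i, if ∃ k, I k = i ∧ P k then g i else 1 := by
    rw [← Finset.prod_subset (Finset.subset_univ (Finset.univ.image I))]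
    · rw [Finset.prod_image (fun x _ y _ h => hI h)]
      apply Finset.prod_congr rfl
      intro k _
      have : (∃ k', I k' = I k ∧ P k') ↔ P k := by
        constructor
        · rintro ⟨k', h, h'⟩
          rwa [← hI h]
        · intro h
          exact ⟨k, rfl, h⟩
      simp only [this]
    · intro i _ hi
      rw [if_neg]
      rintro ⟨k, hk, _⟩
      apply hi
      rw [← hk]
      exact Finset.mem_image_of_mem _ (Finset.mem_univ k)
  rw [h1, ← Finset.prod_mul_distrib]
  apply Finset.prod_congr rfl
  intro i _
  split_ifs <;> simp

/-- uncancelled part of the product -/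
noncomputable def Qc {n N : ℕ} (a : Fin n → ℕ) (E : Fin N → Fin N → ℂ) (I : Fin n → Fin N) : ℂ :=
  ∏ j, ∏ i, if i < j ∧ ¬ ∃ k, I k = i ∧ a k ≤ j then E i j else 1

/-- the pair product -/
noncomputable def Pp {n N : ℕ} (E V : Fin N → Fin N → ℂ) (I : Fin n → Fin N) : ℂ :=
  ∏ k, ∏ l, if k < l then V (I l) (I k) * E (I k) (I l) else 1

/-- the denominators -/
noncomputable def Dn {n N : ℕ} (a : Fin n → ℕ) (V : Fin N → Fin N → ℂ) (I : Fin n → Fin N) : ℂ :=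
  ∏ k, ∏ i : Fin N, if (i : ℕ) < a k ∧ i ≠ I k then (V (I k) i)⁻¹ else 1

noncomputable def Tg {n N : ℕ} (a : Fin n → ℕ) (E V : Fin N → Fin N → ℂ) (I : Fin n → Fin N) : ℂ :=
  Qc a E I * Pp E V I * Dn a V I

def sk {n : ℕ} (N : ℕ) (a : Fin n → ℕ) (k : Fin n) : Finset (Fin N) :=
  Finset.univ.filter fun i => (i : ℕ) < a k

noncomputable def Phig {n N : ℕ} (a : Fin n → ℕ) (E V : Fin N → Fin N → ℂ) : ℂ :=
  ∑ I ∈ Fintype.piFinset (sk N a), Tg a E V I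

theorem mem_pi {n N : ℕ} (a : Fin n → ℕ) (I : Fin n → Fin N) :
    I ∈ Fintype.piFinset (sk N a) ↔ ∀ k, (I k : ℕ) < a k := by
  simp [Fintype.mem_piFinset, sk]

theorem Tg_noninj {n N : ℕ} (a : Fin n → ℕ) (E V : Fin N → Fin N → ℂ) (hV : ∀ i, V i i = 0)
    (I : Fin n → Fin N) (hI : ¬ Function.Injective I) : Tg a E V I = 0 := by
  have : Pp E V I = 0 := by
    unfold Function.Injective at hI
    push Not at hI
    obtain ⟨k, l, h, hne⟩ := hI
    unfold Pp
    rcases lt_or_gt_of_ne hne with h1 | h1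
    · apply Finset.prod_eq_zero (Finset.mem_univ k)
      apply Finset.prod_eq_zero (Finset.mem_univ l)
      rw [if_pos h1, h, hV, zero_mul]
    · apply Finset.prod_eq_zero (Finset.mem_univ l)
      apply Finset.prod_eq_zero (Finset.mem_univ k)
      rw [if_pos h1, h, hV, zero_mul]
  unfold Tg
  rw [this]; simp

/-- full product over pairs -/
noncomputable def Qf {N : ℕ} (E : Fin N → Fin N → ℂ) : ℂ := ∏ j, ∏ i, if i < j then E i j else 1

theorem Qc_cancel {n N : ℕ} (a : Fin n → ℕ) (E : Fin N → Fin N → ℂ) (I : Fin n → Fin N)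
    (hI : Function.Injective I) (hIa : ∀ k, (I k : ℕ) < a k) :
    Qc a E I * (∏ j : Fin N, ∏ k, if a k ≤ j then E (I k) j else 1) = Qf E := by
  unfold Qc Qf
  rw [← Finset.prod_mul_distrib]
  apply Finset.prod_congr rfl
  intro j _
  rw [← inj_prod I hI (fun k => a k ≤ j) (fun i => if i < j then E i j else 1)]
  congr 1
  · apply Finset.prod_congr rfl
    intro i _
    by_cases h1 : ∃ k, I k = i ∧ a k ≤ j
    · simp [h1]
    · simp [h1]
  · apply Finset.prod_congr rfl
    intro k _
    split_ifs with h1 h2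
    · rfl
    · exfalso; apply h2
      rw [Fin.lt_def]; exact (hIa k).trans_le h1
    · rfl

theorem prod_pairs_sq {n : ℕ} (w : Fin n → Fin n → ℂ) (hw : ∀ k l, w k l = w l k) :
    (∏ k, ∏ l, if k < l then w k l * w k l else 1) = ∏ k, ∏ l, if l ≠ k then w k l else 1 := by
  have h1 : ∀ k l : Fin n, (if l ≠ k then w k l else 1) =
      (if k < l then w k l else 1) * (if l < k then w l k else 1) := by
    intro k l
    rcases lt_trichotomy k l with h | h | h
    · simp [h, h.ne', not_lt.mpr h.le]
    · simp [h]
    · simp [h, h.ne, not_lt.mpr h.le, hw k l]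
  simp only [h1, Finset.prod_mul_distrib]
  rw [Finset.prod_comm (f := fun k l : Fin n => if l < k then w l k else 1)]
  rw [← Finset.prod_mul_distrib]
  apply Finset.prod_congr rfl
  intro k _
  rw [← Finset.prod_mul_distrib]
  apply Finset.prod_congr rfl
  intro l _
  split_ifs <;> simp

theorem Qf_rho {N : ℕ} (rho : Fin N → ℂ) :
    Qf (fun i j => rho i * rho j) = (∏ i, rho i) ^ (N - 1) := by
  have h0 : ∀ j i : Fin N, (if i < j then rho i * rho j else 1) =
      (if i < j then rho i else 1) * (if i < j then rho j else 1) := by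
    intro j i; split_ifs <;> simp
  unfold Qf
  simp only [h0, Finset.prod_mul_distrib]
  rw [Finset.prod_comm, ← Finset.prod_mul_distrib, ← Finset.prod_pow]
  refine Finset.prod_congr rfl fun k _ => ?_
  rw [← Finset.prod_mul_distrib]
  have h1 : ∀ i, (if k < i then rho k else 1) * (if i < k then rho k else 1) =
      if i = k then 1 else rho k := by
    intro i
    rcases lt_trichotomy k i with h | h | h
    · simp [h, h.ne', not_lt.mpr h.le]
    · simp [h]
    · simp [h, h.ne, not_lt.mpr h.le]
  simp only [h1]
  rw [← Finset.prod_erase_mul _ _ (Finset.mem_univ k), if_pos rfl, mul_one,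
    Finset.prod_congr rfl (g := fun _ => rho k)]
  · simp
  · intro i hi
    rw [if_neg (Finset.ne_of_mem_erase hi)]

theorem prod_ne_w {n : ℕ} (rho : Fin n → ℂ) (hr : ∀ i, rho i ≠ 0) (c : ℂ) (k : Fin n) :
    (∏ j, if j ≠ k then c * rho j else 1) * rho k = c ^ (n - 1) * ∏ i, rho i := by
  rw [← Finset.prod_erase_mul _ _ (Finset.mem_univ k),
    ← Finset.prod_erase_mul _ rho (Finset.mem_univ k)]
  simp only [ne_eq, not_true_eq_false, if_false, mul_one]
  rw [← mul_assoc]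
  congr 1
  rw [Finset.prod_congr rfl (g := fun j => c * rho j), Finset.prod_mul_distrib]
  · simp
  · intro j hj
    rw [if_pos (Finset.ne_of_mem_erase hj)]

theorem Tg_scale {n : ℕ} (a : Fin n → ℕ) (E V E' V' : Fin (2 * n) → Fin (2 * n) → ℂ)
    (rho : Fin (2 * n) → ℂ) (hr : ∀ i, rho i ≠ 0)
    (hE : ∀ i j, E' i j = (rho i * rho j) * E i j)
    (hV : ∀ i j, V' i j = (rho i * rho j) * V i j)
    (I : Fin n → Fin (2 * n)) (hI : Function.Injective I) (hIa : ∀ k, (I k : ℕ) < a k) :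
    Tg a E' V' I = (∏ i, rho i) ^ (n - 1) * Tg a E V I := by
  let w : Fin (2 * n) → Fin (2 * n) → ℂ := fun i j => rho i * rho j
  have hw : ∀ i j, w i j ≠ 0 := fun i j => mul_ne_zero (hr i) (hr j)
  have h1 : Qc a E' I = Qc a w I * Qc a E I := by
    unfold Qc
    simp only [← Finset.prod_mul_distrib]
    refine Finset.prod_congr rfl fun j _ => Finset.prod_congr rfl fun i _ => ?_
    split_ifs
    · rw [hE]
    · simp
  have h2 : Pp E' V' I = (∏ k, ∏ l, if k < l then w (I k) (I l) * w (I k) (I l) else 1) *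
      Pp E V I := by
    unfold Pp
    simp only [← Finset.prod_mul_distrib]
    refine Finset.prod_congr rfl fun j _ => Finset.prod_congr rfl fun i _ => ?_
    split_ifs
    · rw [hE, hV]; simp only [w]; ring
    · simp
  have h3 : Dn a V' I = Dn a w I * Dn a V I := by
    unfold Dn
    simp only [← Finset.prod_mul_distrib]
    refine Finset.prod_congr rfl fun j _ => Finset.prod_congr rfl fun i _ => ?_
    split_ifs
    · rw [hV, mul_inv]
    · simp
  have h4 := Qc_cancel a w I hI hIa
  rw [prod_pairs_sq (fun k l => w (I k) (I l)) (fun k l => by simp only [w]; ring)] at h2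
  set X := ∏ j : Fin (2 * n), ∏ k, if a k ≤ j then w (I k) j else 1 with hX
  have hX0 : X ≠ 0 := by
    rw [hX, Finset.prod_ne_zero_iff]; intro j _; rw [Finset.prod_ne_zero_iff]; intro k _
    split_ifs
    · exact hw _ _
    · exact one_ne_zero
  set W := ∏ k, ∏ j, if j ≠ I k then w (I k) j else 1 with hW
  have h5 : X = Dn a w I * W := by
    rw [hX, Finset.prod_comm]
    unfold Dn
    rw [hW, ← Finset.prod_mul_distrib]
    refine Finset.prod_congr rfl fun k _ => ?_
    rw [← Finset.prod_mul_distrib]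
    refine Finset.prod_congr rfl fun i _ => ?_
    have := hw (I k) i
    by_cases e1 : (i : ℕ) < a k
    · by_cases e2 : i = I k
      · simp [e2, not_le.mpr (hIa k)]
      · simp [e1, e2, not_le.mpr e1, this]
    · have e2 : i ≠ I k := by
        intro h; apply e1; rw [h]; exact hIa k
      simp [e1, e2, not_lt.mp e1]
  set R := ∏ i, rho i with hR
  have hR0 : R ≠ 0 := Finset.prod_ne_zero_iff.mpr fun i _ => hr i
  set RI := ∏ k, rho (I k) with hRI
  have hRI0 : RI ≠ 0 := Finset.prod_ne_zero_iff.mpr fun i _ => hr _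
  have h6 : W * RI = RI ^ (2 * n - 1) * R ^ n := by
    rw [hW, hRI, ← Finset.prod_mul_distrib]
    simp only [w, prod_ne_w rho hr]
    simp [Finset.prod_mul_distrib, Finset.prod_pow, hR]
  set Y := ∏ k, ∏ l, if l ≠ k then w (I k) (I l) else 1 with hY
  have h7 : Y * RI = RI ^ (n - 1) * RI ^ n := by
    rw [hY, hRI, ← Finset.prod_mul_distrib]
    simp only [w, prod_ne_w (fun k => rho (I k)) (fun k => hr _)]
    simp [Finset.prod_mul_distrib, Finset.prod_pow]
  have h8 : Qf w = R ^ (2 * n - 1) := Qf_rho rho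
  rw [h8] at h4
  unfold Tg
  rw [h1, h2, h3]
  have key : Qc a w I * Y * Dn a w I = R ^ (n - 1) := by
    have hW0 : W ≠ 0 := by
      intro h; rw [h, mul_zero] at h5; exact hX0 h5
    have e1 : Qc a w I * Y * Dn a w I * (W * RI) = R ^ (n - 1) * (W * RI) := by
      calc Qc a w I * Y * Dn a w I * (W * RI) = (Qc a w I * X) * (Y * RI) := by rw [h5]; ring
        _ = R ^ (n - 1) * (W * RI) := by
          rw [h4, h7, h6]
          cases n with
          | zero => simp
          | succ n =>
            have e : 2 * (n + 1) - 1 = n + (n + 1) := by omega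
            rw [e, Nat.add_sub_cancel, pow_add, pow_add]; ring
    exact mul_right_cancel₀ (mul_ne_zero hW0 hRI0) e1
  rw [← key]; ring


/-! ### Part 6: evaluation of residue sums by divided differences -/

noncomputable def Dd {ι : Type} [DecidableEq ι] (s : Finset ι) (z : ι → ℂ) (m : ℕ) : ℂ :=
  ∑ i ∈ s, z i ^ m * ∏ j ∈ s.erase i, (z i - z j)⁻¹

theorem Dd_step {ι : Type} [DecidableEq ι] (s : Finset ι) (z : ι → ℂ) (hz : Function.Injective z)
    (m : ℕ) (x : ι) (hx : x ∈ s) :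
    Dd s z (m + 1) = z x * Dd s z m + Dd (s.erase x) z m := by
  unfold Dd
  rw [Finset.mul_sum, ← sub_eq_iff_eq_add', ← Finset.sum_sub_distrib,
    ← Finset.sum_erase_add _ _ hx]
  have : z x ^ (m + 1) * ∏ j ∈ s.erase x, (z x - z j)⁻¹ - z x * (z x ^ m *
      ∏ j ∈ s.erase x, (z x - z j)⁻¹) = 0 := by ring
  rw [this, add_zero]
  apply Finset.sum_congr rfl
  intro i hi
  have hne : i ≠ x := Finset.ne_of_mem_erase hi
  have h1 : x ∈ s.erase i := Finset.mem_erase.mpr ⟨hne.symm, hx⟩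
  rw [← Finset.prod_erase_mul _ _ h1, Finset.erase_right_comm]
  have : z i - z x ≠ 0 := sub_ne_zero.mpr (hz.ne hne)
  field_simp
  ring

theorem Dd_zero {ι : Type} [DecidableEq ι] (z : ι → ℂ) (hz : Function.Injective z) (c : ℕ)
    (s : Finset ι) (hs : s.card = c + 1) : Dd s z 0 = if c = 0 then 1 else 0 := by
  induction c generalizing s with
  | zero =>
    obtain ⟨x, rfl⟩ := Finset.card_eq_one.mp hs
    simp [Dd]
  | succ c ih =>
    obtain ⟨x, hx, y, hy, hxy⟩ := Finset.one_lt_card.mp (by omega : 1 < s.card)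
    have h1 := Dd_step s z hz 0 x hx
    have h2 := Dd_step s z hz 0 y hy
    have e1 := ih (s.erase x) (by rw [Finset.card_erase_of_mem hx]; omega)
    have e2 := ih (s.erase y) (by rw [Finset.card_erase_of_mem hy]; omega)
    rw [e1] at h1
    rw [h1, e2] at h2
    have h3 : (z x - z y) * Dd s z 0 = 0 := by linear_combination h2
    have : z x - z y ≠ 0 := sub_ne_zero.mpr (hz.ne hxy)
    rcases mul_eq_zero.mp h3 with h | h
    · exact absurd h this
    · simpa using h

theorem exists_H {ι : Type} [DecidableEq ι] (m : ℕ) (s : Finset ι) :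
    ∃ H : MvPolynomial ι ℂ, (∀ z, Function.Injective z → eval z H = Dd s z m) ∧
      (s.Nonempty → eval 0 H = if m + 1 = s.card then 1 else 0) := by
  induction m generalizing s with
  | zero =>
    by_cases hs : s.Nonempty
    · refine ⟨C (if 0 + 1 = s.card then 1 else 0), ?_, ?_⟩
      · intro z hz
        have := Finset.card_pos.mpr hs
        rw [eval_C, Dd_zero z hz (s.card - 1) s (by omega)]
        split_ifs <;> first | rfl | omega
      · intro _
        rw [eval_C]
    · rw [Finset.not_nonempty_iff_eq_empty] at hs
      subst hs
      exact ⟨0, by simp [Dd], by simp⟩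
  | succ m ih =>
    by_cases hs : s.Nonempty
    · obtain ⟨x, hx⟩ := hs
      obtain ⟨H1, h1, h1'⟩ := ih s
      obtain ⟨H2, h2, h2'⟩ := ih (s.erase x)
      by_cases he : (s.erase x).Nonempty
      · refine ⟨X x * H1 + H2, ?_, ?_⟩
        · intro z hz
          rw [Dd_step s z hz m x hx]
          simp [h1 z hz, h2 z hz]
        · intro _
          have hc : (s.erase x).card = s.card - 1 := Finset.card_erase_of_mem hx
          have := Finset.card_pos.mpr he
          simp only [map_add, map_mul, eval_X, Pi.zero_apply, zero_mul, zero_add, h2' he, hc]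
          congr 1
          apply propext
          omega
      · rw [Finset.not_nonempty_iff_eq_empty] at he
        refine ⟨X x * H1, ?_, ?_⟩
        · intro z hz
          rw [Dd_step s z hz m x hx, he]
          simp [h1 z hz, Dd]
        · intro _
          have hc : (s.erase x).card = s.card - 1 := Finset.card_erase_of_mem hx
          rw [he] at hc
          have := Finset.card_pos.mpr ⟨x, hx⟩
          simp only [Finset.card_empty] at hc
          rw [if_neg (by omega)]
          simp
    · rw [Finset.not_nonempty_iff_eq_empty] at hs
      subst hs
      exact ⟨0, by simp [Dd], by simp⟩

theorem exists_g {ι : Type} [DecidableEq ι] (α β : MvPolynomial ι ℂ) (s : Finset ι) :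
    ∃ g : Polynomial (MvPolynomial ι ℂ),
      (∀ z : ι → ℂ, ∀ i0 ∈ s, (g.map (eval z)).eval (z i0) =
        ∏ i ∈ s.erase i0, (eval z α + eval z β * z i)) ∧
      (eval 0 α = 1 → eval 0 β = 0 → s.Nonempty → g.map (eval 0) = 1) := by
  induction s using Finset.induction_on with
  | empty => exact ⟨0, by simp, by simp⟩
  | insert x s hx ih =>
    obtain ⟨g, h1, h2⟩ := ih
    have hP : ∃ P : MvPolynomial ι ℂ, ∀ z, eval z P = ∏ i ∈ s, (eval z α + eval z β * z i) :=
      ⟨∏ i ∈ s, (α + β * X i), fun z => by simp only [map_prod, map_add, map_mul, eval_X]⟩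
    obtain ⟨P, hP⟩ := hP
    refine ⟨Polynomial.C P + Polynomial.C β * (Polynomial.C (X x) - Polynomial.X) * g, ?_, ?_⟩
    · intro z i0 hi0
      simp only [Polynomial.map_add, Polynomial.map_mul, Polynomial.map_sub, Polynomial.map_C,
        Polynomial.map_X, Polynomial.eval_add, Polynomial.eval_mul, Polynomial.eval_sub,
        Polynomial.eval_C, Polynomial.eval_X, RingHom.coe_coe, eval_X, hP]
      by_cases he : i0 = x
      · subst he
        rw [Finset.erase_insert hx]
        ring
      · have hi0s : i0 ∈ s := by
          rcases Finset.mem_insert.mp hi0 with h | h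
          · exact absurd h he
          · exact h
        rw [h1 z i0 hi0s, Finset.erase_insert_of_ne (Ne.symm he), Finset.prod_insert,
          ← Finset.prod_erase_mul s _ hi0s]
        · ring
        · intro h; exact hx (Finset.mem_of_mem_erase h)
    · intro ha hb _
      rw [Polynomial.map_add, Polynomial.map_mul, Polynomial.map_mul, Polynomial.map_C,
        Polynomial.map_C, hP, hb, ha]
      simp

theorem A_sum {n N : ℕ} (s : Fin n → Finset (Fin N))
    (G : MvPolynomial (Fin n) (MvPolynomial (Fin N) ℂ)) :
    ∃ A : MvPolynomial (Fin N) ℂ,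
      (∀ z : Fin N → ℂ, Function.Injective z →
        ∑ I ∈ Fintype.piFinset s, (∏ k, ∏ i ∈ (s k).erase (I k), (z (I k) - z i)⁻¹) *
          eval (fun k => z (I k)) (map (eval z) G) = eval z A) ∧
      ((∀ k, (s k).Nonempty) → ∀ m : Fin n →₀ ℕ, (∀ k, m k + 1 = (s k).card) →
        eval 0 A = coeff m (map (eval 0) G)) := by
  have hH := fun (k : Fin n) (m : ℕ) => exists_H m (s k)
  choose H hH1 hH2 using hH
  refine ⟨∑ m ∈ G.support, coeff m G * ∏ k, H k (m k), ?_, ?_⟩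
  · intro z hz
    have hG : ∀ w : Fin n → ℂ, eval w (map (eval z) G) =
        ∑ m ∈ G.support, eval z (coeff m G) * ∏ k, w k ^ m k := by
      intro w
      conv_lhs => rw [G.as_sum]
      rw [map_sum, map_sum]
      apply Finset.sum_congr rfl
      intro m _
      rw [map_monomial, eval_monomial, Finsupp.prod_fintype _ _ (by simp)]
    simp only [hG, Finset.mul_sum, map_sum, map_mul, map_prod]
    rw [Finset.sum_comm]
    apply Finset.sum_congr rfl
    intro m _
    simp only [hH1 _ _ z hz, Dd]
    rw [Finset.prod_univ_sum, Finset.mul_sum]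
    apply Finset.sum_congr rfl
    intro I _
    rw [Finset.prod_mul_distrib]
    ring
  · intro hne m hm
    simp only [map_sum, map_mul, map_prod, hH2 _ _ (hne _), ← hm, Nat.add_right_cancel_iff]
    have : ∀ m' : Fin n →₀ ℕ, (∏ k, if m' k = m k then (1 : ℂ) else 0) = if m' = m then 1 else 0 := by
      intro m'
      split_ifs with h
      · simp [h]
      · rw [Finset.prod_eq_zero_iff]
        by_contra h2
        push Not at h2
        apply h
        ext k
        by_contra h3
        exact h2 k (Finset.mem_univ k) (if_neg h3)
    simp only [this, coeff_map]
    simp only [mul_ite, mul_one, mul_zero, Finset.sum_ite_eq']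
    split_ifs with h
    · rfl
    · rw [notMem_support_iff.mp h, map_zero]

/-- the normalising denominator -/
noncomputable def Nn {n N : ℕ} (a : Fin n → ℕ) (E : Fin N → Fin N → ℂ) : ℂ :=
  ∏ j : Fin N, ∏ k, if a k ≤ j then ∏ i ∈ sk N a k, E i j else 1

theorem Dn_eq {n N : ℕ} (a : Fin n → ℕ) (z : Fin N → ℂ) (I : Fin n → Fin N) :
    Dn a (fun i j => z i - z j) I = ∏ k, ∏ i ∈ (sk N a k).erase (I k), (z (I k) - z i)⁻¹ := by
  unfold Dn
  apply Finset.prod_congr rfl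
  intro k _
  rw [← Finset.prod_filter]
  apply Finset.prod_congr _ (fun _ _ => rfl)
  ext i
  simp [sk, and_comm]

theorem A_main {n N : ℕ} (a : Fin n → ℕ) (α β : Fin N → MvPolynomial (Fin N) ℂ)
    (F : MvPolynomial (Fin n) ℂ)
    (hF : ∀ (z : Fin N → ℂ) (I : Fin n → Fin N),
      Pp (fun i j => eval z (α j) + eval z (β j) * z i) (fun i j => z i - z j) I =
        eval (fun k => z (I k)) F) :
    ∃ A : MvPolynomial (Fin N) ℂ,
      (∀ z : Fin N → ℂ, Function.Injective z →
        Nn a (fun i j => eval z (α j) + eval z (β j) * z i) *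
          Phig a (fun i j => eval z (α j) + eval z (β j) * z i) (fun i j => z i - z j) =
        Qf (fun i j => eval z (α j) + eval z (β j) * z i) * eval z A) ∧
      ((∀ j, eval 0 (α j) = 1) → (∀ j, eval 0 (β j) = 0) →
        (∀ k, (sk N a k).Nonempty) → ∀ m : Fin n →₀ ℕ, (∀ k, m k + 1 = (sk N a k).card) →
        eval 0 A = coeff m F) := by
  have hg := fun (k : Fin n) (j : Fin N) => exists_g (α j) (β j) (sk N a k)
  choose g hg1 hg2 using hg
  let G : MvPolynomial (Fin n) (MvPolynomial (Fin N) ℂ) :=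
    (∏ j : Fin N, ∏ k, if a k ≤ j then Polynomial.aeval (X k) (g k j) else 1) * map C F
  have hGev : ∀ (z : Fin N → ℂ), map (eval z) G = (∏ j : Fin N, ∏ k, if a k ≤ j then
      Polynomial.aeval (X k) ((g k j).map (eval z)) else 1) * F := by
    intro z
    simp only [G, map_mul, map_prod, map_map]
    congr 1
    · refine Finset.prod_congr rfl fun j _ => Finset.prod_congr rfl fun k _ => ?_
      split_ifs
      · rw [Polynomial.aeval_def, Polynomial.aeval_def, Polynomial.hom_eval₂,
          Polynomial.eval₂_map, map_X]
        congr 1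
        ext x <;> simp [algebraMap_eq]
      · simp
    · have : (eval z).comp C = RingHom.id ℂ := by ext x; simp
      rw [this, map_id]
  obtain ⟨A, hA1, hA2⟩ := A_sum (sk N a) G
  refine ⟨A, ?_, ?_⟩
  · intro z hz
    rw [← hA1 z hz]
    unfold Phig
    rw [Finset.mul_sum, Finset.mul_sum]
    apply Finset.sum_congr rfl
    intro I hIm
    rw [mem_pi] at hIm
    by_cases hI : Function.Injective I
    swap
    · rw [Tg_noninj _ _ _ (by simp) I hI, hGev]
      have h0 := hF z I
      have : Pp (fun i j => eval z (α j) + eval z (β j) * z i) (fun i j => z i - z j) I = 0 := by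
        unfold Function.Injective at hI
        push Not at hI
        obtain ⟨k, l, h, hne⟩ := hI
        unfold Pp
        rcases lt_or_gt_of_ne hne with h1 | h1
        · apply Finset.prod_eq_zero (Finset.mem_univ k)
          apply Finset.prod_eq_zero (Finset.mem_univ l)
          rw [if_pos h1, h]; simp
        · apply Finset.prod_eq_zero (Finset.mem_univ l)
          apply Finset.prod_eq_zero (Finset.mem_univ k)
          rw [if_pos h1, h]; simp
      rw [map_mul, ← h0, this]
      simp
    unfold Tg
    rw [Dn_eq, hF, hGev, map_mul, map_prod]
    have e1 : Nn a (fun i j => eval z (α j) + eval z (β j) * z i) =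
        (∏ j : Fin N, ∏ k, if a k ≤ j then eval z (α j) + eval z (β j) * z (I k) else 1) *
        (∏ j : Fin N, eval (fun k => z (I k)) (∏ k, if a k ≤ j then
          Polynomial.aeval (X k) ((g k j).map (eval z)) else 1)) := by
      unfold Nn
      rw [← Finset.prod_mul_distrib]
      refine Finset.prod_congr rfl fun j _ => ?_
      rw [map_prod, ← Finset.prod_mul_distrib]
      refine Finset.prod_congr rfl fun k _ => ?_
      have hmem : I k ∈ sk N a k := by simp [sk, hIm k]
      split_ifs with h
      · rw [← Finset.mul_prod_erase _ _ hmem, ← hg1 k j z (I k) hmem]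
        congr 1
        rw [Polynomial.aeval_def, Polynomial.hom_eval₂, Polynomial.eval, eval_X]
        congr 1
        ext x; simp [algebraMap_eq]
      · simp
    rw [e1]
    rw [← Qc_cancel a (fun i j => eval z (α j) + eval z (β j) * z i) I hI hIm]
    ring
  · intro h1 h2 h3 m hm
    rw [hA2 h3 m hm, hGev]
    have : (∏ j : Fin N, ∏ k, if a k ≤ j then Polynomial.aeval (X k : MvPolynomial (Fin n) ℂ)
        ((g k j).map (eval 0)) else 1) = 1 := by
      refine Finset.prod_eq_one fun j _ => Finset.prod_eq_one fun k _ => ?_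
      split_ifs
      · rw [hg2 k j (h1 j) (h2 j) (h3 k), map_one]
      · rfl
    rw [this, one_mul]


/-! ### Part 7: the polynomials attached to sequences -/

noncomputable def ell {N : ℕ} (z : Fin N → ℂ) (i j : Fin N) : ℂ := q * z i - q⁻¹ * z j

def Vz {N : ℕ} (z : Fin N → ℂ) (i j : Fin N) : ℂ := z i - z j

noncomputable def Phz {n N : ℕ} (a : Fin n → ℕ) (z : Fin N → ℂ) : ℂ := Phig a (ell z) (Vz z)

noncomputable def Vp (N : ℕ) : MvPolynomial (Fin N) ℂ :=
  ∏ i : Fin N, ∏ j : Fin N, if i ≠ j then X i - X j else 1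

theorem Vp_eval {N : ℕ} (z : Fin N → ℂ) : eval z (Vp N) ≠ 0 ↔ Function.Injective z := by
  unfold Vp
  simp only [map_prod, Finset.prod_ne_zero_iff, Finset.mem_univ, true_imp_iff]
  constructor
  · intro h i j hij
    by_contra hne
    have := h i j
    rw [if_pos hne] at this
    apply this
    simp [hij]
  · intro h i j
    split_ifs with hne
    · simpa [sub_eq_zero] using h.ne hne
    · simp

theorem Vp_dvd {N : ℕ} {i j : Fin N} (h : i ≠ j) : (X i - X j : MvPolynomial (Fin N) ℂ) ∣ Vp N := by
  unfold Vp
  refine dvd_trans ?_ (Finset.dvd_prod_of_mem _ (Finset.mem_univ i))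
  refine dvd_trans ?_ (Finset.dvd_prod_of_mem _ (Finset.mem_univ j))
  rw [if_pos h]

theorem Vp_ne {N : ℕ} : Vp N ≠ 0 := by
  intro h
  have : eval (fun i : Fin N => ((i : ℕ) : ℂ)) (Vp N) ≠ 0 := by
    rw [Vp_eval]
    intro i j hij
    simpa [Fin.ext_iff] using hij
  rw [h] at this
  simp at this

def IsRat {N : ℕ} (f : (Fin N → ℂ) → ℂ) : Prop :=
  ∃ (B : MvPolynomial (Fin N) ℂ) (m : ℕ), ∀ z, Function.Injective z →
    eval z B = eval z (Vp N) ^ m * f z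

theorem IsRat.poly {N : ℕ} {f : (Fin N → ℂ) → ℂ} (p : MvPolynomial (Fin N) ℂ)
    (h : ∀ z, eval z p = f z) : IsRat f :=
  ⟨p, 0, fun z _ => by simp [h]⟩

theorem IsRat.mul {N : ℕ} {f g : (Fin N → ℂ) → ℂ} (hf : IsRat f) (hg : IsRat g) :
    IsRat (fun z => f z * g z) := by
  obtain ⟨B, m, h⟩ := hf
  obtain ⟨B', m', h'⟩ := hg
  exact ⟨B * B', m + m', fun z hz => by rw [map_mul, h z hz, h' z hz]; ring⟩

theorem IsRat.add {N : ℕ} {f g : (Fin N → ℂ) → ℂ} (hf : IsRat f) (hg : IsRat g) :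
    IsRat (fun z => f z + g z) := by
  obtain ⟨B, m, h⟩ := hf
  obtain ⟨B', m', h'⟩ := hg
  exact ⟨Vp N ^ m' * B + Vp N ^ m * B', m + m', fun z hz => by
    simp only [map_add, map_mul, map_pow]; rw [h z hz, h' z hz]; ring⟩

theorem IsRat.prod {N : ℕ} {T : Type} (s : Finset T) (f : T → (Fin N → ℂ) → ℂ)
    (hf : ∀ t ∈ s, IsRat (f t)) : IsRat (fun z => ∏ t ∈ s, f t z) := by
  induction s using Finset.induction_on with
  | empty => exact IsRat.poly 1 (by simp)
  | insert x s hx ih =>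
    simp only [Finset.prod_insert hx]
    exact (hf x (Finset.mem_insert_self _ _)).mul
      (ih fun t ht => hf t (Finset.mem_insert_of_mem ht))

theorem IsRat.sum {N : ℕ} {T : Type} (s : Finset T) (f : T → (Fin N → ℂ) → ℂ)
    (hf : ∀ t ∈ s, IsRat (f t)) : IsRat (fun z => ∑ t ∈ s, f t z) := by
  induction s using Finset.induction_on with
  | empty => exact IsRat.poly 0 (by simp)
  | insert x s hx ih =>
    simp only [Finset.sum_insert hx]
    exact (hf x (Finset.mem_insert_self _ _)).add
      (ih fun t ht => hf t (Finset.mem_insert_of_mem ht))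

theorem IsRat.inv {N : ℕ} {i j : Fin N} (h : i ≠ j) : IsRat (fun z => (z i - z j)⁻¹) := by
  obtain ⟨B, hB⟩ := Vp_dvd h
  refine ⟨B, 1, fun z hz => ?_⟩
  have : z i - z j ≠ 0 := sub_ne_zero.mpr (hz.ne h)
  rw [hB]
  simp only [map_mul, map_sub, eval_X]
  field_simp

theorem IsRat.Phz {n N : ℕ} (a : Fin n → ℕ) : IsRat (N := N) (Phz a) := by
  unfold _root_.Phz Phig
  apply IsRat.sum
  intro I _
  unfold Tg Qc Pp Dn
  have hell : ∀ i j : Fin N, IsRat (fun z => ell z i j) := fun i j =>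
    IsRat.poly (C q * X i - C q⁻¹ * X j) (by simp [ell])
  have hV : ∀ i j : Fin N, IsRat (fun z => Vz z i j) := fun i j =>
    IsRat.poly (X i - X j) (by simp [Vz])
  have h1 : IsRat (N := N) (fun _ => 1) := IsRat.poly 1 (by simp)
  refine ((IsRat.prod _ _ fun j _ => IsRat.prod _ _ fun i _ => ?_).mul
    (IsRat.prod _ _ fun j _ => IsRat.prod _ _ fun i _ => ?_)).mul
    (IsRat.prod _ _ fun j _ => IsRat.prod _ _ fun i _ => ?_)
  · split_ifs
    · exact hell _ _
    · exact h1
  · split_ifs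
    · exact (hV _ _).mul (hell _ _)
    · exact h1
  · split_ifs with h
    · exact IsRat.inv (Ne.symm h.2)
    · exact h1

theorem q_sub_inv : q - q⁻¹ ≠ 0 := by
  rw [q_inv, sub_ne_zero]
  exact Ne.symm q_sq_ne_q

theorem exists_Phi0 {n N : ℕ} (a : Fin n → ℕ) : ∃ p : MvPolynomial (Fin N) ℂ,
    ∀ z, Function.Injective z → eval z p = Phz a z := by
  obtain ⟨B, m, hB⟩ := IsRat.Phz (N := N) a
  obtain ⟨A, hA, -⟩ := A_main (N := N) a (fun j => C (-q⁻¹) * X j) (fun _ => C q)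
    (∏ k, ∏ l, if k < l then (X l - X k) * (C q * X k - C q⁻¹ * X l) else 1) (by
      intro z I
      unfold Pp
      simp only [map_prod]
      refine Finset.prod_congr rfl fun k _ => Finset.prod_congr rfl fun l _ => ?_
      split_ifs
      · simp only [map_mul, map_sub, eval_X, eval_C]; ring
      · simp)
  have hE : ∀ z : Fin N → ℂ, (fun i j => eval z ((fun j => C (-q⁻¹) * X j : Fin N →
      MvPolynomial (Fin N) ℂ) j) + eval z ((fun _ => C q : Fin N → MvPolynomial (Fin N) ℂ) j) * z i)
      = ell z := by
    intro z
    ext i j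
    simp only [map_mul, eval_X, eval_C, ell]; ring
  simp only [hE] at hA
  let Np : MvPolynomial (Fin N) ℂ :=
    ∏ j : Fin N, ∏ k, if a k ≤ j then ∏ i ∈ sk N a k, (C q * X i - C q⁻¹ * X j) else 1
  let Qp : MvPolynomial (Fin N) ℂ :=
    ∏ j : Fin N, ∏ i, if i < j then (C q * X i - C q⁻¹ * X j) else 1
  have hN : ∀ z, eval z Np = Nn a (ell z) := by
    intro z
    simp only [Np, Nn, map_prod]
    refine Finset.prod_congr rfl fun k _ => Finset.prod_congr rfl fun l _ => ?_
    split_ifs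
    · simp [map_prod, ell]
    · simp
  have hQ : ∀ z, eval z Qp = Qf (ell z) := by
    intro z
    simp only [Qp, Qf, map_prod]
    refine Finset.prod_congr rfl fun k _ => Finset.prod_congr rfl fun l _ => ?_
    split_ifs
    · simp [ell]
    · simp
  have hN1 : eval (fun _ => 1) Np ≠ 0 := by
    rw [hN, Nn]
    simp only [Finset.prod_ne_zero_iff, Finset.mem_univ, true_imp_iff]
    intro j k
    split_ifs
    · rw [Finset.prod_ne_zero_iff]
      intro i _
      simpa [ell] using q_sub_inv
    · exact one_ne_zero
  have key : B * Np = Vp N ^ m * (Qp * A) := by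
    apply poly_eq_of_generic (Vp_ne (N := N))
    intro z hz
    rw [Vp_eval] at hz
    simp only [map_mul, map_pow]
    rw [hB z hz, hN, hQ, ← hA z hz]
    simp only [Phz]
    change _ * Phig a (ell z) (Vz z) * _ = _ * (_ * Phig a (ell z) (Vz z))
    ring
  have hrel : IsRelPrime (Vp N ^ m) Np := by
    apply IsRelPrime.pow_left
    apply IsRelPrime.prod_left
    intro i _
    apply IsRelPrime.prod_left
    intro j _
    split_ifs with hij
    · have hp : Prime (X i - X j : MvPolynomial (Fin N) ℂ) := by
        have := linform_prime i _ (indep_X (Ne.symm hij) 1)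
        simpa using this
      rw [hp.irreducible.isRelPrime_iff_not_dvd]
      rintro ⟨r, hr⟩
      apply hN1
      rw [hr]
      simp
    · exact isRelPrime_one_left
  have hdvd : Vp N ^ m ∣ B := hrel.dvd_of_dvd_mul_right ⟨_, key⟩
  obtain ⟨p, hp⟩ := hdvd
  refine ⟨p, fun z hz => ?_⟩
  have h1 := hB z hz
  rw [hp, map_mul, map_pow] at h1
  exact mul_left_cancel₀ (pow_ne_zero _ ((Vp_eval z).mpr hz)) h1

theorem Phz_scale {n : ℕ} (a : Fin n → ℕ) (c mu : ℂ) (hmu : mu ^ 2 = c) (hc : c ≠ 0)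
    (z : Fin (2 * n) → ℂ) :
    Phz a (fun i => c * z i) = c ^ (n * (n - 1)) * Phz a z := by
  unfold Phz Phig
  rw [Finset.mul_sum]
  apply Finset.sum_congr rfl
  intro I hI
  rw [mem_pi] at hI
  by_cases hinj : Function.Injective I
  · rw [Tg_scale a (ell z) (Vz z) _ _ (fun _ => mu) (fun _ h => hc (by rw [← hmu, h]; simp)) ?_ ?_
      I hinj hI]
    · congr 1
      simp only [Finset.prod_const, Finset.card_univ, Fintype.card_fin]
      rw [pow_mul, hmu, ← pow_mul]
    · intro i j; simp only [ell, ← hmu]; ring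
    · intro i j; simp only [Vz, ← hmu]; ring
  · rw [Tg_noninj _ _ _ (by simp [Vz]) I hinj, Tg_noninj _ _ _ (by simp [Vz]) I hinj, mul_zero]

theorem Phz_wheel {n N : ℕ} (a : Fin n → ℕ) (ha : Monotone a) (z : Fin N → ℂ) {i j k : Fin N}
    (hij : i < j) (hjk : j < k) (h1 : z j = q ^ 2 * z i) (h2 : z k = q * z i) : Phz a z = 0 := by
  have e1 : ell z i j = 0 := by
    simp only [ell, h1]; field_simp [q_ne_zero]; ring
  have e2 : ell z j k = 0 := by
    simp only [ell, h1, h2]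
    have := q_cube
    have h3 := q_inv
    rw [h3]
    linear_combination (0 : ℂ) * this
  unfold Phz Phig
  apply Finset.sum_eq_zero
  intro I hI
  rw [mem_pi] at hI
  by_cases c1 : ∃ k', I k' = i ∧ a k' ≤ j
  · by_cases c2 : ∃ l', I l' = j ∧ a l' ≤ k
    · obtain ⟨k', hk', hak⟩ := c1
      obtain ⟨l', hl', hal⟩ := c2
      have hlt : k' < l' := by
        by_contra h
        have := ha (not_lt.mp h)
        have h4 := hI l'
        rw [hl'] at h4
        omega
      have : Pp (ell z) (Vz z) I = 0 := by
        unfold Pp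
        apply Finset.prod_eq_zero (Finset.mem_univ k')
        apply Finset.prod_eq_zero (Finset.mem_univ l')
        rw [if_pos hlt, hk', hl', e1, mul_zero]
      unfold Tg
      rw [this]; simp
    · have : Qc a (ell z) I = 0 := by
        unfold Qc
        apply Finset.prod_eq_zero (Finset.mem_univ k)
        apply Finset.prod_eq_zero (Finset.mem_univ j)
        rw [if_pos ⟨hjk, c2⟩, e2]
      unfold Tg
      rw [this]; simp
  · have : Qc a (ell z) I = 0 := by
      unfold Qc
      apply Finset.prod_eq_zero (Finset.mem_univ j)
      apply Finset.prod_eq_zero (Finset.mem_univ i)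
      rw [if_pos ⟨hij, c1⟩, e1]
    unfold Tg
    rw [this]; simp

theorem q_norm_pt {N : ℕ} {i j k : Fin N} (hij : i < j) (hjk : j < k) :
    ∃ z : Fin N → ℂ, z j = q ^ 2 * z i ∧ z k = q * z i ∧ Function.Injective z := by
  have n1 : i ≠ j := hij.ne
  have n2 : j ≠ k := hjk.ne
  have n3 : i ≠ k := (hij.trans hjk).ne
  refine ⟨fun l => if l = i then 1 else if l = j then q ^ 2 else if l = k then q else
    ((l : ℕ) : ℂ) + 2, ?_, ?_, ?_⟩
  · simp [n1.symm]
  · simp [n2.symm, n3.symm]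
  · have hn : ∀ l : ℕ, (1 : ℝ) < ‖(l : ℂ) + 2‖ := by
      intro l
      have : ((l : ℂ) + 2) = (((l : ℝ) + 2 : ℝ) : ℂ) := by push_cast; ring
      rw [this, Complex.norm_real, Real.norm_of_nonneg (by positivity)]
      have : (0 : ℝ) ≤ l := by positivity
      linarith
    have hq := q_norm
    have m1 : ∀ l : ℕ, (l : ℂ) + 2 ≠ 1 := fun l h => by
      have := hn l; rw [h] at this; simp at this
    have m2 : ∀ l : ℕ, (l : ℂ) + 2 ≠ q := fun l h => by
      have := hn l; rw [h, hq] at this; simp at this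
    have m3 : ∀ l : ℕ, (l : ℂ) + 2 ≠ q ^ 2 := fun l h => by
      have := hn l; rw [h, norm_pow, hq] at this; simp at this
    have d1 := q_ne_one
    have d2 := q_sq_ne_one
    have d3 := q_sq_ne_q
    intro x y hxy
    simp only at hxy
    split_ifs at hxy with c1 c2 c3 c4 c5 c6 c7 c8 c9 c10 c11 c12 c13 c14 c15 <;>
      first
      | (subst_vars; rfl)
      | exact absurd hxy (d1 )
      | exact absurd hxy.symm (d1 )
      | exact absurd hxy (d2 )
      | exact absurd hxy.symm (d2 )
      | exact absurd hxy (d3 )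
      | exact absurd hxy.symm (d3 )
      | exact absurd hxy (m1 _)
      | exact absurd hxy.symm (m1 _)
      | exact absurd hxy (m2 _)
      | exact absurd hxy.symm (m2 _)
      | exact absurd hxy (m3 _)
      | exact absurd hxy.symm (m3 _)
      | skip
    apply Fin.ext
    have := add_right_cancel hxy
    exact_mod_cast this

theorem exists_Phi {n : ℕ} (a : Fin n → ℕ) : ∃ p : MvPolynomial (Fin (2 * n)) ℂ,
    (∀ z, Function.Injective z → eval z p = Phz a z) ∧ p.totalDegree ≤ n * (n - 1) ∧
    (Monotone a → WheelFun p) := by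
  obtain ⟨p, hp⟩ := exists_Phi0 (N := 2 * n) a
  refine ⟨p, hp, ?_, ?_⟩
  · set d := n * (n - 1) with hd
    have h1 : aeval (fun i => C 2 * X i : Fin (2 * n) → MvPolynomial (Fin (2 * n)) ℂ) p =
        C (2 ^ d) * p := by
      apply poly_eq_of_generic (Vp_ne (N := 2 * n))
      intro z hz
      rw [Vp_eval] at hz
      rw [eval_aeval]
      simp only [map_mul, eval_C, eval_X]
      rw [hp z hz, hp _ (fun x y h => hz (mul_left_cancel₀ two_ne_zero h))]
      obtain ⟨mu, hmu⟩ := IsSquare.exists_sq (2 : ℂ) (by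
        obtain ⟨r, hr⟩ := IsAlgClosed.exists_pow_nat_eq (2 : ℂ) (n := 2) (by norm_num)
        exact ⟨r, by rw [← hr]; ring⟩)
      exact Phz_scale a 2 mu hmu.symm two_ne_zero z
    have h2 : ∀ t, t ≠ d → homogeneousComponent t p = 0 := by
      intro t ht
      have h3 := congrArg (homogeneousComponent t) h1
      rw [homComp_aeval _ (fun i => (isHomogeneous_X ℂ i).C_mul 2), homogeneousComponent_C_mul] at h3
      apply MvPolynomial.funext
      intro z
      have h4 := congrArg (eval z) h3
      rw [eval_aeval] at h4
      simp only [map_mul, eval_C, eval_X] at h4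
      rw [hom_eval_smul _ (homogeneousComponent_isHomogeneous t p) 2 z] at h4
      have h5 : ((2 : ℂ) ^ t - 2 ^ d) ≠ 0 := by
        rw [sub_ne_zero]
        intro h
        apply ht
        have : (2 : ℕ) ^ t = 2 ^ d := by exact_mod_cast h
        exact Nat.pow_right_injective (le_refl 2) this
      have h6 : ((2 : ℂ) ^ t - 2 ^ d) * eval z (homogeneousComponent t p) = 0 := by
        rw [sub_mul, sub_eq_zero]; exact h4
      simpa [h5] using h6
    have h3 : p = homogeneousComponent d p := by
      conv_lhs => rw [← sum_homogeneousComponent p]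
      by_cases hdt : d ∈ Finset.range (p.totalDegree + 1)
      · rw [Finset.sum_eq_single_of_mem d hdt (fun t _ ht => h2 t ht)]
      · rw [Finset.sum_eq_zero (fun t ht => h2 t (fun h => hdt (h ▸ ht)))]
        rw [homogeneousComponent_eq_zero]
        simp at hdt; omega
    rw [h3]
    exact (homogeneousComponent_isHomogeneous d p).totalDegree_le
  · intro ha
    apply wheel_of_mul (Vp (2 * n))
    · intro i j k z hij hjk h1 h2
      rw [map_mul]
      by_cases hz : Function.Injective z
      · rw [hp z hz, Phz_wheel a ha z hij hjk h1 h2, mul_zero]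
      · rw [← Vp_eval, not_not] at hz
        rw [hz, zero_mul]
    · intro i j k hij hjk
      obtain ⟨z, h1, h2, h3⟩ := q_norm_pt hij hjk
      exact ⟨z, h1, h2, (Vp_eval z).mpr h3⟩

noncomputable def PhiP {n : ℕ} (a : Fin n → ℕ) : MvPolynomial (Fin (2 * n)) ℂ :=
  (exists_Phi a).choose

theorem PhiP_eval {n : ℕ} (a : Fin n → ℕ) (z : Fin (2 * n) → ℂ) (hz : Function.Injective z) :
    eval z (PhiP a) = Phz a z := (exists_Phi a).choose_spec.1 z hz

theorem PhiP_deg {n : ℕ} (a : Fin n → ℕ) : (PhiP a).totalDegree ≤ n * (n - 1) :=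
  (exists_Phi a).choose_spec.2.1

theorem PhiP_wheel {n : ℕ} (a : Fin n → ℕ) (ha : Monotone a) : WheelFun (PhiP a) :=
  (exists_Phi a).choose_spec.2.2 ha


/-! ### Part 8: vanishing for triple values -/

theorem Qc_perm {n N : ℕ} (a : Fin n → ℕ) (E : Fin N → Fin N → ℂ) (I : Fin n → Fin N)
    (s : Equiv.Perm (Fin n)) (hs : ∀ k, a (s k) = a k) : Qc a E (I ∘ s) = Qc a E I := by
  unfold Qc
  refine Finset.prod_congr rfl fun j _ => Finset.prod_congr rfl fun i _ => ?_
  have : (∃ k, (I ∘ s) k = i ∧ a k ≤ j) ↔ (∃ k, I k = i ∧ a k ≤ j) := by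
    constructor
    · rintro ⟨k, h1, h2⟩
      exact ⟨s k, h1, by rw [hs]; exact h2⟩
    · rintro ⟨k, h1, h2⟩
      refine ⟨s.symm k, by simpa using h1, ?_⟩
      rw [← hs]; simpa using h2
  simp only [this]

theorem Dn_perm {n N : ℕ} (a : Fin n → ℕ) (V : Fin N → Fin N → ℂ) (I : Fin n → Fin N)
    (s : Equiv.Perm (Fin n)) (hs : ∀ k, a (s k) = a k) : Dn a V (I ∘ s) = Dn a V I := by
  unfold Dn
  rw [← Equiv.prod_comp s (fun k => ∏ i : Fin N, if (i : ℕ) < a k ∧ i ≠ I k then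
    (V (I k) i)⁻¹ else 1)]
  refine Finset.prod_congr rfl fun k _ => ?_
  simp only [hs, Function.comp]

/-- pair product away from an exceptional set -/
noncomputable def PpT {n N : ℕ} (T : Finset (Fin n)) (E V : Fin N → Fin N → ℂ)
    (I : Fin n → Fin N) : ℂ :=
  ∏ k, ∏ l, if k < l ∧ ¬ (k ∈ T ∧ l ∈ T) then V (I l) (I k) * E (I k) (I l) else 1

theorem PpT_perm {n N : ℕ} (T : Finset (Fin n)) (E V : Fin N → Fin N → ℂ)
    (I : Fin n → Fin N) (s : Equiv.Perm (Fin n)) (hT : ∀ k, s k ∈ T ↔ k ∈ T)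
    (hlt : ∀ k l, ¬ (k ∈ T ∧ l ∈ T) → (s k < s l ↔ k < l)) : PpT T E V (I ∘ s) = PpT T E V I := by
  unfold PpT
  rw [← Equiv.prod_comp s (fun k => ∏ l, if k < l ∧ ¬ (k ∈ T ∧ l ∈ T) then
    V (I l) (I k) * E (I k) (I l) else 1)]
  refine Finset.prod_congr rfl fun k _ => ?_
  rw [← Equiv.prod_comp s (fun l => if s k < l ∧ ¬ (s k ∈ T ∧ l ∈ T) then
    V (I l) (I (s k)) * E (I (s k)) (I l) else 1)]
  refine Finset.prod_congr rfl fun l _ => ?_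
  have : (k < l ∧ ¬ (k ∈ T ∧ l ∈ T)) ↔ (s k < s l ∧ ¬ (s k ∈ T ∧ s l ∈ T)) := by
    rw [hT, hT]
    constructor
    · rintro ⟨h1, h2⟩; exact ⟨(hlt k l h2).mpr h1, h2⟩
    · rintro ⟨h1, h2⟩; exact ⟨(hlt k l h2).mp h1, h2⟩
  simp only [this, Function.comp]

noncomputable def f3 {N : ℕ} (E V : Fin N → Fin N → ℂ) (x y z : Fin N) : ℂ :=
  V y x * E x y * (V z x * E x z) * (V z y * E y z)

theorem Pp_split {n N : ℕ} (t0 t1 t2 : Fin n) (h01 : t0 < t1) (h12 : t1 < t2)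
    (E V : Fin N → Fin N → ℂ) (I : Fin n → Fin N) :
    Pp E V I = PpT {t0, t1, t2} E V I * f3 E V (I t0) (I t1) (I t2) := by
  have h02 := h01.trans h12
  have e : ∀ (T : Finset (Fin n)) (g : Fin n → Fin n → ℂ),
      (∏ k, ∏ l, if k < l then g k l else 1) =
      (∏ k, ∏ l, if k < l ∧ ¬ (k ∈ T ∧ l ∈ T) then g k l else 1) *
      (∏ k ∈ T, ∏ l ∈ T, if k < l then g k l else 1) := by
    intro T g
    have h1 : (∏ k ∈ T, ∏ l ∈ T, if k < l then g k l else 1) =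
        ∏ k, ∏ l, if k < l ∧ (k ∈ T ∧ l ∈ T) then g k l else 1 := by
      rw [← Finset.univ_inter T, ← Finset.prod_ite_mem]
      refine Finset.prod_congr rfl fun k _ => ?_
      rw [Finset.univ_inter T]
      split_ifs with hk
      · conv_lhs => rw [← Finset.univ_inter T, ← Finset.prod_ite_mem]
        refine Finset.prod_congr rfl fun l _ => ?_
        by_cases hl : l ∈ T <;> simp [hk, hl]
      · symm
        apply Finset.prod_eq_one
        intro l _
        simp [hk]
    rw [h1, ← Finset.prod_mul_distrib]
    refine Finset.prod_congr rfl fun k _ => ?_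
    rw [← Finset.prod_mul_distrib]
    refine Finset.prod_congr rfl fun l _ => ?_
    by_cases h2 : k < l <;> by_cases h3 : k ∈ T ∧ l ∈ T <;> simp [h2, h3]
  unfold Pp
  rw [e {t0, t1, t2}]
  unfold PpT f3
  congr 1
  have n01 := h01.ne
  have n12 := h12.ne
  have n02 := h02.ne
  have m01 := not_lt.mpr h01.le
  have m12 := not_lt.mpr h12.le
  have m02 := not_lt.mpr h02.le
  simp only [Finset.prod_insert (show t0 ∉ ({t1, t2} : Finset (Fin n)) by simp [n01, n02]),
    Finset.prod_insert (show t1 ∉ ({t2} : Finset (Fin n)) by simp [n12]), Finset.prod_singleton]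
  simp only [h01, h12, h02, m01, m12, m02, if_true, if_false, lt_irrefl]
  ring

theorem f3_sum {N : ℕ} (z : Fin N → ℂ) (x y w : Fin N) :
    f3 (ell z) (Vz z) x y w + f3 (ell z) (Vz z) y x w + f3 (ell z) (Vz z) x w y +
    f3 (ell z) (Vz z) w y x + f3 (ell z) (Vz z) y w x + f3 (ell z) (Vz z) w x y = 0 := by
  unfold f3 ell Vz
  rw [q_inv]
  have h := q_rel
  generalize z x = x'
  generalize z y = y'
  generalize z w = w'
  linear_combination (-(q ^ 3 + q ^ 4) * ((y' - x') * (w' - x') * (w' - y')) ^ 2) * h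

theorem Phz_triple {n N : ℕ} (a : Fin n → ℕ) (z : Fin N → ℂ) (t0 t1 t2 : Fin n)
    (h01 : (t0 : ℕ) + 1 = t1) (h12 : (t1 : ℕ) + 1 = t2) (ha1 : a t1 = a t0) (ha2 : a t2 = a t0) :
    Phz a z = 0 := by
  have l01 : t0 < t1 := by rw [Fin.lt_def]; omega
  have l12 : t1 < t2 := by rw [Fin.lt_def]; omega
  have n01 := l01.ne
  have n12 := l12.ne
  have n02 := (l01.trans l12).ne
  have key : ∀ s : Equiv.Perm (Fin n), (∀ k, k ∉ ({t0, t1, t2} : Finset (Fin n)) → s k = k) →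
      Phz a z = ∑ I ∈ Fintype.piFinset (sk N a), (Qc a (ell z) I * PpT {t0, t1, t2} (ell z) (Vz z) I *
        Dn a (Vz z) I) * f3 (ell z) (Vz z) (I (s t0)) (I (s t1)) (I (s t2)) := by
    intro s hs
    have hT : ∀ k, s k ∈ ({t0, t1, t2} : Finset (Fin n)) ↔ k ∈ ({t0, t1, t2} : Finset (Fin n)) := by
      intro k
      constructor
      · intro h
        by_contra h2
        rw [hs k h2] at h
        exact h2 h
      · intro h
        by_contra h2
        have := s.injective (hs _ h2)
        rw [this] at h2
        exact h2 h
    have haT : ∀ k ∈ ({t0, t1, t2} : Finset (Fin n)), a k = a t0 := by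
      intro k hk
      simp only [Finset.mem_insert, Finset.mem_singleton] at hk
      rcases hk with rfl | rfl | rfl
      · rfl
      · exact ha1
      · exact ha2
    have has : ∀ k, a (s k) = a k := by
      intro k
      by_cases hk : k ∈ ({t0, t1, t2} : Finset (Fin n))
      · rw [haT _ hk, haT _ ((hT k).mpr hk)]
      · rw [hs k hk]
    have hin : ∀ k : Fin n, k ∈ ({t0, t1, t2} : Finset (Fin n)) ↔ t0 ≤ k ∧ k ≤ t2 := by
      intro k
      simp only [Finset.mem_insert, Finset.mem_singleton, Fin.ext_iff, Fin.le_def]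
      omega
    have hlt : ∀ k l, ¬ (k ∈ ({t0, t1, t2} : Finset (Fin n)) ∧ l ∈ ({t0, t1, t2} : Finset (Fin n))) →
        (s k < s l ↔ k < l) := by
      intro k l hkl
      by_cases hk : k ∈ ({t0, t1, t2} : Finset (Fin n))
      · have hl : l ∉ ({t0, t1, t2} : Finset (Fin n)) := fun h => hkl ⟨hk, h⟩
        rw [hs l hl]
        have hk2 := (hT k).mpr hk
        rw [hin] at hk hk2 hl
        simp only [Fin.le_def, Fin.lt_def] at hk hk2 hl ⊢
        omega
      · rw [hs k hk]
        by_cases hl : l ∈ ({t0, t1, t2} : Finset (Fin n))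
        · have hl2 := (hT l).mpr hl
          rw [hin] at hk hl hl2
          simp only [Fin.le_def, Fin.lt_def] at hk hl hl2 ⊢
          omega
        · rw [hs l hl]
    unfold Phz Phig
    symm
    apply Finset.sum_bij (fun I _ => I ∘ s)
    · intro I hI
      rw [mem_pi] at hI ⊢
      intro k
      rw [← has k]; exact hI (s k)
    · intro I _ J _ h
      funext k
      have := congrFun h (s.symm k)
      simpa using this
    · intro J hJ
      refine ⟨J ∘ s.symm, ?_, ?_⟩
      · rw [mem_pi] at hJ ⊢
        intro k
        have h1 := hJ (s.symm k)
        have h2 := has (s.symm k)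
        rw [Equiv.apply_symm_apply] at h2
        rw [h2]; exact h1
      · funext k; simp
    · intro I _
      unfold Tg
      rw [Pp_split t0 t1 t2 l01 l12, Qc_perm a _ I s has, Dn_perm a _ I s has,
        PpT_perm _ _ _ I s hT hlt]
      simp only [Function.comp]
      ring
  have k1 := key 1 (by simp)
  have k2 := key (Equiv.swap t0 t1) (by
    intro k hk; simp only [Finset.mem_insert, Finset.mem_singleton, not_or] at hk
    exact Equiv.swap_apply_of_ne_of_ne hk.1 hk.2.1)
  have k3 := key (Equiv.swap t1 t2) (by
    intro k hk; simp only [Finset.mem_insert, Finset.mem_singleton, not_or] at hk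
    exact Equiv.swap_apply_of_ne_of_ne hk.2.1 hk.2.2)
  have k4 := key (Equiv.swap t0 t2) (by
    intro k hk; simp only [Finset.mem_insert, Finset.mem_singleton, not_or] at hk
    exact Equiv.swap_apply_of_ne_of_ne hk.1 hk.2.2)
  have k5 := key (Equiv.swap t0 t1 * Equiv.swap t1 t2) (by
    intro k hk; simp only [Finset.mem_insert, Finset.mem_singleton, not_or] at hk
    rw [Equiv.Perm.mul_apply, Equiv.swap_apply_of_ne_of_ne hk.2.1 hk.2.2,
      Equiv.swap_apply_of_ne_of_ne hk.1 hk.2.1])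
  have k6 := key (Equiv.swap t1 t2 * Equiv.swap t0 t1) (by
    intro k hk; simp only [Finset.mem_insert, Finset.mem_singleton, not_or] at hk
    rw [Equiv.Perm.mul_apply, Equiv.swap_apply_of_ne_of_ne hk.1 hk.2.1,
      Equiv.swap_apply_of_ne_of_ne hk.2.1 hk.2.2])
  simp only [Equiv.Perm.mul_apply, Equiv.Perm.one_apply, Equiv.swap_apply_left,
    Equiv.swap_apply_right, Equiv.swap_apply_of_ne_of_ne n02.symm n12.symm,
    Equiv.swap_apply_of_ne_of_ne n01 n02, Equiv.swap_apply_of_ne_of_ne n01.symm n12]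
    at k1 k2 k3 k4 k5 k6
  have hsum : Phz a z + Phz a z + Phz a z + Phz a z + Phz a z + Phz a z = 0 := by
    nth_rewrite 1 [k1]
    nth_rewrite 1 [k2]
    nth_rewrite 1 [k3]
    nth_rewrite 1 [k4]
    nth_rewrite 1 [k5]
    nth_rewrite 1 [k6]
    simp only [← Finset.sum_add_distrib]
    apply Finset.sum_eq_zero
    intro I _
    have := f3_sum z (I t0) (I t1) (I t2)
    linear_combination (Qc a (ell z) I * PpT {t0, t1, t2} (ell z) (Vz z) I * Dn a (Vz z) I) * this
  have h6 : (6 : ℂ) * Phz a z = 0 := by linear_combination hsum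
  simpa using h6


/-! ### Part 9: the recursion -/

theorem ek_bnd {m : ℕ} (κ : Fin (2 * m + 1)) (i : Fin (2 * m)) (A : ℕ) :
    ((ek κ i : Fin _) : ℕ) < A ↔ (i : ℕ) < fk κ A := by
  rw [ek_val]; unfold fk
  split_ifs <;> omega

theorem ek_bnd' {m : ℕ} (κ : Fin (2 * m + 1)) (i : Fin (2 * m)) (A : ℕ) :
    A ≤ ((ek κ i : Fin _) : ℕ) ↔ fk κ A ≤ (i : ℕ) := by
  rw [← not_lt, ek_bnd, not_lt]

def insI {n : ℕ} (κ : Fin (2 * n + 1)) (k0 : Fin (n + 1)) (I' : Fin n → Fin (2 * n)) :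
    Fin (n + 1) → Fin (2 * (n + 1)) :=
  k0.insertNth (α := fun _ => Fin (2 * (n + 1))) (kA κ) (fun x => ek κ (I' x))

theorem insI_same {n : ℕ} (κ : Fin (2 * n + 1)) (k0 : Fin (n + 1)) (I' : Fin n → Fin (2 * n)) :
    insI κ k0 I' k0 = kA κ := by simp [insI]

theorem insI_succ {n : ℕ} (κ : Fin (2 * n + 1)) (k0 : Fin (n + 1)) (I' : Fin n → Fin (2 * n))
    (x : Fin n) : insI κ k0 I' (k0.succAbove x) = ek κ (I' x) := by simp [insI]

theorem insI_ex {n : ℕ} (κ : Fin (2 * n + 1)) (k0 : Fin (n + 1)) (I' : Fin n → Fin (2 * n))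
    (a : Fin (n + 1) → ℕ) (i : Fin (2 * n)) (v : ℕ) :
    (∃ k, insI κ k0 I' k = ek κ i ∧ a k ≤ v) ↔ ∃ x, I' x = i ∧ a (k0.succAbove x) ≤ v := by
  constructor
  · rintro ⟨k, h1, h2⟩
    rcases Fin.eq_self_or_eq_succAbove k0 k with rfl | ⟨x, rfl⟩
    · rw [insI_same] at h1
      exact absurd h1.symm (ek_ne_kA κ i)
    · rw [insI_succ] at h1
      exact ⟨x, ek_inj κ h1, h2⟩
  · rintro ⟨x, rfl, h2⟩
    exact ⟨k0.succAbove x, insI_succ _ _ _ _, h2⟩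

section rec
variable {n : ℕ} (κ : Fin (2 * n + 1)) (k0 : Fin (n + 1)) (I' : Fin n → Fin (2 * n))
    (a : Fin (n + 1) → ℕ) (c : ℂ) (z : Fin (2 * (n + 1)) → ℂ) (z' : Fin (2 * n) → ℂ)

theorem Qc_ins (hA : z (kA κ) = c) (hB : z (kB κ) = q ^ 2 * c) (hE : ∀ i, z (ek κ i) = z' i)
    (hk0 : a k0 = κ + 1) (hI : Function.Injective I')
    (hIa : ∀ x, (I' x : ℕ) < fk κ (a (k0.succAbove x))) :
    Qc a (ell z) (insI κ k0 I') *
      ((∏ x, if a (k0.succAbove x) ≤ κ then (q * z' (I' x) - q⁻¹ * c) else 1) *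
       (∏ x, if a (k0.succAbove x) ≤ κ + 1 then q * (z' (I' x) - c) else 1)) =
    Qc (fun x => fk κ (a (k0.succAbove x))) (ell z') I' *
      ((∏ i : Fin (2 * n), if (i : ℕ) < κ then (q * z' i - q⁻¹ * c) else 1) *
       (∏ i : Fin (2 * n), if (i : ℕ) < κ then q * (z' i - c) else 1) *
       ∏ i : Fin (2 * n), if (κ : ℕ) ≤ i then -q⁻¹ * (z' i - q * c) else 1) := by
  have hltA : ∀ i : Fin (2 * n), ek κ i < kA κ ↔ (i : ℕ) < κ := by
    intro i; rw [Fin.lt_def, ek_val, kA_val]; split_ifs <;> omega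
  have hltB : ∀ i : Fin (2 * n), ek κ i < kB κ ↔ (i : ℕ) < κ := by
    intro i; rw [Fin.lt_def, ek_val, kB_val]; split_ifs <;> omega
  have hBlt : ∀ i : Fin (2 * n), kB κ < ek κ i ↔ (κ : ℕ) ≤ i := by
    intro i; rw [Fin.lt_def, ek_val, kB_val]; split_ifs <;> omega
  have hAlt : ∀ i : Fin (2 * n), kA κ < ek κ i ↔ (κ : ℕ) ≤ i := by
    intro i; rw [Fin.lt_def, ek_val, kA_val]; split_ifs <;> omega
  have hq3 := q_cube
  have hqi := q_inv
  let G : Fin (2 * (n + 1)) → Fin (2 * (n + 1)) → ℂ := fun j i =>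
    if i < j ∧ ¬ ∃ k, insI κ k0 I' k = i ∧ a k ≤ j then ell z i j else 1
  have g1 : ∏ i, G (kA κ) i = ∏ i, if ∃ x, I' x = i ∧ a (k0.succAbove x) ≤ κ then 1 else
      (if (i : ℕ) < κ then (q * z' i - q⁻¹ * c) else 1) := by
    rw [prod_split κ]
    have e1 : G (kA κ) (kA κ) = 1 := by simp [G]
    have e2 : G (kA κ) (kB κ) = 1 := by simp [G, not_lt.mpr (kA_lt_kB κ).le]
    rw [e1, e2, one_mul, one_mul]
    refine Finset.prod_congr rfl fun i _ => ?_
    simp only [G, insI_ex, hltA, kA_val, ell, hE, hA]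
    by_cases h1 : ∃ x, I' x = i ∧ a (k0.succAbove x) ≤ κ <;> simp [h1]
  have g2 : ∏ i, G (kB κ) i = ∏ i, if ∃ x, I' x = i ∧ a (k0.succAbove x) ≤ κ + 1 then 1 else
      (if (i : ℕ) < κ then q * (z' i - c) else 1) := by
    rw [prod_split κ]
    have e1 : G (kB κ) (kA κ) = 1 := by
      simp only [G]
      rw [if_neg]
      rintro ⟨_, h⟩
      exact h ⟨k0, insI_same _ _ _, by rw [hk0, kB_val]⟩
    have e2 : G (kB κ) (kB κ) = 1 := by simp [G]
    rw [e1, e2, one_mul, one_mul]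
    refine Finset.prod_congr rfl fun i _ => ?_
    simp only [G, insI_ex, hltB, kB_val, ell, hE, hB]
    have : q * z' i - q⁻¹ * (q ^ 2 * c) = q * (z' i - c) := by
      rw [hqi]; linear_combination (-q * c) * hq3
    rw [this]
    by_cases h1 : ∃ x, I' x = i ∧ a (k0.succAbove x) ≤ κ + 1 <;> simp [h1]
  have g3 : ∀ j', ∏ i, G (ek κ j') i = (if (κ : ℕ) ≤ j' then -q⁻¹ * (z' j' - q * c) else 1) *
      ∏ i, if i < j' ∧ ¬ ∃ x, I' x = i ∧ fk κ (a (k0.succAbove x)) ≤ j' then ell z' i j' else 1 := by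
    intro j'
    rw [prod_split κ]
    have e1 : G (ek κ j') (kA κ) = 1 := by
      simp only [G]
      rw [if_neg]
      rintro ⟨h1, h⟩
      refine h ⟨k0, insI_same _ _ _, ?_⟩
      rw [hk0]; exact h1
    have e2 : G (ek κ j') (kB κ) = if (κ : ℕ) ≤ j' then -q⁻¹ * (z' j' - q * c) else 1 := by
      have hno : ¬ ∃ k, insI κ k0 I' k = kB κ ∧ a k ≤ ek κ j' := by
        rintro ⟨k, h1, -⟩
        rcases Fin.eq_self_or_eq_succAbove k0 k with rfl | ⟨x, rfl⟩
        · rw [insI_same] at h1; exact kA_ne_kB κ h1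
        · rw [insI_succ] at h1; exact ek_ne_kB κ _ h1
      simp only [G, hno, not_false_eq_true, and_true, hBlt]
      have : ell z (kB κ) (ek κ j') = -q⁻¹ * (z' j' - q * c) := by
        simp only [ell, hB, hE, hqi]; ring
      rw [this]
    rw [e1, e2, one_mul]
    congr 1
    refine Finset.prod_congr rfl fun i _ => ?_
    simp only [G, insI_ex, ek_lt_iff, ek_bnd', ell, hE]
  have h0 : Qc a (ell z) (insI κ k0 I') = ∏ j, ∏ i, G j i := rfl
  rw [h0, prod_split κ, g1, g2]
  simp only [g3, Finset.prod_mul_distrib]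
  have r1 : (∏ x, if a (k0.succAbove x) ≤ κ then
      (if (I' x : ℕ) < κ then (q * z' (I' x) - q⁻¹ * c) else 1) else 1) =
      ∏ x, if a (k0.succAbove x) ≤ κ then (q * z' (I' x) - q⁻¹ * c) else 1 := by
    refine Finset.prod_congr rfl fun x _ => ?_
    split_ifs with h1 h2
    · rfl
    · exfalso
      have := hIa x
      unfold fk at this
      split_ifs at this <;> omega
    · rfl
  have r2 : (∏ x, if a (k0.succAbove x) ≤ κ + 1 then
      (if (I' x : ℕ) < κ then q * (z' (I' x) - c) else 1) else 1) =
      ∏ x, if a (k0.succAbove x) ≤ κ + 1 then q * (z' (I' x) - c) else 1 := by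
    refine Finset.prod_congr rfl fun x _ => ?_
    split_ifs with h1 h2
    · rfl
    · exfalso
      have := hIa x
      unfold fk at this
      split_ifs at this <;> omega
    · rfl
  have p1 : (∏ i : Fin (2 * n), if ∃ x, I' x = i ∧ a (k0.succAbove x) ≤ κ then 1 else
      (if (i : ℕ) < κ then (q * z' i - q⁻¹ * c) else 1)) *
      (∏ x, if a (k0.succAbove x) ≤ κ then (q * z' (I' x) - q⁻¹ * c) else 1) =
      ∏ i : Fin (2 * n), if (i : ℕ) < κ then (q * z' i - q⁻¹ * c) else 1 := by
    rw [← r1, ← inj_prod I' hI (fun x => a (k0.succAbove x) ≤ κ)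
      (fun i => if (i : ℕ) < κ then (q * z' i - q⁻¹ * c) else 1)]
    congr!
  have p2 : (∏ i : Fin (2 * n), if ∃ x, I' x = i ∧ a (k0.succAbove x) ≤ κ + 1 then 1 else
      (if (i : ℕ) < κ then q * (z' i - c) else 1)) *
      (∏ x, if a (k0.succAbove x) ≤ κ + 1 then q * (z' (I' x) - c) else 1) =
      ∏ i : Fin (2 * n), if (i : ℕ) < κ then q * (z' i - c) else 1 := by
    rw [← r2, ← inj_prod I' hI (fun x => a (k0.succAbove x) ≤ κ + 1)
      (fun i => if (i : ℕ) < κ then q * (z' i - c) else 1)]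
    congr!
  rw [← p1, ← p2]
  unfold Qc
  ring

theorem Pp_ins (hA : z (kA κ) = c) (hE : ∀ i, z (ek κ i) = z' i) :
    Pp (ell z) (Vz z) (insI κ k0 I') = Pp (ell z') (Vz z') I' *
      ∏ x, if k0.succAbove x < k0 then (c - z' (I' x)) * (q * z' (I' x) - q⁻¹ * c)
        else (z' (I' x) - c) * (q * c - q⁻¹ * z' (I' x)) := by
  unfold Pp
  rw [Fin.prod_univ_succAbove _ k0, Fin.prod_univ_succAbove _ k0]
  simp only [Fin.prod_univ_succAbove (fun l => if k0.succAbove _ < l then _ else _) k0]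
  simp only [insI_same, insI_succ, Fin.succAbove_lt_succAbove_iff, lt_irrefl, if_false, one_mul,
    ell, Vz, hA, hE, Finset.prod_mul_distrib]
  rw [← mul_assoc, mul_comm]
  congr 1
  rw [← Finset.prod_mul_distrib]
  refine Finset.prod_congr rfl fun x _ => ?_
  by_cases h : k0.succAbove x < k0
  · simp [h, not_lt.mpr h.le]
  · have h2 : k0 < k0.succAbove x := lt_of_le_of_ne (not_lt.mp h) (Fin.succAbove_ne k0 x).symm
    simp [h, h2]

theorem Dn_ins (hA : z (kA κ) = c) (hB : z (kB κ) = q ^ 2 * c) (hE : ∀ i, z (ek κ i) = z' i)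
    (hk0 : a k0 = κ + 1) :
    Dn a (Vz z) (insI κ k0 I') = Dn (fun x => fk κ (a (k0.succAbove x))) (Vz z') I' *
      (∏ i : Fin (2 * n), if (i : ℕ) < κ then (c - z' i)⁻¹ else 1) *
      ∏ x, ((if κ + 1 ≤ a (k0.succAbove x) then (z' (I' x) - c)⁻¹ else 1) *
        (if κ + 2 ≤ a (k0.succAbove x) then (z' (I' x) - q ^ 2 * c)⁻¹ else 1)) := by
  unfold Dn
  rw [Fin.prod_univ_succAbove _ k0, prod_split κ]
  have e1 : ∀ x, (∏ i : Fin (2 * (n + 1)), if (i : ℕ) < a (k0.succAbove x) ∧ i ≠ insI κ k0 I' (k0.succAbove x) then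
      (Vz z (insI κ k0 I' (k0.succAbove x)) i)⁻¹ else 1) =
      ((if κ + 1 ≤ a (k0.succAbove x) then (z' (I' x) - c)⁻¹ else 1) *
        (if κ + 2 ≤ a (k0.succAbove x) then (z' (I' x) - q ^ 2 * c)⁻¹ else 1)) *
      ∏ i : Fin (2 * n), if (i : ℕ) < fk κ (a (k0.succAbove x)) ∧ i ≠ I' x then
        (Vz z' (I' x) i)⁻¹ else 1 := by
    intro x
    rw [prod_split κ]
    simp only [insI_succ, Vz, hA, hB, hE, kA_val, kB_val, ek_bnd]
    congr 1
    · congr 1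
      · have : (κ : ℕ) < a (k0.succAbove x) ∧ kA κ ≠ ek κ (I' x) ↔ κ + 1 ≤ a (k0.succAbove x) :=
          ⟨fun h => h.1, fun h => ⟨h, (ek_ne_kA κ (I' x)).symm⟩⟩
        simp only [this]
      · have : (κ : ℕ) + 1 < a (k0.succAbove x) ∧ kB κ ≠ ek κ (I' x) ↔
            κ + 2 ≤ a (k0.succAbove x) :=
          ⟨fun h => h.1, fun h => ⟨h, (ek_ne_kB κ (I' x)).symm⟩⟩
        simp only [this]
    · refine Finset.prod_congr rfl fun i _ => ?_
      simp [(ek_inj κ).eq_iff]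
  simp only [e1, Finset.prod_mul_distrib]
  have e2 : ∀ i : Fin (2 * n), ((ek κ i : ℕ) < a k0 ∧ ek κ i ≠ kA κ) ↔ (i : ℕ) < κ := by
    intro i
    rw [hk0, ek_bnd]
    simp only [ne_eq, ek_ne_kA κ i, not_false_eq_true, and_true, fk]
    split_ifs <;> omega
  simp only [insI_same, e2]
  simp only [Vz, hA, hE, kA_val, kB_val, hk0]
  simp only [ne_eq, not_true_eq_false, and_false, if_false, lt_irrefl, false_and, one_mul]
  ring

theorem T_ins (ha : Monotone a) (hA : z (kA κ) = c) (hB : z (kB κ) = q ^ 2 * c)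
    (hE : ∀ i, z (ek κ i) = z' i)
    (hk0 : a k0 = κ + 1) (hz1 : ∀ i, z' i ≠ c) (hz2 : ∀ i, z' i ≠ q * c)
    (hz3 : ∀ i, z' i ≠ q ^ 2 * c) (hI : Function.Injective I')
    (hIa : ∀ x, (I' x : ℕ) < fk κ (a (k0.succAbove x))) :
    Tg a (ell z) (Vz z) (insI κ k0 I') = (∏ i, -q⁻¹ * (z' i - q * c)) *
      (∏ x, if a (k0.succAbove x) = κ + 1 then
        (if k0.succAbove x < k0 then -(q * z' (I' x) - q⁻¹ * c) / (q * (z' (I' x) - c))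
          else (q * c - q⁻¹ * z' (I' x)) / (q * (z' (I' x) - c))) else -q⁻¹) *
      Tg (fun x => fk κ (a (k0.succAbove x))) (ell z') (Vz z') I' := by
  have hq0 := q_ne_zero
  have hq3 := q_cube
  have hqi := q_inv
  have d1 : ∀ i, z' i - c ≠ 0 := fun i => sub_ne_zero.mpr (hz1 i)
  have d1' : ∀ i, c - z' i ≠ 0 := fun i => sub_ne_zero.mpr (hz1 i).symm
  have d3 : ∀ i, z' i - q ^ 2 * c ≠ 0 := fun i => sub_ne_zero.mpr (hz3 i)
  have f2 : ∀ i, q * z' i - q⁻¹ * c = q * (z' i - q * c) := by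
    intro i; rw [hqi]; ring
  have d2 : ∀ i, q * z' i - q⁻¹ * c ≠ 0 := by
    intro i; rw [f2]; exact mul_ne_zero hq0 (sub_ne_zero.mpr (hz2 i))
  have hQ := Qc_ins κ k0 I' a c z z' hA hB hE hk0 hI hIa
  set D := (∏ x, if a (k0.succAbove x) ≤ κ then (q * z' (I' x) - q⁻¹ * c) else 1) *
       (∏ x, if a (k0.succAbove x) ≤ κ + 1 then q * (z' (I' x) - c) else 1) with hD
  have hD0 : D ≠ 0 := by
    rw [hD]
    refine mul_ne_zero (Finset.prod_ne_zero_iff.mpr fun x _ => ?_)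
      (Finset.prod_ne_zero_iff.mpr fun x _ => ?_)
    · split_ifs
      · exact d2 _
      · exact one_ne_zero
    · split_ifs
      · exact mul_ne_zero hq0 (d1 _)
      · exact one_ne_zero
  apply mul_right_cancel₀ hD0
  unfold Tg
  rw [Pp_ins κ k0 I' c z z' hA hE, Dn_ins κ k0 I' a c z z' hA hB hE hk0]
  have s1 : (∏ i : Fin (2 * n), -q⁻¹ * (z' i - q * c)) =
      ((∏ i : Fin (2 * n), if (i : ℕ) < κ then (q * z' i - q⁻¹ * c) else 1) *
       (∏ i : Fin (2 * n), if (i : ℕ) < κ then q * (z' i - c) else 1) *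
       ∏ i : Fin (2 * n), if (κ : ℕ) ≤ i then -q⁻¹ * (z' i - q * c) else 1) *
      (∏ i : Fin (2 * n), if (i : ℕ) < κ then (c - z' i)⁻¹ else 1) := by
    simp only [← Finset.prod_mul_distrib]
    refine Finset.prod_congr rfl fun i _ => ?_
    by_cases h : (i : ℕ) < κ
    · have h' : ¬ (κ : ℕ) ≤ i := not_le.mpr h
      simp only [h, h', if_true, if_false]
      have := d1' i
      rw [f2, hqi]
      field_simp
      ring
    · have h' : (κ : ℕ) ≤ i := not_lt.mp h
      simp only [h, h', if_true, if_false]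
      ring
  have s2 : (∏ x, if k0.succAbove x < k0 then (c - z' (I' x)) * (q * z' (I' x) - q⁻¹ * c)
        else (z' (I' x) - c) * (q * c - q⁻¹ * z' (I' x))) *
      (∏ x, ((if κ + 1 ≤ a (k0.succAbove x) then (z' (I' x) - c)⁻¹ else 1) *
        (if κ + 2 ≤ a (k0.succAbove x) then (z' (I' x) - q ^ 2 * c)⁻¹ else 1))) =
      (∏ x, if a (k0.succAbove x) = κ + 1 then
        (if k0.succAbove x < k0 then -(q * z' (I' x) - q⁻¹ * c) / (q * (z' (I' x) - c))
          else (q * c - q⁻¹ * z' (I' x)) / (q * (z' (I' x) - c))) else -q⁻¹) * D := by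
    rw [hD]
    simp only [← Finset.prod_mul_distrib]
    refine Finset.prod_congr rfl fun x _ => ?_
    have u1 := d1 (I' x)
    have u3 := d3 (I' x)
    rcases lt_trichotomy (a (k0.succAbove x)) (κ + 1) with h | h | h
    · have hlt : k0.succAbove x < k0 := by
        by_contra h2
        have := ha (not_lt.mp h2)
        omega
      have c1 : ¬ (κ : ℕ) + 1 ≤ a (k0.succAbove x) := by omega
      have c2 : ¬ (κ : ℕ) + 2 ≤ a (k0.succAbove x) := by omega
      have c3 : a (k0.succAbove x) ≤ κ := by omega
      have c4 : a (k0.succAbove x) ≤ κ + 1 := by omega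
      simp only [hlt, h.ne, c1, c2, c3, c4, if_true, if_false]
      field_simp
      ring
    · have c2 : ¬ (κ : ℕ) + 2 ≤ (κ : ℕ) + 1 := by omega
      have c3 : ¬ (κ : ℕ) + 1 ≤ κ := by omega
      simp only [h, c2, c3, if_true, if_false, le_refl]
      by_cases hlt : k0.succAbove x < k0
      · simp only [hlt, if_true]
        field_simp
        ring
      · simp only [hlt, if_false]
        field_simp
    · have hlt : ¬ k0.succAbove x < k0 := by
        intro h2
        have := ha h2.le
        omega
      have c1 : (κ : ℕ) + 1 ≤ a (k0.succAbove x) := by omega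
      have c2 : (κ : ℕ) + 2 ≤ a (k0.succAbove x) := by omega
      have c3 : ¬ a (k0.succAbove x) ≤ κ := by omega
      have c4 : ¬ a (k0.succAbove x) ≤ κ + 1 := by omega
      simp only [hlt, h.ne', c1, c2, c3, c4, if_true, if_false]
      have : q * c - q⁻¹ * z' (I' x) = -q⁻¹ * (z' (I' x) - q ^ 2 * c) := by
        rw [hqi]; linear_combination (-q * c) * hq3
      rw [this]
      have u3' : z' (I' x) - c * q ^ 2 ≠ 0 := by rw [mul_comm c]; exact u3
      field_simp
  rw [s1]
  set pp := (∏ x, if k0.succAbove x < k0 then (c - z' (I' x)) * (q * z' (I' x) - q⁻¹ * c)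
        else (z' (I' x) - c) * (q * c - q⁻¹ * z' (I' x)))
  set dd := (∏ x, ((if κ + 1 ≤ a (k0.succAbove x) then (z' (I' x) - c)⁻¹ else 1) *
        (if κ + 2 ≤ a (k0.succAbove x) then (z' (I' x) - q ^ 2 * c)⁻¹ else 1)))
  set rr := (∏ x, if a (k0.succAbove x) = κ + 1 then
        (if k0.succAbove x < k0 then -(q * z' (I' x) - q⁻¹ * c) / (q * (z' (I' x) - c))
          else (q * c - q⁻¹ * z' (I' x)) / (q * (z' (I' x) - c))) else -q⁻¹)
  linear_combination (pp * dd * Pp (ell z') (Vz z') I' *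
    Dn (fun x => fk κ (a (k0.succAbove x))) (Vz z') I' *
    (∏ i : Fin (2 * n), if (i : ℕ) < κ then (c - z' i)⁻¹ else 1)) * hQ +
    ((Qc (fun x => fk κ (a (k0.succAbove x))) (ell z') I' *
      ((∏ i : Fin (2 * n), if (i : ℕ) < κ then (q * z' i - q⁻¹ * c) else 1) *
       (∏ i : Fin (2 * n), if (i : ℕ) < κ then q * (z' i - c) else 1) *
       ∏ i : Fin (2 * n), if (κ : ℕ) ≤ i then -q⁻¹ * (z' i - q * c) else 1)) *
      Pp (ell z') (Vz z') I' * Dn (fun x => fk κ (a (k0.succAbove x))) (Vz z') I' *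
    (∏ i : Fin (2 * n), if (i : ℕ) < κ then (c - z' i)⁻¹ else 1)) * s2

end rec


/-! ### Part 10: the value at matchings -/

/-- the reduced sequence -/
def ahat {n : ℕ} (κ : ℕ) (a : Fin (n + 1) → ℕ) (k0 : Fin (n + 1)) : Fin n → ℕ :=
  fun x => fk κ (a (k0.succAbove x))

theorem insI_inj {n : ℕ} (κ : Fin (2 * n + 1)) (k0 k1 : Fin (n + 1)) (I J : Fin n → Fin (2 * n))
    (h : insI κ k0 I = insI κ k1 J) : k0 = k1 ∧ I = J := by
  have h0 : k0 = k1 := by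
    have := congrFun h k0
    rw [insI_same] at this
    rcases Fin.eq_self_or_eq_succAbove k1 k0 with h2 | ⟨x, h2⟩
    · exact h2
    · rw [h2, insI_succ] at this
      exact absurd this.symm (ek_ne_kA κ _)
  subst h0
  refine ⟨rfl, funext fun x => ?_⟩
  have := congrFun h (k0.succAbove x)
  rw [insI_succ, insI_succ] at this
  exact ek_inj κ this

section rec2
variable {n : ℕ} (κ : Fin (2 * n + 1))
    (a : Fin (n + 1) → ℕ) (c : ℂ) (z : Fin (2 * (n + 1)) → ℂ) (z' : Fin (2 * n) → ℂ)

theorem ell_AB (hA : z (kA κ) = c) (hB : z (kB κ) = q ^ 2 * c) : ell z (kA κ) (kB κ) = 0 := by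
  have hq3 := q_cube
  simp only [ell, hA, hB, q_inv]
  linear_combination (-q * c) * hq3

theorem T_supp (ha : Monotone a) (hA : z (kA κ) = c) (hB : z (kB κ) = q ^ 2 * c)
    (I : Fin (n + 1) → Fin (2 * (n + 1))) (hI : ∀ k, (I k : ℕ) < a k)
    (hT : Tg a (ell z) (Vz z) I ≠ 0) :
    ∃ k0 I', a k0 = κ + 1 ∧ (∀ x, (I' x : ℕ) < ahat κ a k0 x) ∧ insI κ k0 I' = I := by
  have hinj : Function.Injective I := by
    by_contra h
    exact hT (Tg_noninj a _ _ (by intro i; simp [Vz]) I h)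
  have h0 := ell_AB κ c z hA hB
  have hQ : Qc a (ell z) I ≠ 0 := fun h => hT (by simp [Tg, h])
  have hP : Pp (ell z) (Vz z) I ≠ 0 := fun h => hT (by simp [Tg, h])
  have hex : ∃ k, I k = kA κ ∧ a k ≤ kB κ := by
    by_contra hno
    apply hQ
    unfold Qc
    refine Finset.prod_eq_zero (Finset.mem_univ (kB κ)) ?_
    refine Finset.prod_eq_zero (Finset.mem_univ (kA κ)) ?_
    rw [if_pos ⟨kA_lt_kB κ, hno⟩, h0]
  obtain ⟨k0, hk, hle⟩ := hex
  have hge := hI k0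
  rw [hk, kA_val] at hge
  rw [kB_val] at hle
  have hk0 : a k0 = κ + 1 := by omega
  have hnoB : ∀ l, I l ≠ kB κ := by
    intro l hl
    apply hP
    have h1 := hI l
    rw [hl, kB_val] at h1
    have h2 : k0 < l := by
      by_contra h
      have := ha (not_lt.mp h)
      omega
    unfold Pp
    refine Finset.prod_eq_zero (Finset.mem_univ k0) ?_
    refine Finset.prod_eq_zero (Finset.mem_univ l) ?_
    rw [if_pos h2, hk, hl, h0, mul_zero]
  have hpre : ∀ x, ∃ i, ek κ i = I (k0.succAbove x) := by
    intro x
    rcases ek_cover κ (I (k0.succAbove x)) with h | h | h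
    · exact absurd (hinj (h.trans hk.symm)) (Fin.succAbove_ne k0 x)
    · exact absurd h (hnoB _)
    · exact h
  choose I' hI' using hpre
  refine ⟨k0, I', hk0, fun x => ?_, funext fun k => ?_⟩
  · unfold ahat
    rw [← ek_bnd, hI']
    exact hI _
  · rcases Fin.eq_self_or_eq_succAbove k0 k with rfl | ⟨x, rfl⟩
    · rw [insI_same, hk]
    · rw [insI_succ, hI']

theorem Phz_sum (ha : Monotone a) (hA : z (kA κ) = c) (hB : z (kB κ) = q ^ 2 * c) :
    Phz a z = ∑ k0 ∈ Finset.univ.filter (fun k => a k = κ + 1),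
      ∑ I' ∈ Fintype.piFinset (sk (2 * n) (ahat κ a k0)), Tg a (ell z) (Vz z) (insI κ k0 I') := by
  unfold Phz Phig
  rw [Finset.sum_sigma']
  symm
  refine Finset.sum_of_injOn (fun p => insI κ p.1 p.2) ?_ ?_ ?_ ?_
  · rintro ⟨k0, I⟩ _ ⟨k1, J⟩ _ h
    obtain ⟨rfl, rfl⟩ := insI_inj κ k0 k1 I J h
    rfl
  · rintro ⟨k0, I⟩ h
    simp only [Finset.mem_coe, Finset.mem_sigma, Finset.mem_filter, Finset.mem_univ, true_and,
      mem_pi] at h ⊢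
    obtain ⟨h1, h2⟩ := h
    intro k
    rcases Fin.eq_self_or_eq_succAbove k0 k with rfl | ⟨x, rfl⟩
    · rw [insI_same, kA_val, h1]; omega
    · rw [insI_succ, ek_bnd]; exact h2 x
  · intro I hI hno
    by_contra hT
    rw [mem_pi] at hI
    obtain ⟨k0, I', h1, h2, h3⟩ := T_supp κ a c z ha hA hB I hI hT
    apply hno
    refine ⟨⟨k0, I'⟩, ?_, h3⟩
    simp only [Finset.mem_coe, Finset.mem_sigma, Finset.mem_filter, Finset.mem_univ, true_and,
      mem_pi]
    exact ⟨h1, h2⟩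
  · intro p _
    rfl

theorem Phz_zero (ha : Monotone a) (hA : z (kA κ) = c) (hB : z (kB κ) = q ^ 2 * c)
    (hk : ∀ k, a k ≠ κ + 1) : Phz a z = 0 := by
  rw [Phz_sum κ a c z ha hA hB]
  have : (Finset.univ.filter fun i => a i = κ + 1) = ∅ := by
    ext i; simp [hk]
  rw [this, Finset.sum_empty]

/-- the ratio factor -/
noncomputable def rfac (k0 : Fin (n + 1)) (I' : Fin n → Fin (2 * n)) (x : Fin n) : ℂ :=
  if a (k0.succAbove x) = κ + 1 then
        (if k0.succAbove x < k0 then -(q * z' (I' x) - q⁻¹ * c) / (q * (z' (I' x) - c))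
          else (q * c - q⁻¹ * z' (I' x)) / (q * (z' (I' x) - c))) else -q⁻¹

theorem T_ins2 (ha : Monotone a) (hA : z (kA κ) = c) (hB : z (kB κ) = q ^ 2 * c)
    (hE : ∀ i, z (ek κ i) = z' i) (k0 : Fin (n + 1))
    (hk0 : a k0 = κ + 1) (hz1 : ∀ i, z' i ≠ c) (hz2 : ∀ i, z' i ≠ q * c)
    (hz3 : ∀ i, z' i ≠ q ^ 2 * c) (I' : Fin n → Fin (2 * n))
    (hIa : I' ∈ Fintype.piFinset (sk (2 * n) (ahat κ a k0))) :
    Tg a (ell z) (Vz z) (insI κ k0 I') = (∏ i, -q⁻¹ * (z' i - q * c)) *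
      (∏ x, rfac κ a c z' k0 I' x) * Tg (ahat κ a k0) (ell z') (Vz z') I' := by
  rw [mem_pi] at hIa
  by_cases hI : Function.Injective I'
  · exact T_ins κ k0 I' a c z z' ha hA hB hE hk0 hz1 hz2 hz3 hI hIa
  · rw [Tg_noninj (ahat κ a k0) _ _ (by intro i; simp [Vz]) I' hI, mul_zero]
    apply Tg_noninj a _ _ (by intro i; simp [Vz])
    intro h
    apply hI
    intro x y hxy
    have := @h (k0.succAbove x) (k0.succAbove y) (by rw [insI_succ, insI_succ, hxy])
    exact Fin.succAbove_right_injective this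

theorem Phz_rec (ha : Monotone a) (hA : z (kA κ) = c) (hB : z (kB κ) = q ^ 2 * c)
    (hE : ∀ i, z (ek κ i) = z' i) (k0 : Fin (n + 1))
    (hk0 : a k0 = κ + 1) (hz1 : ∀ i, z' i ≠ c) (hz2 : ∀ i, z' i ≠ q * c)
    (hz3 : ∀ i, z' i ≠ q ^ 2 * c)
    (hm : (Finset.univ.filter fun i => a i = κ + 1).card ≤ 2) :
    Phz a z = ((chi ((Finset.univ.filter fun i => a i = κ + 1).card : ℤ) : ℤ) : ℂ) *
      ((∏ i, -q⁻¹ * (z' i - q * c)) * (-q⁻¹) ^ n * Phz (ahat κ a k0) z') := by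
  classical
  have hq0 := q_ne_zero
  rw [Phz_sum κ a c z ha hA hB]
  have hmem : k0 ∈ Finset.univ.filter fun i => a i = κ + 1 := by simp [hk0]
  have hpos := Finset.card_pos.mpr ⟨k0, hmem⟩
  rcases (by omega : (Finset.univ.filter fun i => a i = κ + 1).card = 1 ∨
    (Finset.univ.filter fun i => a i = κ + 1).card = 2) with h1 | h2
  · obtain ⟨k, hk⟩ := Finset.card_eq_one.mp h1
    rw [hk, Finset.mem_singleton] at hmem
    subst hmem
    rw [h1, hk, Finset.sum_singleton]
    have : chi ((1 : ℕ) : ℤ) = 1 := by decide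
    rw [this, Int.cast_one, one_mul]
    unfold Phz Phig
    rw [Finset.mul_sum]
    refine Finset.sum_congr rfl fun I' hI' => ?_
    rw [T_ins2 κ a c z z' ha hA hB hE k0 hk0 hz1 hz2 hz3 I' hI']
    have : ∀ x, rfac κ a c z' k0 I' x = -q⁻¹ := by
      intro x
      unfold rfac
      rw [if_neg]
      intro h
      have : k0.succAbove x ∈ Finset.univ.filter fun i => a i = κ + 1 := by simp [h]
      rw [hk, Finset.mem_singleton] at this
      exact Fin.succAbove_ne k0 x this
    simp [this]
  · -- the pair
    have key : ∀ k1 k2 : Fin (n + 1), k1 < k2 → (Finset.univ.filter fun i => a i = κ + 1) = {k1, k2} →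
      (∑ k0 ∈ Finset.univ.filter (fun k => a k = κ + 1),
      ∑ I' ∈ Fintype.piFinset (sk (2 * n) (ahat κ a k0)), Tg a (ell z) (Vz z) (insI κ k0 I')) =
      -1 * ((∏ i, -q⁻¹ * (z' i - q * c)) * (-q⁻¹) ^ n * Phz (ahat κ a k1) z') ∧
      ahat κ a k1 = ahat κ a k2 := by
      intro k1 k2 h12 hk
      have m1 : a k1 = κ + 1 := by
        have : k1 ∈ Finset.univ.filter fun i => a i = κ + 1 := by rw [hk]; simp
        simpa using this
      have m2 : a k2 = κ + 1 := by
        have : k2 ∈ Finset.univ.filter fun i => a i = κ + 1 := by rw [hk]; simp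
        simpa using this
      have hs : (k2 : ℕ) = k1 + 1 := by
        by_contra hne
        have hlt : (k1 : ℕ) < k2 := h12
        have hb := k2.isLt
        let t : Fin (n + 1) := ⟨k1 + 1, by omega⟩
        have u1 : a k1 ≤ a t := ha (by rw [Fin.le_def]; simp [t])
        have u2 : a t ≤ a k2 := ha (by rw [Fin.le_def]; simp [t]; omega)
        have : t ∈ Finset.univ.filter fun i => a i = κ + 1 := by simp; omega
        rw [hk] at this
        simp only [Finset.mem_insert, Finset.mem_singleton, Fin.ext_iff, t] at this
        omega
      have hsa : ∀ x : Fin n, ((x : ℕ) < k1 ∧ k1.succAbove x = x.castSucc ∧ k2.succAbove x = x.castSucc) ∨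
          ((x : ℕ) = k1 ∧ k1.succAbove x = k2 ∧ k2.succAbove x = k1) ∨
          ((k1 : ℕ) < x ∧ k1.succAbove x = x.succ ∧ k2.succAbove x = x.succ) := by
        intro x
        rcases lt_trichotomy (x : ℕ) k1 with h | h | h
        · left
          refine ⟨h, Fin.succAbove_of_castSucc_lt _ _ (by rw [Fin.lt_def]; simpa using h),
            Fin.succAbove_of_castSucc_lt _ _ (by rw [Fin.lt_def]; simp; omega)⟩
        · right; left
          refine ⟨h, ?_, ?_⟩
          · rw [Fin.succAbove_of_le_castSucc _ _ (by rw [Fin.le_def]; simp; omega)]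
            ext; simp; omega
          · rw [Fin.succAbove_of_castSucc_lt _ _ (by rw [Fin.lt_def]; simp; omega)]
            ext; simp; omega
        · right; right
          refine ⟨h, Fin.succAbove_of_le_castSucc _ _ (by rw [Fin.le_def]; simp; omega),
            Fin.succAbove_of_le_castSucc _ _ (by rw [Fin.le_def]; simp; omega)⟩
      have hah : ahat κ a k1 = ahat κ a k2 := by
        funext x
        unfold ahat
        rcases hsa x with ⟨-, h1, h2⟩ | ⟨-, h1, h2⟩ | ⟨-, h1, h2⟩
        · rw [h1, h2]
        · rw [h1, h2, m1, m2]
        · rw [h1, h2]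
      refine ⟨?_, hah⟩
      rw [hk, Finset.sum_pair h12.ne, ← hah, ← Finset.sum_add_distrib]
      unfold Phz Phig
      rw [Finset.mul_sum, Finset.mul_sum]
      refine Finset.sum_congr rfl fun I' hI' => ?_
      have hI2 := hI'
      rw [hah] at hI2
      rw [T_ins2 κ a c z z' ha hA hB hE k1 m1 hz1 hz2 hz3 I' hI',
        T_ins2 κ a c z z' ha hA hB hE k2 m2 hz1 hz2 hz3 I' hI2, ← hah]
      have hb := k2.isLt
      let x0 : Fin n := ⟨k1, by omega⟩
      have hout : ∀ k, k ≠ k1 → k ≠ k2 → a k ≠ κ + 1 := by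
        intro k u1 u2 u3
        have : k ∈ Finset.univ.filter fun i => a i = κ + 1 := by simp [u3]
        rw [hk] at this
        simp [u1, u2] at this
      have r1 : ∀ x ∈ Finset.univ.erase x0, rfac κ a c z' k1 I' x = -q⁻¹ := by
        intro x hx
        have hne : (x : ℕ) ≠ k1 := fun h => (Finset.ne_of_mem_erase hx) (Fin.ext h)
        unfold rfac
        rw [if_neg]
        rcases hsa x with ⟨h, h1, h2⟩ | ⟨h, h1, h2⟩ | ⟨h, h1, h2⟩
        · rw [h1]
          exact hout _ (by rw [Ne, Fin.ext_iff]; simp; omega) (by rw [Ne, Fin.ext_iff]; simp; omega)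
        · exact absurd h hne
        · rw [h1]
          exact hout _ (by rw [Ne, Fin.ext_iff]; simp; omega) (by rw [Ne, Fin.ext_iff]; simp; omega)
      have r2 : ∀ x ∈ Finset.univ.erase x0, rfac κ a c z' k2 I' x = -q⁻¹ := by
        intro x hx
        have hne : (x : ℕ) ≠ k1 := fun h => (Finset.ne_of_mem_erase hx) (Fin.ext h)
        unfold rfac
        rw [if_neg]
        rcases hsa x with ⟨h, h1, h2⟩ | ⟨h, h1, h2⟩ | ⟨h, h1, h2⟩
        · rw [h2]
          exact hout _ (by rw [Ne, Fin.ext_iff]; simp; omega) (by rw [Ne, Fin.ext_iff]; simp; omega)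
        · exact absurd h hne
        · rw [h2]
          exact hout _ (by rw [Ne, Fin.ext_iff]; simp; omega) (by rw [Ne, Fin.ext_iff]; simp; omega)
      have hx0 : k1.succAbove x0 = k2 ∧ k2.succAbove x0 = k1 := by
        rcases hsa x0 with ⟨h, h1, h2⟩ | ⟨h, h1, h2⟩ | ⟨h, h1, h2⟩
        · exact absurd h (lt_irrefl _)
        · exact ⟨h1, h2⟩
        · exact absurd h (lt_irrefl _)
      have s0 : rfac κ a c z' k1 I' x0 + rfac κ a c z' k2 I' x0 = q⁻¹ := by
        unfold rfac
        rw [hx0.1, hx0.2, if_pos m1, if_pos m2, if_pos h12, if_neg (not_lt.mpr h12.le)]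
        have d1 : z' (I' x0) - c ≠ 0 := sub_ne_zero.mpr (hz1 _)
        have hrel := q_rel
        have hq3 := q_cube
        field_simp
        linear_combination (c - z' (I' x0)) * hrel
      rw [← Finset.mul_prod_erase _ _ (Finset.mem_univ x0),
        ← Finset.mul_prod_erase _ (rfac κ a c z' k2 I') (Finset.mem_univ x0),
        Finset.prod_congr rfl r1, Finset.prod_congr rfl r2]
      simp only [Finset.prod_const, Finset.card_erase_of_mem (Finset.mem_univ x0), Finset.card_univ,
        Fintype.card_fin]
      have hn : n = (n - 1) + 1 := by omega
      have hpow : (-q⁻¹ : ℂ) ^ n = (-q⁻¹) ^ (n - 1) * (-q⁻¹) := by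
        rw [← pow_succ, ← hn]
      rw [hpow]
      linear_combination ((∏ i, -q⁻¹ * (z' i - q * c)) * (-q⁻¹) ^ (n - 1) *
        Tg (ahat κ a k1) (ell z') (Vz z') I') * s0
    obtain ⟨x, y, hxy, hk⟩ := Finset.card_eq_two.mp h2
    rw [hk] at hmem
    simp only [Finset.mem_insert, Finset.mem_singleton] at hmem
    have hchi : chi ((2 : ℕ) : ℤ) = -1 := by decide
    rw [h2, hchi]
    push_cast
    rcases lt_or_gt_of_ne hxy with h | h
    · obtain ⟨e1, e2⟩ := key x y h hk
      rw [e1]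
      rcases hmem with rfl | rfl
      · rfl
      · rw [e2]
    · obtain ⟨e1, e2⟩ := key y x h (by rw [hk, Finset.pair_comm])
      rw [e1]
      rcases hmem with rfl | rfl
      · rw [e2]
      · rfl

end rec2


/-! ### Part 11: the value at matchings, continued -/

theorem spin_prod {n : ℕ} (σ : NCM n) :
    (∏ i, -q⁻¹ * ((if i < σ.f i then q⁻¹ else q) - q * q⁻¹)) * (-q⁻¹) ^ n =
      (q - q⁻¹) ^ (2 * n) := by
  have hq0 := q_ne_zero
  have hq3 := q_cube
  have hqi := q_inv
  have hrel := q_rel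
  have h1 : ∀ i, -q⁻¹ * ((if i < σ.f i then q⁻¹ else q) - q * q⁻¹) =
      if i < σ.f i then -q⁻¹ * (q⁻¹ - q * q⁻¹) else -q⁻¹ * (q - q * q⁻¹) := by
    intro i; split_ifs <;> rfl
  simp only [h1]
  rw [Finset.prod_ite, Finset.prod_const, Finset.prod_const]
  have c1 := card_openers σ
  have c2 := Finset.card_filter_add_card_filter_not (s := Finset.univ) (fun i => i < σ.f i)
  rw [c1, Finset.card_univ, Fintype.card_fin] at c2
  have c3 : (Finset.univ.filter fun i => ¬ i < σ.f i).card = n := by omega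
  rw [c1, c3, pow_mul, ← mul_pow, ← mul_pow]
  congr 1
  rw [hqi]
  linear_combination (-q^9+q^8+q^7-2*q^6+q^5+q^4-2*q^3+q^2) * hq3

theorem Phz_empty (a : Fin 0 → ℕ) (z : Fin (2 * 0) → ℂ) : Phz a z = 1 := by
  unfold Phz Phig
  have : (Fintype.piFinset (sk (2 * 0) a)) = {fun i => i.elim0} := by
    ext I
    simp only [mem_pi, Finset.mem_singleton]
    constructor
    · intro _; funext i; exact i.elim0
    · intro _ i; exact i.elim0
  rw [this, Finset.sum_singleton]
  simp [Tg, Qc, Pp, Dn]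

theorem fk_mono (κ : ℕ) : Monotone (fk κ) := by
  intro x y h
  unfold fk
  split_ifs <;> omega

theorem ahat_mono {n : ℕ} (κ : ℕ) (a : Fin (n + 1) → ℕ) (k0) (ha : Monotone a) :
    Monotone (ahat κ a k0) := by
  intro x y h
  exact fk_mono κ (ha ((Fin.strictMono_succAbove k0).monotone h))

theorem triple_mono {n : ℕ} (a : Fin n → ℕ) (v : ℕ) (ha : Monotone a)
    (h : 3 ≤ (Finset.univ.filter fun i => a i = v).card) :
    ∃ t0 t1 t2 : Fin n, (t0 : ℕ) + 1 = t1 ∧ (t1 : ℕ) + 1 = t2 ∧ a t1 = a t0 ∧ a t2 = a t0 := by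
  classical
  set S := Finset.univ.filter fun i => a i = v with hS
  have hne : S.Nonempty := Finset.card_pos.mp (by omega)
  have h0 := S.min'_mem hne
  have h1 := S.max'_mem hne
  set m := S.min' hne
  set M := S.max' hne
  have hsub : S ⊆ Finset.Icc m M := by
    intro x hx
    rw [Finset.mem_Icc]
    exact ⟨S.min'_le x hx, S.le_max' x hx⟩
  have hc := Finset.card_le_card hsub
  rw [Fin.card_Icc] at hc
  have hM := M.isLt
  simp only [hS, Finset.mem_filter, Finset.mem_univ, true_and] at h0 h1
  refine ⟨m, ⟨m + 1, by omega⟩, ⟨m + 2, by omega⟩, rfl, rfl, ?_, ?_⟩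
  · apply le_antisymm
    · exact (ha (by rw [Fin.le_def]; simp; omega)).trans (h1.trans h0.symm).le
    · exact ha (by rw [Fin.le_def]; simp)
  · apply le_antisymm
    · exact (ha (by rw [Fin.le_def]; simp; omega)).trans (h1.trans h0.symm).le
    · exact ha (by rw [Fin.le_def]; simp)

/-- the genericity polynomial -/
noncomputable def gen (n : ℕ) : MvPolynomial (Fin n) ℂ :=
  Vp n * ∏ i, ((X i - C q⁻¹) * (X i - C (q * q⁻¹)) * (X i - C (q ^ 2 * q⁻¹)))

theorem gen_ne (n : ℕ) : gen n ≠ 0 := by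
  have : ∀ (i : Fin n) (c : ℂ), (X i - C c : MvPolynomial (Fin n) ℂ) ≠ 0 := by
    intro i c h
    have := congrArg (eval fun _ => c + 1) h
    simp at this
  refine mul_ne_zero Vp_ne (Finset.prod_ne_zero_iff.mpr fun i _ => ?_)
  exact mul_ne_zero (mul_ne_zero (this _ _) (this _ _)) (this _ _)

theorem gen_eval {n : ℕ} (z : Fin n → ℂ) (h : eval z (gen n) ≠ 0) :
    Function.Injective z ∧ (∀ i, z i ≠ q⁻¹) ∧ (∀ i, z i ≠ q * q⁻¹) ∧ ∀ i, z i ≠ q ^ 2 * q⁻¹ := by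
  unfold gen at h
  rw [map_mul] at h
  obtain ⟨h1, h2⟩ := mul_ne_zero_iff.mp h
  rw [Vp_eval] at h1
  rw [map_prod, Finset.prod_ne_zero_iff] at h2
  simp only [map_mul, map_sub, eval_X, eval_C, mul_ne_zero_iff, sub_ne_zero, Finset.mem_univ,
    true_imp_iff] at h2
  exact ⟨h1, fun i => (h2 i).1.1, fun i => (h2 i).1.2, fun i => (h2 i).2⟩

theorem ext_inj {n : ℕ} (κ : Fin (2 * n + 1)) (z : Fin (2 * n) → ℂ) (hz : Function.Injective z)
    (h1 : ∀ i, z i ≠ q⁻¹) (h3 : ∀ i, z i ≠ q ^ 2 * q⁻¹) :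
    Function.Injective (extZ (ek κ) (kA κ) (kB κ) q⁻¹ z) := by
  have eA := extZ_i (ek κ) (kA κ) (kB κ) q⁻¹ z
  have eB := extZ_j (ek κ) (kA_ne_kB κ) q⁻¹ z
  have eE := fun l => extZ_e (ek κ) (ek_inj κ) (ek_ne_kA κ) (ek_ne_kB κ) q⁻¹ z l
  have hAB : q⁻¹ ≠ q ^ 2 * q⁻¹ := by
    intro h
    have h2 : q⁻¹ ≠ 0 := inv_ne_zero q_ne_zero
    apply q_sq_ne_one
    apply mul_right_cancel₀ h2
    rw [one_mul, ← h]
  intro x y hxy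
  rcases ek_cover κ x with rfl | rfl | ⟨i, rfl⟩ <;> rcases ek_cover κ y with rfl | rfl | ⟨j, rfl⟩ <;>
    simp only [eA, eB, eE] at hxy
  · rfl
  · exact absurd hxy hAB
  · exact absurd hxy.symm (h1 _)
  · exact absurd hxy.symm hAB
  · rfl
  · exact absurd hxy.symm (h3 _)
  · exact absurd hxy (h1 _)
  · exact absurd hxy (h3 _)
  · rw [hz hxy]

theorem PhiP_rec {n : ℕ} (κ : Fin (2 * n + 1)) (a : Fin (n + 1) → ℕ) (g : MvPolynomial (Fin (2 * n)) ℂ)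
    (H : ∀ z, Function.Injective z → (∀ i, z i ≠ q⁻¹) → (∀ i, z i ≠ q * q⁻¹) →
      (∀ i, z i ≠ q ^ 2 * q⁻¹) → Phz a (extZ (ek κ) (kA κ) (kB κ) q⁻¹ z) = eval z g) (z) :
    eval (extZ (ek κ) (kA κ) (kB κ) q⁻¹ z) (PhiP a) = eval z g := by
  have : aeval (extP (ek κ) (kA κ) (kB κ) q⁻¹) (PhiP a) = g := by
    apply poly_eq_of_generic (gen_ne (2 * n))
    intro z hz
    obtain ⟨h0, h1, h2, h3⟩ := gen_eval z hz
    rw [← H z h0 h1 h2 h3, eval_aeval]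
    exact PhiP_eval a _ (ext_inj κ z h0 h1 h3)
  rw [← this, eval_aeval]
  rfl

theorem PhiP_NC {n : ℕ} (a : Fin n → ℕ) (ha : Monotone a) (σ : NCM n) :
    evalNC (PhiP a) σ = (q - q⁻¹) ^ (n * (n - 1)) * ((CmatSeq a σ : ℤ) : ℂ) := by
  induction n with
  | zero =>
    unfold evalNC
    rw [PhiP_eval a _ (fun x => absurd x.isLt (by omega)), Phz_empty]
    have : CmatSeq a σ = 1 := by
      unfold CmatSeq
      exact Finset.prod_eq_one fun x _ => absurd x.isLt (by omega)
    simp [this]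
  | succ n ih =>
    obtain ⟨κ, σ', hI⟩ := exists_ins σ
    unfold evalNC
    rw [← spin_ins hI]
    have eA := extZ_i (ek κ) (kA κ) (kB κ) q⁻¹
    have eB := extZ_j (ek κ) (kA_ne_kB κ) q⁻¹
    have eE := extZ_e (ek κ) (ek_inj κ) (ek_ne_kA κ) (ek_ne_kB κ) q⁻¹
    by_cases hk : ∀ k, a k ≠ κ + 1
    · rw [C_ins_zero a hI hk, PhiP_rec κ a 0]
      · simp
      · intro z _ _ _ _
        rw [map_zero]
        exact Phz_zero κ a q⁻¹ _ ha (eA z) (eB z) hk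
    · push Not at hk
      obtain ⟨k0, hk0⟩ := hk
      by_cases h3 : 3 ≤ (Finset.univ.filter fun i => a i = κ + 1).card
      · rw [C_triple a σ _ h3, PhiP_rec κ a 0]
        · simp
        · intro z _ _ _ _
          rw [map_zero]
          obtain ⟨t0, t1, t2, u1, u2, u3, u4⟩ := triple_mono a _ ha h3
          exact Phz_triple a _ t0 t1 t2 u1 u2 u3 u4
      · rw [C_rec a hI k0 hk0, PhiP_rec κ a (C ((chi ((Finset.univ.filter
          fun i => a i = κ + 1).card : ℤ) : ℤ) : ℂ) *
          ((∏ i, C (-q⁻¹) * (X i - C (q * q⁻¹))) * C ((-q⁻¹) ^ n) * PhiP (ahat κ a k0)))]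
        · have := ih (ahat κ a k0) (ahat_mono κ a k0 ha) σ'
          unfold evalNC at this
          simp only [map_mul, map_prod, eval_C, map_sub, eval_X]
          rw [this, spin_prod]
          have e : (n + 1) * (n + 1 - 1) = 2 * n + n * (n - 1) := by
            cases n with
            | zero => rfl
            | succ m => simp only [Nat.add_sub_cancel]; ring
          rw [e, pow_add]
          push_cast
          unfold ahat
          ring
        · intro z h0 h1 h2 h4
          rw [Phz_rec κ a q⁻¹ _ z ha (eA z) (eB z) (fun i => eE z i) k0 hk0 h1 h2 h4 (by omega)]
          simp only [map_mul, map_prod, eval_C, map_sub, eval_X]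
          rw [PhiP_eval _ z h0]


/-! ### Part 12: the value at one -/

/-- The product `∏_{i<j} (z_j - z_i)(1 + z_j + z_i z_j)`. -/
noncomputable def Gp (n : ℕ) : MvPolynomial (Fin n) ℂ :=
  ∏ i : Fin n, ∏ j : Fin n, if i < j then (X j - X i) * (1 + X j + X i * X j) else 1

/-- The weights in the rational variables. -/
def Et {N : ℕ} (t : Fin N → ℂ) (i j : Fin N) : ℂ := 1 + t j + t j * t i

noncomputable def mob (t : ℂ) : ℂ := (1 - q⁻¹ * t) / (1 - q * t)

theorem mob_V (s t : ℂ) (hs : 1 - q * s ≠ 0) (ht : 1 - q * t ≠ 0) :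
    mob s - mob t = (q - q⁻¹) / ((1 - q * s) * (1 - q * t)) * (s - t) := by
  unfold mob
  rw [div_sub_div _ _ hs ht, div_mul_eq_mul_div, div_left_inj' (mul_ne_zero hs ht)]
  have hq : q * q⁻¹ = 1 := mul_inv_cancel₀ q_ne_zero
  linear_combination (0 : ℂ) * hq

theorem mob_E (s t : ℂ) (hs : 1 - q * s ≠ 0) (ht : 1 - q * t ≠ 0) :
    q * mob s - q⁻¹ * mob t =
      (q - q⁻¹) / ((1 - q * s) * (1 - q * t)) * (1 + t + t * s) := by
  unfold mob
  rw [← mul_div_assoc, ← mul_div_assoc, div_sub_div _ _ hs ht, div_mul_eq_mul_div,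
    div_left_inj' (mul_ne_zero hs ht)]
  have hq3 := q_cube
  rw [q_inv]
  linear_combination (q * t + (q - q ^ 2) * s * t) * hq3

theorem Phz_mob {n : ℕ} (a : Fin n → ℕ) (t : Fin (2 * n) → ℂ) (hd : ∀ i, 1 - q * t i ≠ 0) :
    (∏ i, (1 - q * t i)) ^ (n - 1) * Phz a (fun i => mob (t i)) =
      (q - q⁻¹) ^ (n * (n - 1)) * Phig a (Et t) (fun i j => t i - t j) := by
  obtain ⟨mu, hmu⟩ := IsAlgClosed.exists_pow_nat_eq (q - q⁻¹) (n := 2) (by norm_num)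
  have hmu0 : mu ≠ 0 := by
    intro h
    rw [h] at hmu
    exact q_sub_inv (by rw [← hmu]; simp)
  unfold Phz Phig
  rw [Finset.mul_sum, Finset.mul_sum]
  apply Finset.sum_congr rfl
  intro I hI
  rw [mem_pi] at hI
  by_cases hinj : Function.Injective I
  · rw [Tg_scale a (Et t) (fun i j => t i - t j) _ _ (fun i => mu / (1 - q * t i))
      (fun i => div_ne_zero hmu0 (hd i)) ?_ ?_ I hinj hI]
    · rw [← mul_assoc, ← mul_pow, ← Finset.prod_mul_distrib]
      congr 1
      have : ∀ i, (1 - q * t i) * (mu / (1 - q * t i)) = mu := by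
        intro i
        have := hd i
        field_simp
      simp only [this, Finset.prod_const, Finset.card_univ, Fintype.card_fin]
      rw [pow_mul, hmu, ← pow_mul]
    · intro i j
      simp only [ell]
      rw [mob_E _ _ (hd i) (hd j), ← hmu]
      unfold Et
      have := hd i
      have := hd j
      field_simp
    · intro i j
      simp only [Vz]
      rw [mob_V _ _ (hd i) (hd j), ← hmu]
      have := hd i
      have := hd j
      field_simp
  · rw [Tg_noninj _ _ _ (by simp [Vz]) I hinj, Tg_noninj _ _ _ (by simp) I hinj, mul_zero, mul_zero]

theorem sk_card {n N : ℕ} (a : Fin n → ℕ) (k) (h : a k ≤ N) : (sk N a k).card = a k := by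
  unfold sk
  have := Fin.card_filter_val_lt (n := N) (m := a k)
  rw [this, min_eq_right h]

theorem PhiP_one {n : ℕ} (a : Fin n → ℕ) (h1 : ∀ k, 1 ≤ a k) (h2 : ∀ k, a k ≤ 2 * n) :
    evalOne (PhiP a) = (q - q⁻¹) ^ (n * (n - 1)) *
      coeff (Finsupp.equivFunOnFinite.symm fun k => a k - 1) (Gp n) := by
  obtain ⟨A, hA1, hA2⟩ := A_main (N := 2 * n) a (fun j => 1 + X j) (fun j => X j) (Gp n) (by
    intro z I
    unfold Pp Gp
    simp only [map_prod, apply_ite (eval fun k => z (I k)), map_mul, map_sub, map_add, eval_X,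
      map_one]
    refine Finset.prod_congr rfl fun k _ => Finset.prod_congr rfl fun l _ => ?_
    simp only [mul_comm (z (I k)) (z (I l))])
  have hA0 := hA2 (by simp) (by simp) (fun k => Finset.card_pos.mp (by rw [sk_card a k (h2 k)]; exact h1 k))
    (Finsupp.equivFunOnFinite.symm fun k => a k - 1) (by
      intro k
      rw [sk_card a k (h2 k)]
      have := h1 k
      simp only [Finsupp.coe_equivFunOnFinite_symm]
      omega)
  rw [← hA0]
  let t : ℂ → Fin (2 * n) → ℂ := fun ε i => ε * ((i : ℕ) + 1)
  have hEt : ∀ z : Fin (2 * n) → ℂ, (fun i j => eval z (1 + X j) + eval z (X j) * z i) = Et z := by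
    intro z; funext i j; simp [Et]
  let f : ℂ → ℂ := fun ε => (∏ i, (1 - q * t ε i)) ^ (n - 1) *
    eval (fun i => mob (t ε i)) (PhiP a) * Nn a (Et (t ε))
  let g : ℂ → ℂ := fun ε => (q - q⁻¹) ^ (n * (n - 1)) * (Qf (Et (t ε)) * eval (t ε) A)
  have ht0 : t 0 = 0 := by funext i; simp [t]
  have htc : Continuous t := by
    apply continuous_pi
    intro i
    fun_prop
  have hEc : ∀ i j, Continuous fun ε => Et (t ε) i j := by
    intro i j
    unfold Et
    fun_prop
  have hfc : ContinuousAt f 0 := by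
    apply ContinuousAt.mul
    · apply ContinuousAt.mul
      · apply Continuous.continuousAt
        fun_prop
      · apply ContinuousAt.comp (g := fun x => eval x (PhiP a))
        · exact (MvPolynomial.continuous_eval _).continuousAt
        · rw [continuousAt_pi]
          intro i
          unfold mob
          apply ContinuousAt.div
          · fun_prop
          · fun_prop
          · simp [t]
    · apply Continuous.continuousAt
      unfold Nn
      apply continuous_finsetProd
      intro j _
      apply continuous_finsetProd
      intro k _
      split_ifs
      · exact continuous_finsetProd _ fun i _ => hEc i j
      · exact continuous_const
  have hgc : ContinuousAt g 0 := by
    apply Continuous.continuousAt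
    apply Continuous.mul continuous_const
    apply Continuous.mul
    · unfold Qf
      apply continuous_finsetProd
      intro j _
      apply continuous_finsetProd
      intro i _
      split_ifs
      · exact hEc i j
      · exact continuous_const
    · exact (MvPolynomial.continuous_eval A).comp htc
  have hev : ∀ᶠ ε in nhdsWithin (0 : ℂ) {0}ᶜ, f ε = g ε := by
    have e1 : ∀ᶠ ε in nhds (0 : ℂ), ∀ i, 1 - q * t ε i ≠ 0 := by
      rw [Filter.eventually_all]
      intro i
      apply ContinuousAt.eventually_ne
      · fun_prop
      · simp [t]
    filter_upwards [nhdsWithin_le_nhds e1, self_mem_nhdsWithin] with ε h3 h4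
    have h4 : ε ≠ 0 := h4
    have hinj : Function.Injective (t ε) := by
      intro i j hij
      have := mul_left_cancel₀ h4 hij
      have : ((i : ℕ) : ℂ) = (j : ℕ) := by linear_combination this
      exact Fin.ext (by exact_mod_cast this)
    have hinj2 : Function.Injective (fun i => mob (t ε i)) := by
      intro i j hij
      apply hinj
      have h5 := mob_V _ _ (h3 i) (h3 j)
      have hij' : mob (t ε i) = mob (t ε j) := hij
      rw [hij', sub_self] at h5
      have h6 := mul_eq_zero.mp h5.symm
      rcases h6 with h6 | h6
      · exact absurd h6 (div_ne_zero q_sub_inv (mul_ne_zero (h3 i) (h3 j)))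
      · exact sub_eq_zero.mp h6
    have h7 := hA1 (t ε) hinj
    simp only [hEt] at h7
    simp only [f, g]
    rw [PhiP_eval a _ hinj2, Phz_mob a _ h3, ← h7]
    ring
  have hlim : f 0 = g 0 := by
    refine tendsto_nhds_unique (hfc.tendsto.mono_left (nhdsWithin_le_nhds (s := {0}ᶜ))) ?_
    refine Filter.Tendsto.congr' ?_ (hgc.tendsto.mono_left (nhdsWithin_le_nhds (s := {0}ᶜ)))
    filter_upwards [hev] with ε h
    exact h.symm
  have hE0 : ∀ i j, Et (0 : Fin (2 * n) → ℂ) i j = 1 := by intro i j; simp [Et]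
  simp only [f, g, ht0] at hlim
  have hN : Nn a (Et (0 : Fin (2 * n) → ℂ)) = 1 := by simp [Nn, hE0]
  have hQ : Qf (Et (0 : Fin (2 * n) → ℂ)) = 1 := by simp [Qf, hE0]
  rw [hN, hQ] at hlim
  simpa [mob, evalOne] using hlim


/-! ### Part 13: the final combinatorics -/

theorem plus_le' {n : ℕ} (π : NCM n) (j : Fin n) : plus π j ≤ 2 * (j : ℕ) + 1 := by
  classical
  set v := plus π j - 1 with hv
  have hge := plus_ge π j
  have h1 : n - (j : ℕ) ≤ (Finset.univ.filter fun i => v + 1 ≤ plus π i).card := by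
    rw [← Fin.card_Ici]
    apply Finset.card_le_card
    intro i hi
    rw [Finset.mem_Ici] at hi
    rw [Finset.mem_filter]
    refine ⟨Finset.mem_univ _, ?_⟩
    have := (plus_strictMono π).monotone hi
    omega
  have h2 := plus_count π (fun x => v + 1 ≤ x)
  have h3 := suffix_ballot π v
  have h4 : (Finset.univ.filter fun j => j < π.f j ∧ v ≤ (j : ℕ)).card +
      (Finset.univ.filter fun j => ¬ j < π.f j ∧ v ≤ (j : ℕ)).card ≤ 2 * n - v := by
    rw [← Finset.card_union_of_disjoint]
    · have h5 : (Finset.univ.filter fun i : Fin (2 * n) => v ≤ (i : ℕ)).card ≤ 2 * n - v := by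
        have : (Finset.univ.filter fun i : Fin (2 * n) => v ≤ (i : ℕ)).card =
            ((Finset.univ.filter fun i : Fin (2 * n) => v ≤ (i : ℕ)).map Fin.valEmbedding).card := by
          rw [Finset.card_map]
        rw [this, ← Nat.card_Ico]
        apply Finset.card_le_card
        intro x hx
        simp only [Finset.mem_map, Finset.mem_filter, Finset.mem_univ, true_and,
          Fin.valEmbedding_apply] at hx
        obtain ⟨i, h1, rfl⟩ := hx
        exact Finset.mem_Ico.mpr ⟨h1, i.isLt⟩
      refine le_trans (Finset.card_le_card ?_) h5
      intro x hx
      simp only [Finset.mem_union, Finset.mem_filter, Finset.mem_univ, true_and] at hx ⊢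
      tauto
    · rw [Finset.disjoint_left]
      intro x hx hy
      simp only [Finset.mem_filter, Finset.mem_univ, true_and] at hx hy
      exact hy.1 hx.1
  simp only [add_le_add_iff_right] at h2
  have h6 := plus_le π j
  have h7 := j.isLt
  omega

theorem card_range_fin (n x y : ℕ) (hy : y ≤ n) :
    (Finset.univ.filter fun m : Fin n => x ≤ (m : ℕ) ∧ (m : ℕ) < y).card = y - x := by
  rw [← Nat.card_Ico, ← Finset.card_map Fin.valEmbedding]
  congr 1
  ext i
  simp only [Finset.mem_map, Finset.mem_filter, Finset.mem_univ, true_and,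
          Fin.valEmbedding_apply, Finset.mem_Ico]
  constructor
  · rintro ⟨j, h, rfl⟩; exact h
  · intro h; exact ⟨⟨i, by omega⟩, h, rfl⟩

section fin
variable {k n : ℕ}

/-- The sequences occurring in the expansion. -/
noncomputable def aS (σ : NCM k) (s : Finset (Fin n)) (i : Fin n) : ℕ :=
  if h : 1 ≤ (i : ℕ) ∧ (i : ℕ) ≤ k then plus σ ⟨(i : ℕ) - 1, by omega⟩ + 1
  else if (i : ℕ) = 0 then 1 else if i ∈ s then 2 * i else 2 * i + 1

theorem aS_cases (σ : NCM k) (s : Finset (Fin n)) (m : Fin n) :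
    ((m : ℕ) = 0 ∧ aS σ s m = 1) ∨ (1 ≤ (m : ℕ) ∧ (m : ℕ) ≤ k ∧ 2 ≤ aS σ s m ∧ aS σ s m ≤ 2 * m) ∨
    (k + 1 ≤ (m : ℕ) ∧ m ∈ s ∧ aS σ s m = 2 * m) ∨
    (k + 1 ≤ (m : ℕ) ∧ m ∉ s ∧ aS σ s m = 2 * m + 1) := by
  unfold aS
  by_cases h : 1 ≤ (m : ℕ) ∧ (m : ℕ) ≤ k
  · right; left
    rw [dif_pos h]
    have h1 := plus_ge σ ⟨(m : ℕ) - 1, by omega⟩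
    have h2 := plus_le' σ ⟨(m : ℕ) - 1, by omega⟩
    simp only at h2
    omega
  · rw [dif_neg h]
    by_cases h0 : (m : ℕ) = 0
    · simp [h0]
    · by_cases hs : m ∈ s
      · right; right; left
        simp only [h0, hs, if_true, if_false]
        refine ⟨by omega, trivial, trivial⟩
      · right; right; right
        simp only [h0, hs, if_false]
        refine ⟨by omega, not_false, trivial⟩

theorem aS_block (σ : NCM k) (s : Finset (Fin n)) (i : Fin k) (h : (i : ℕ) + 1 < n) :
    aS σ s ⟨i + 1, h⟩ = plus σ i + 1 := by
  unfold aS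
  have := i.isLt
  rw [dif_pos (by simp only; omega)]
  rfl

theorem aS_mono (σ : NCM k) (s : Finset (Fin n)) : Monotone (aS σ s) := by
  intro x y hxy
  rcases hxy.eq_or_lt with rfl | hlt
  · exact le_rfl
  have hv : (x : ℕ) < y := hlt
  by_cases hb : 1 ≤ (x : ℕ) ∧ (y : ℕ) ≤ k
  · unfold aS
    rw [dif_pos ⟨hb.1, by omega⟩, dif_pos ⟨by omega, hb.2⟩]
    have : plus σ ⟨(x : ℕ) - 1, by omega⟩ ≤ plus σ ⟨(y : ℕ) - 1, by omega⟩ :=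
      (plus_strictMono σ).monotone (by rw [Fin.le_def]; simp; omega)
    omega
  · have h1 := aS_cases σ s x
    have h2 := aS_cases σ s y
    omega

theorem aS_ge (σ : NCM k) (s : Finset (Fin n)) (m) : 1 ≤ aS σ s m := by
  have := aS_cases σ s m
  omega

theorem aS_le (σ : NCM k) (s : Finset (Fin n)) (m) : aS σ s m ≤ 2 * m + 1 := by
  have := aS_cases σ s m
  omega

theorem p_zero (σ : NCM k) (s : Finset (Fin n)) (f : ℕ) (h1 : k ≤ f) (h2 : f < n) :
    pjkSeq (aS σ s) (0 + 1) (2 * f + 1 + 1) = 1 := by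
  unfold pjkSeq
  have : (Finset.univ.filter fun m : Fin n => 0 + 1 ≤ aS σ s m ∧ aS σ s m < 2 * f + 1 + 1) =
      Finset.univ.filter fun m : Fin n => 0 ≤ (m : ℕ) ∧ (m : ℕ) < f + 1 := by
    ext m
    simp only [Finset.mem_filter, Finset.mem_univ, true_and]
    have := aS_cases σ s m
    omega
  rw [this, card_range_fin n 0 (f + 1) (by omega)]
  have : (2 * f + 1 + 1 - (0 + 1) - 1) / 2 = f := by omega
  rw [this]
  push_cast
  ring

theorem p_odd (σ : NCM k) (s : Finset (Fin n)) (e : ℕ) (f : Fin n) (h1 : k ≤ e) (h2 : e < f) :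
    pjkSeq (aS σ s) (2 * e + 1 + 1) (2 * (f : ℕ) + 1) = if f ∈ s then 1 else 0 := by
  unfold pjkSeq
  have hf := f.isLt
  have : (Finset.univ.filter fun m : Fin n => 2 * e + 1 + 1 ≤ aS σ s m ∧ aS σ s m < 2 * (f : ℕ) + 1) =
      Finset.univ.filter fun m : Fin n => e + 1 ≤ (m : ℕ) ∧ (m : ℕ) < f + if f ∈ s then 1 else 0 := by
    ext m
    simp only [Finset.mem_filter, Finset.mem_univ, true_and]
    have := aS_cases σ s m
    by_cases hm : m = f
    · subst hm
      split_ifs with h <;> simp only [h, not_true_eq_false, not_false_eq_true, true_and, false_and,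
        and_false, or_false, false_or] at this <;> omega
    · have : (m : ℕ) ≠ f := fun h => hm (Fin.ext h)
      split_ifs <;> omega
  rw [this, card_range_fin n _ _ (by split_ifs <;> omega)]
  split_ifs <;> omega

theorem p_even (σ : NCM k) (s : Finset (Fin n)) (e : Fin n) (f : ℕ) (h1 : k + 1 ≤ e) (h2 : e ≤ f)
    (h3 : f < n) :
    pjkSeq (aS σ s) (2 * (e : ℕ) + 1) (2 * f + 1 + 1) = if e ∈ s then 0 else 1 := by
  unfold pjkSeq
  have : (Finset.univ.filter fun m : Fin n => 2 * (e : ℕ) + 1 ≤ aS σ s m ∧ aS σ s m < 2 * f + 1 + 1) =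
      Finset.univ.filter fun m : Fin n => e + (if e ∈ s then 1 else 0) ≤ (m : ℕ) ∧ (m : ℕ) < f + 1 := by
    ext m
    simp only [Finset.mem_filter, Finset.mem_univ, true_and]
    have := aS_cases σ s m
    by_cases hm : m = e
    · subst hm
      split_ifs with h <;> simp only [h, not_true_eq_false, not_false_eq_true, true_and, false_and,
        and_false, or_false, false_or] at this <;> omega
    · have : (m : ℕ) ≠ e := fun h => hm (Fin.ext h)
      split_ifs <;> omega
  rw [this, card_range_fin n _ _ (by omega)]
  split_ifs <;> omega

theorem p_leave (σ : NCM k) (s : Finset (Fin n)) (e f : ℕ) (h0 : 1 ≤ e) (h1 : e ≤ k) (h2 : k ≤ f)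
    (h3 : f < n) :
    pjkSeq (aS σ s) (2 * e + 1) (2 * f + 1 + 1) ≤ 0 := by
  unfold pjkSeq
  have : (Finset.univ.filter fun m : Fin n => 2 * e + 1 ≤ aS σ s m ∧ aS σ s m < 2 * f + 1 + 1).card ≤
      (Finset.univ.filter fun m : Fin n => e + 1 ≤ (m : ℕ) ∧ (m : ℕ) < f + 1).card := by
    apply Finset.card_le_card
    intro m
    simp only [Finset.mem_filter, Finset.mem_univ, true_and]
    have := aS_cases σ s m
    omega
  rw [card_range_fin n _ _ (by omega)] at this
  omega

theorem p_block (hn : k + 1 ≤ n) (σ : NCM k) (s : Finset (Fin n)) (i v : ℕ) (hv : v < 2 * k) :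
    pjkSeq (aS σ s) (i + 1 + 1) (v + 1 + 1) = pjkSeq (plus σ) (i + 1) (v + 1) := by
  unfold pjkSeq
  have e1 : v + 1 + 1 - (i + 1 + 1) - 1 = v + 1 - (i + 1) - 1 := by omega
  rw [e1]
  congr 2
  symm
  apply Finset.card_bij (fun (x : Fin k) _ => (⟨x + 1, by have := x.isLt; omega⟩ : Fin n))
  · intro x hx
    simp only [Finset.mem_filter, Finset.mem_univ, true_and] at hx ⊢
    rw [aS_block]
    omega
  · intro x _ y _ h
    rw [Fin.ext_iff] at h ⊢
    simp only at h
    omega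
  · intro m hm
    simp only [Finset.mem_filter, Finset.mem_univ, true_and] at hm
    have h := aS_cases σ s m
    have hm1 : 1 ≤ (m : ℕ) ∧ (m : ℕ) ≤ k := by omega
    have hmm : m = ⟨((⟨(m : ℕ) - 1, by omega⟩ : Fin k) : ℕ) + 1, by simp only; omega⟩ := by
      ext; simp only; omega
    refine ⟨⟨(m : ℕ) - 1, by omega⟩, ?_, hmm.symm⟩
    rw [hmm, aS_block] at hm
    simp only [Finset.mem_filter, Finset.mem_univ, true_and]
    omega

end fin


/-! ### Part 14: matchings with a closed block -/

section closed
variable {k n : ℕ}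

/-- The block of sites `1, …, 2k` (zero-indexed) is stable under the matching. -/
def BlockClosed (k : ℕ) (τ : NCM n) : Prop :=
  ∀ i : Fin (2 * n), 1 ≤ (i : ℕ) → (i : ℕ) ≤ 2 * k → 1 ≤ (τ.f i : ℕ) ∧ (τ.f i : ℕ) ≤ 2 * k

theorem exists_leave (hn : k + 1 ≤ n) (τ : NCM n) (h : ¬ BlockClosed k τ) :
    ∃ i : Fin (2 * n), ∃ e : ℕ, (i : ℕ) = 2 * e ∧ 1 ≤ e ∧ e ≤ k ∧ 2 * k < (τ.f i : ℕ) := by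
  by_contra hc
  push Not at hc
  apply h
  have hlt : ∀ e : Fin k, 2 * ((e : ℕ) + 1) < 2 * n := fun e => by have := e.isLt; omega
  have key : ∀ e : Fin k, (τ.f ⟨2 * ((e : ℕ) + 1), hlt e⟩ : ℕ) % 2 = 1 ∧
      (τ.f ⟨2 * ((e : ℕ) + 1), hlt e⟩ : ℕ) ≤ 2 * k := by
    intro e
    have h1 := hc ⟨2 * ((e : ℕ) + 1), hlt e⟩ ((e : ℕ) + 1) rfl (by omega) (by have := e.isLt; omega)
    have h2 := parity τ ⟨2 * ((e : ℕ) + 1), hlt e⟩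
    simp only at h2
    omega
  let g : Fin k → Fin k := fun e => ⟨(τ.f ⟨2 * ((e : ℕ) + 1), hlt e⟩ : ℕ) / 2, by
    have := key e; omega⟩
  have hinj : Function.Injective g := by
    intro e f hef
    have h0 : (τ.f ⟨2 * ((e : ℕ) + 1), hlt e⟩ : ℕ) / 2 = (τ.f ⟨2 * ((f : ℕ) + 1), hlt f⟩ : ℕ) / 2 :=
      congrArg Fin.val hef
    have h1 := key e
    have h2 := key f
    have h3 : τ.f ⟨2 * ((e : ℕ) + 1), hlt e⟩ = τ.f ⟨2 * ((f : ℕ) + 1), hlt f⟩ := by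
      apply Fin.ext; omega
    have h4 := congrArg τ.f h3
    rw [τ.invol, τ.invol, Fin.ext_iff] at h4
    apply Fin.ext
    simp only at h4
    omega
  have hsurj : Function.Surjective g := Finite.injective_iff_surjective.mp hinj
  intro i h1 h2
  rcases Nat.even_or_odd' (i : ℕ) with ⟨c, hc | hc⟩
  · have h3 := key ⟨c - 1, by omega⟩
    have h4 : (⟨2 * (c - 1 + 1), by omega⟩ : Fin (2 * n)) = i := by
      apply Fin.ext; simp only; omega
    simp only [h4] at h3
    omega
  · obtain ⟨e, he⟩ := hsurj ⟨c, by omega⟩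
    have h0 : (τ.f ⟨2 * ((e : ℕ) + 1), hlt e⟩ : ℕ) / 2 = c := congrArg Fin.val he
    have h3 := key e
    have h4 : τ.f ⟨2 * ((e : ℕ) + 1), hlt e⟩ = i := by
      apply Fin.ext; omega
    have h5 := congrArg τ.f h4
    rw [τ.invol] at h5
    rw [← h5]
    have := e.isLt
    simp only
    omega

theorem C_not_closed (hn : k + 1 ≤ n) (σ : NCM k) (s : Finset (Fin n)) (τ : NCM n)
    (h : ¬ BlockClosed k τ) : CmatSeq (aS σ s) τ = 0 := by
  by_contra hc
  obtain ⟨i, e, h1, h2, h3, h4⟩ := exists_leave hn τ h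
  have h5 := C_arc_pos (aS σ s) τ hc i (by rw [Fin.lt_def]; omega)
  have h6 := parity τ i
  have h7 := (τ.f i).isLt
  have h8 := p_leave σ s e ((τ.f i : ℕ) / 2) h2 h3 (by omega) (by omega)
  have h9 : 2 * ((τ.f i : ℕ) / 2) + 1 = (τ.f i : ℕ) := by omega
  rw [h9, ← h1] at h8
  omega

theorem exists_sub (hn : k + 1 ≤ n) (τ : NCM n) (h : BlockClosed k τ) :
    ∃ τ₀ : NCM k, ∀ (i : Fin (2 * k)) (hi : (i : ℕ) + 1 < 2 * n),
      (τ.f ⟨(i : ℕ) + 1, hi⟩ : ℕ) = (τ₀.f i : ℕ) + 1 := by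
  have hlt : ∀ i : Fin (2 * k), (i : ℕ) + 1 < 2 * n := fun i => by have := i.isLt; omega
  have hb : ∀ i : Fin (2 * k), 1 ≤ (τ.f ⟨(i : ℕ) + 1, hlt i⟩ : ℕ) ∧
      (τ.f ⟨(i : ℕ) + 1, hlt i⟩ : ℕ) ≤ 2 * k := fun i => h _ (by simp) (by
        have := i.isLt; simp only; omega)
  let F : Fin (2 * k) → Fin (2 * k) := fun i => ⟨(τ.f ⟨(i : ℕ) + 1, hlt i⟩ : ℕ) - 1, by
    have := hb i; omega⟩
  have hF : ∀ i, (⟨(F i : ℕ) + 1, hlt (F i)⟩ : Fin (2 * n)) = τ.f ⟨(i : ℕ) + 1, hlt i⟩ := by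
    intro i
    apply Fin.ext
    have := hb i
    change (τ.f ⟨(i : ℕ) + 1, hlt i⟩ : ℕ) - 1 + 1 = _
    omega
  refine ⟨⟨F, ?_, ?_, ?_⟩, ?_⟩
  · intro i
    have h1 := hF (F i)
    rw [hF i, τ.invol, Fin.ext_iff] at h1
    simp only at h1
    apply Fin.ext
    omega
  · intro i hi
    have h1 := hF i
    rw [hi] at h1
    exact τ.nofix _ h1.symm
  · intro a b c d hab hbc hcd hac hbd
    refine τ.noncross ⟨(a : ℕ) + 1, hlt a⟩ ⟨(b : ℕ) + 1, hlt b⟩ ⟨(c : ℕ) + 1, hlt c⟩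
      ⟨(d : ℕ) + 1, hlt d⟩ ?_ ?_ ?_ ?_ ?_
    · rw [Fin.lt_def] at *; simp only; omega
    · rw [Fin.lt_def] at *; simp only; omega
    · rw [Fin.lt_def] at *; simp only; omega
    · rw [← hF a]; apply Fin.ext; simp only [hac]
    · rw [← hF b]; apply Fin.ext; simp only [hbd]
  · intro i hi
    have := congrArg Fin.val (hF i)
    exact this.symm

/-- The set of `e ≥ k+1` such that site `2e` is a closer. -/
noncomputable def Sset (k : ℕ) (τ : NCM n) : Finset (Fin n) :=
  Finset.univ.filter fun e => k + 1 ≤ (e : ℕ) ∧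
    (τ.f ⟨2 * (e : ℕ), by have := e.isLt; omega⟩ : ℕ) < 2 * (e : ℕ)

theorem closed_out {τ : NCM n} (h : BlockClosed k τ) (i : Fin (2 * n))
    (hi : (i : ℕ) = 0 ∨ 2 * k < (i : ℕ)) : (τ.f i : ℕ) = 0 ∨ 2 * k < (τ.f i : ℕ) := by
  by_contra hc
  have := h (τ.f i) (by omega) (by omega)
  rw [τ.invol] at this
  omega

theorem C_closed_eq (hn : k + 1 ≤ n) (σ : NCM k) (τ : NCM n) (h : BlockClosed k τ)
    (τ₀ : NCM k) (h₀ : ∀ (i : Fin (2 * k)) (hi : (i : ℕ) + 1 < 2 * n),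
      (τ.f ⟨(i : ℕ) + 1, hi⟩ : ℕ) = (τ₀.f i : ℕ) + 1) :
    CmatSeq (aS σ (Sset k τ)) τ = CmatSeq (plus σ) τ₀ := by
  have hlt : ∀ i : Fin (2 * k), (i : ℕ) + 1 < 2 * n := fun i => by have := i.isLt; omega
  rw [CmatSeq_eq, CmatSeq_eq]
  symm
  apply Finset.prod_of_injOn (fun i : Fin (2 * k) => (⟨(i : ℕ) + 1, hlt i⟩ : Fin (2 * n)))
  · intro a _ b _ hab
    simp only [Fin.mk.injEq] at hab
    apply Fin.ext; omega
  · intro a _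
    simp
  · intro i _ hi
    have hout : (i : ℕ) = 0 ∨ 2 * k < (i : ℕ) := by
      by_contra hc
      apply hi
      refine ⟨⟨(i : ℕ) - 1, by omega⟩, by simp, ?_⟩
      apply Fin.ext
      simp only
      omega
    split_ifs with hlt'
    · have hl : (i : ℕ) < τ.f i := hlt'
      have hout' := closed_out h i hout
      have hpar := parity τ i
      have hb := (τ.f i).isLt
      suffices hp : pjkSeq (aS σ (Sset k τ)) ((i : ℕ) + 1) ((τ.f i : ℕ) + 1) = 1 by
        rw [hp]; rfl
      rcases Nat.even_or_odd' (i : ℕ) with ⟨e, he | he⟩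
      · obtain ⟨f, hf⟩ : ∃ f, (τ.f i : ℕ) = 2 * f + 1 := ⟨(τ.f i : ℕ) / 2, by omega⟩
        by_cases h0 : e = 0
        · subst h0
          rw [he, hf]
          exact p_zero σ _ f (by omega) (by omega)
        · have := p_even σ (Sset k τ) ⟨e, by omega⟩ f (by simp only; omega)
            (by simp only; omega) (by omega)
          simp only at this
          rw [he, hf, this, if_neg]
          unfold Sset
          simp only [Finset.mem_filter, Finset.mem_univ, true_and, not_and, not_lt]
          intro _
          have hh : (⟨2 * e, by omega⟩ : Fin (2 * n)) = i := Fin.ext he.symm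
          rw [hh]
          omega
      · obtain ⟨f, hf⟩ : ∃ f, (τ.f i : ℕ) = 2 * f := ⟨(τ.f i : ℕ) / 2, by omega⟩
        have := p_odd σ (Sset k τ) e ⟨f, by omega⟩ (by omega) (by simp only; omega)
        simp only at this
        rw [he, hf, this, if_pos]
        unfold Sset
        simp only [Finset.mem_filter, Finset.mem_univ, true_and]
        refine ⟨by omega, ?_⟩
        have hh : (⟨2 * f, by omega⟩ : Fin (2 * n)) = τ.f i := Fin.ext hf.symm
        rw [hh, τ.invol]
        omega
    · rfl
  · intro i _
    have h1 := h₀ i (hlt i)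
    have h2 : (⟨(i : ℕ) + 1, hlt i⟩ : Fin (2 * n)) < τ.f ⟨(i : ℕ) + 1, hlt i⟩ ↔ i < τ₀.f i := by
      rw [Fin.lt_def, Fin.lt_def, h1]
      simp only
      omega
    simp only [h2, h1]
    rw [p_block hn σ _ i (τ₀.f i) (τ₀.f i).isLt]

theorem C_closed_ne (hn : k + 1 ≤ n) (σ : NCM k) (τ : NCM n) (h : BlockClosed k τ)
    (s : Finset (Fin n)) (hs : ∀ e ∈ s, k + 1 ≤ (e : ℕ)) (hne : s ≠ Sset k τ) :
    CmatSeq (aS σ s) τ = 0 := by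
  obtain ⟨e, he⟩ : ∃ e : Fin n, ¬ (e ∈ s ↔ e ∈ Sset k τ) := by
    by_contra hc
    push Not at hc
    exact hne (Finset.ext hc)
  have hek : k + 1 ≤ (e : ℕ) := by
    by_contra hc
    apply he
    constructor
    · intro h1; exact absurd (hs e h1) hc
    · intro h1; unfold Sset at h1; rw [Finset.mem_filter] at h1; exact absurd h1.2.1 hc
  have hlt : 2 * (e : ℕ) < 2 * n := by have := e.isLt; omega
  have hmem : e ∈ Sset k τ ↔ (τ.f ⟨2 * (e : ℕ), hlt⟩ : ℕ) < 2 * (e : ℕ) := by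
    unfold Sset
    simp only [Finset.mem_filter, Finset.mem_univ, true_and, hek]
  rw [hmem] at he
  set i : Fin (2 * n) := ⟨2 * (e : ℕ), hlt⟩ with hi
  have hiv : (i : ℕ) = 2 * (e : ℕ) := rfl
  have hout' := closed_out h i (by omega)
  have hpar := parity τ i
  have hb := (τ.f i).isLt
  obtain ⟨f, hf⟩ : ∃ f, (τ.f i : ℕ) = 2 * f + 1 := ⟨(τ.f i : ℕ) / 2, by omega⟩
  rw [CmatSeq_eq]
  by_cases hc : (τ.f i : ℕ) < 2 * (e : ℕ)
  · apply Finset.prod_eq_zero (Finset.mem_univ (τ.f i))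
    rw [τ.invol, if_pos (by rw [Fin.lt_def]; omega)]
    have hes : e ∉ s := by tauto
    have := p_odd σ s f e (by omega) (by omega)
    rw [hf, hiv, this, if_neg hes]
    rfl
  · apply Finset.prod_eq_zero (Finset.mem_univ i)
    rw [if_pos (by rw [Fin.lt_def]; omega)]
    have hes : e ∈ s := by tauto
    have := p_even σ s e f hek (by omega) (by omega)
    rw [hf, hiv, this, if_pos hes]
    rfl

theorem inE_iff (hn : k + 1 ≤ n) (π₀ : NCM k) (τ : NCM n) : inE π₀ τ ↔ BlockClosed k τ ∧
    ∃ τ₀ : NCM k, (∀ (i : Fin (2 * k)) (hi : (i : ℕ) + 1 < 2 * n),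
      (τ.f ⟨(i : ℕ) + 1, hi⟩ : ℕ) = (τ₀.f i : ℕ) + 1) ∧ τ₀ = π₀ := by
  constructor
  · intro h
    refine ⟨?_, π₀, h, rfl⟩
    intro i h1 h2
    have h3 := h ⟨(i : ℕ) - 1, by omega⟩ (by simp only; omega)
    have h4 : (⟨(i : ℕ) - 1 + 1, by omega⟩ : Fin (2 * n)) = i := by
      apply Fin.ext; simp only; omega
    simp only [h4] at h3
    have := (π₀.f ⟨(i : ℕ) - 1, by omega⟩).isLt
    omega
  · rintro ⟨_, τ₀, h, rfl⟩
    exact h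

theorem sum_C (hn : k + 1 ≤ n) (π₀ : NCM k) (τ : NCM n) :
    ∑ σ : NCM k, Ctilde k π₀ σ * ∑ s ∈ (Finset.univ.filter fun j : Fin n => k + 1 ≤ (j : ℕ)).powerset,
      ((CmatSeq (aS σ s) τ : ℤ) : ℂ) = if inE π₀ τ then 1 else 0 := by
  by_cases hcl : BlockClosed k τ
  · obtain ⟨τ₀, h₀⟩ := exists_sub hn τ hcl
    have h1 : ∀ σ : NCM k, ∑ s ∈ (Finset.univ.filter fun j : Fin n => k + 1 ≤ (j : ℕ)).powerset,
        ((CmatSeq (aS σ s) τ : ℤ) : ℂ) = CmatC k σ τ₀ := by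
      intro σ
      rw [Finset.sum_eq_single (Sset k τ)]
      · rw [C_closed_eq hn σ τ hcl τ₀ h₀]; rfl
      · intro s hs hne
        rw [C_closed_ne hn σ τ hcl s _ hne]
        · simp
        · intro e he
          exact (Finset.mem_filter.mp (Finset.mem_powerset.mp hs he)).2
      · intro hh
        exfalso
        apply hh
        rw [Finset.mem_powerset]
        intro e he
        unfold Sset at he
        rw [Finset.mem_filter] at he ⊢
        exact ⟨he.1, he.2.1⟩
    simp only [h1]
    have h2 : ∑ σ : NCM k, Ctilde k π₀ σ * CmatC k σ τ₀ = (Ctilde k * CmatC k) π₀ τ₀ := rfl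
    rw [h2]
    unfold Ctilde
    rw [Matrix.nonsing_inv_mul _ ((Matrix.isUnit_iff_isUnit_det _).mp (CmatC_unit k)),
      Matrix.one_apply]
    have h3 : π₀ = τ₀ ↔ inE π₀ τ := by
      rw [inE_iff hn]
      constructor
      · rintro rfl; exact ⟨hcl, _, h₀, rfl⟩
      · rintro ⟨_, τ₁, h4, rfl⟩
        apply NCM.ext'
        funext i
        have hi : (i : ℕ) + 1 < 2 * n := by have := i.isLt; omega
        have h5 := h4 i hi
        have h6 := h₀ i hi
        apply Fin.ext
        omega
    simp only [h3]
  · rw [if_neg (fun h => hcl ((inE_iff hn _ _).mp h).1)]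
    apply Finset.sum_eq_zero
    intro σ _
    rw [Finset.sum_eq_zero, mul_zero]
    intro s _
    rw [C_not_closed hn σ s τ hcl]
    simp

end closed


/-! ### Part 15: conclusion -/

theorem bidx_lt {k n : ℕ} (hn : k + 1 ≤ n) (j : Fin k) : (j : ℕ) + 1 < n := by
  have := j.isLt
  omega

theorem mon_aS {k n : ℕ} (hn : k + 1 ≤ n) (σ : NCM k) (s : Finset (Fin n))
    (hs : ∀ e ∈ s, k + 1 ≤ (e : ℕ)) :
    (∏ j : Fin k, (X (⟨(j : ℕ) + 1, bidx_lt hn j⟩ : Fin n) :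
        MvPolynomial (Fin n) ℂ) ^ (2 * ((j : ℕ) + 1) - plus σ j)) * ∏ i ∈ s, X i =
      monomial (Finsupp.equivFunOnFinite.symm fun i : Fin n => 2 * (i : ℕ) - (aS σ s i - 1)) 1 := by
  have h1 : ∏ i ∈ s, (X i : MvPolynomial (Fin n) ℂ) = ∏ i : Fin n, X i ^ (if i ∈ s then 1 else 0) := by
    rw [← Finset.prod_subset (Finset.subset_univ s)]
    · apply Finset.prod_congr rfl
      intro i hi
      simp [hi]
    · intro i _ hi
      simp [hi]
  have h2 : (∏ j : Fin k, (X (⟨(j : ℕ) + 1, bidx_lt hn j⟩ : Fin n) :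
        MvPolynomial (Fin n) ℂ) ^ (2 * ((j : ℕ) + 1) - plus σ j)) =
      ∏ i : Fin n, X i ^ (if (i : ℕ) ≤ k then 2 * (i : ℕ) - (aS σ s i - 1) else 0) := by
    apply Finset.prod_of_injOn
      (fun j : Fin k => (⟨(j : ℕ) + 1, bidx_lt hn j⟩ : Fin n))
    · intro a _ b _ hab
      simp only [Fin.mk.injEq] at hab
      apply Fin.ext; omega
    · intro a _
      simp
    · intro i _ hi
      have h0 : (i : ℕ) = 0 ∨ ¬ (i : ℕ) ≤ k := by
        by_contra hc
        apply hi
        refine ⟨⟨(i : ℕ) - 1, by omega⟩, by simp, ?_⟩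
        apply Fin.ext
        simp only
        omega
      rcases h0 with h0 | h0
      · simp [h0]
      · simp [h0]
    · intro j _
      have hj := j.isLt
      rw [aS_block σ s j (by omega)]
      simp only
      rw [if_pos (by omega)]
      rfl
  rw [h1, h2, ← Finset.prod_mul_distrib, monomial_eq, map_one, one_mul,
    Finsupp.prod_fintype _ _ (by simp)]
  apply Finset.prod_congr rfl
  intro i _
  rw [← pow_add]
  congr 1
  simp only [Finsupp.equivFunOnFinite_symm_apply_apply]
  have h3 := aS_cases σ s i
  by_cases hi : i ∈ s
  · have := hs i hi
    simp only [hi, not_true_eq_false, true_and, false_and, and_false, or_false, if_true] at h3 ⊢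
    split_ifs <;> omega
  · simp only [hi, not_false_eq_true, true_and, false_and, and_false, false_or, if_false] at h3 ⊢
    split_ifs <;> omega

theorem coeff_aS {k n : ℕ} (hn : k + 1 ≤ n) (σ : NCM k) :
    coeff (Finsupp.equivFunOnFinite.symm fun i : Fin n => 2 * (i : ℕ))
      ((∏ j : Fin k, (X (⟨(j : ℕ) + 1, bidx_lt hn j⟩ : Fin n) :
        MvPolynomial (Fin n) ℂ) ^ (2 * ((j : ℕ) + 1) - plus σ j)) * Gp n *
        ∏ j : Fin n, if k + 1 ≤ (j : ℕ) then 1 + X j else 1) =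
    ∑ s ∈ (Finset.univ.filter fun j : Fin n => k + 1 ≤ (j : ℕ)).powerset,
      coeff (Finsupp.equivFunOnFinite.symm fun i => aS σ s i - 1) (Gp n) := by
  rw [← Finset.prod_filter, Finset.prod_one_add, Finset.mul_sum, coeff_sum]
  apply Finset.sum_congr rfl
  intro s hs
  have hs' : ∀ e ∈ s, k + 1 ≤ (e : ℕ) := fun e he =>
    (Finset.mem_filter.mp (Finset.mem_powerset.mp hs he)).2
  rw [mul_right_comm, mon_aS hn σ s hs']
  have hD : (Finsupp.equivFunOnFinite.symm fun i : Fin n => 2 * (i : ℕ)) =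
      (Finsupp.equivFunOnFinite.symm fun i : Fin n => 2 * (i : ℕ) - (aS σ s i - 1)) +
      Finsupp.equivFunOnFinite.symm fun i => aS σ s i - 1 := by
    ext i
    simp only [Finsupp.equivFunOnFinite_symm_apply_apply, Finsupp.add_apply]
    have := aS_le σ s i
    omega
  rw [hD, coeff_monomial_mul, one_mul]

theorem totalDegree_sum_le' {ι κ : Type} (s : Finset ι) (f : ι → MvPolynomial κ ℂ) (d : ℕ)
    (h : ∀ i ∈ s, (f i).totalDegree ≤ d) : (∑ i ∈ s, f i).totalDegree ≤ d :=
  totalDegree_finsetSum_le h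

theorem main_identity {k n : ℕ} (hn : k + 1 ≤ n) (π₀ : NCM k)
    (Ψ : NCM n → MvPolynomial (Fin (2 * n)) ℂ)
    (hwheel : ∀ π, IsWheel n (Ψ π))
    (hdual : ∀ π σ : NCM n, evalNC (Ψ π) σ = if σ = π then 1 else 0) :
    (∑ σ : NCM k, Ctilde k π₀ σ •
      ∑ s ∈ (Finset.univ.filter fun j : Fin n => k + 1 ≤ (j : ℕ)).powerset, PhiP (aS σ s)) -
    (q - q⁻¹) ^ (n * (n - 1)) • ∑ π : NCM n, (if inE π₀ π then (1 : ℂ) else 0) • Ψ π = 0 := by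
  apply uniqB n
  · intro i j l z hij hjl h1 h2
    have e1 : ∀ σ s, eval z (PhiP (aS (k := k) (n := n) σ s)) = 0 := fun σ s =>
      PhiP_wheel _ (aS_mono σ s) i j l z hij hjl h1 h2
    have e2 : ∀ π, eval z (Ψ π) = 0 := fun π => (hwheel π).wheelFun i j l z hij hjl h1 h2
    simp only [map_sub, map_sum, smul_eval, e1, e2, mul_zero, Finset.sum_const_zero, sub_zero]
  · refine le_trans (totalDegree_sub _ _) (max_le ?_ ?_)
    · apply totalDegree_sum_le'
      intro σ _
      refine le_trans (totalDegree_smul_le _ _) ?_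
      apply totalDegree_sum_le'
      intro s _
      exact PhiP_deg _
    · refine le_trans (totalDegree_smul_le _ _) ?_
      apply totalDegree_sum_le'
      intro π _
      exact le_trans (totalDegree_smul_le _ _) (hwheel π).1.totalDegree_le
  · intro τ
    have e1 : ∀ σ s, eval (fun k => if k < τ.f k then q⁻¹ else q) (PhiP (aS (k := k) (n := n) σ s)) =
        (q - q⁻¹) ^ (n * (n - 1)) * ((CmatSeq (aS σ s) τ : ℤ) : ℂ) := fun σ s =>
      PhiP_NC _ (aS_mono σ s) τ
    have e2 : ∀ π, eval (fun k => if k < τ.f k then q⁻¹ else q) (Ψ π) = if τ = π then 1 else 0 :=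
      fun π => hdual π τ
    unfold evalNC
    simp only [map_sub, map_sum, smul_eval, e1, e2]
    have e3 := sum_C hn π₀ τ
    have e4 : ∑ π : NCM n, (if inE π₀ π then (1 : ℂ) else 0) * (if τ = π then 1 else 0) =
        if inE π₀ τ then 1 else 0 := by
      rw [Finset.sum_eq_single τ]
      · simp
      · intro b _ hb
        rw [if_neg (Ne.symm hb), mul_zero]
      · simp
    rw [e4, ← e3, Finset.mul_sum, sub_eq_zero]
    apply Finset.sum_congr rfl
    intro σ _
    rw [← Finset.mul_sum]
    ring


/-- Explicit formula for submatching event probabilities (Theorem 1.12 / formula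
(1.14), unnormalized form): `Σ_{π ∈ E_n(π₀)} Ψ_π(1,…,1)` equals the coefficient of
`z_1^0 z_2^2 ⋯ z_n^{2n-2}` in `F_{π₀}(z_2,…,z_{k+1}) ∏_{i<j}(z_j-z_i)(1+z_j+z_iz_j)
∏_{j=k+2}^n (1+z_j)`, where `F_{π₀}(w) = Σ_{a ∈ NC_k⁺} C̃_{π₀,a} ∏_j w_j^{2j-a_j}`. -/
theorem submatching_coeff_formula (k : ℕ) (hk : 1 ≤ k) (π₀ : NCM k)
    (n : ℕ) (hn : k + 1 ≤ n)
    (Ψ : NCM n → MvPolynomial (Fin (2 * n)) ℂ)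
    (hwheel : ∀ π, IsWheel n (Ψ π))
    (hdual : ∀ π σ : NCM n, evalNC (Ψ π) σ = if σ = π then 1 else 0) :
    (∑ π : NCM n, if inE π₀ π then evalOne (Ψ π) else 0) =
      coeff (Finsupp.equivFunOnFinite.symm fun i : Fin n => 2 * (i : ℕ))
        ((∑ σ : NCM k, Ctilde k π₀ σ •
            ∏ j : Fin k,
              (X (⟨(j : ℕ) + 1, by have := j.isLt; omega⟩ : Fin n) :
                  MvPolynomial (Fin n) ℂ) ^ (2 * ((j : ℕ) + 1) - plus σ j)) *
          (∏ i : Fin n, ∏ j : Fin n,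
            if i < j then (X j - X i) * (1 + X j + X i * X j) else 1) *
          ∏ j : Fin n, if k + 1 ≤ (j : ℕ) then 1 + X j else 1) := by
  have hδ : (q - q⁻¹) ^ (n * (n - 1)) ≠ 0 := pow_ne_zero _ q_sub_inv
  have h1 := congrArg (fun p => evalOne (n := n) p) (main_identity hn π₀ Ψ hwheel hdual)
  have e1 : ∀ σ s, eval (fun _ => (1 : ℂ)) (PhiP (aS (k := k) (n := n) σ s)) =
      (q - q⁻¹) ^ (n * (n - 1)) *
        coeff (Finsupp.equivFunOnFinite.symm fun i => aS σ s i - 1) (Gp n) := fun σ s =>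
    PhiP_one _ (aS_ge σ s) (fun i => by have := aS_le σ s i; have := i.isLt; omega)
  unfold evalOne at h1
  simp only [map_sub, map_sum, smul_eval, e1, map_zero, ite_mul, one_mul, zero_mul] at h1
  rw [sub_eq_zero] at h1
  unfold evalOne
  apply mul_left_cancel₀ hδ
  rw [← h1]
  change _ = _ * coeff _ (_ * Gp n * _)
  rw [Finset.sum_mul, Finset.sum_mul, coeff_sum, Finset.mul_sum]
  apply Finset.sum_congr rfl
  intro σ _
  rw [smul_mul_assoc, smul_mul_assoc, coeff_smul, coeff_aS hn σ, smul_eq_mul, ← Finset.mul_sum]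
  ring
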